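/- arXiv:2304.11991 — 4 statements merged into one kernel-verified Lean document; each statement's English description precedes it below -/
import Mathlib

section
/- Let n, r ∈ ℕ with gcd(n,r) = 1 and n > r, and let integers a_j ∈ ℤ be given for 1 ≤ j ≤ n−1 with j ≠ r. Then there is a constant c(n), depending only on n, such that for all but at most c(n) integers a_r, the polynomial x^n + a_1 x^{n−1} + ⋯ + a_{n−1} x + t has Galois group S_n over the rational function field ℚ(t). -/
open Polynomial

attribute [local instance] Polynomial.Gal.splits_ℚ_ℂ

noncomputable section

/-- The Galois group of `f` over `F`, acting on the roots of `f` in a splitting field. -/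
def galPermHom {F : Type*} [Field F] (f : Polynomial F) :
    f.Gal →* Equiv.Perm (f.rootSet f.SplittingField) :=
  @Polynomial.Gal.galActionHom F _ f f.SplittingField _ _ ⟨SplittingField.splits f⟩

/-- The Galois group of `f` over `F` is the full symmetric group on the roots of `f`. -/
def GalIsSymm {F : Type*} [Field F] (f : Polynomial F) : Prop :=
  Function.Bijective (galPermHom f)

/-- Under the identification `e` of the roots of `f` with `Fin n`, the image of the
Galois group of `f` over `F` in `Perm (Fin n)` is exactly `G`. -/
def GalGroupIs {F : Type*} [Field F] {n : ℕ} (f : Polynomial F)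
    (e : f.rootSet f.SplittingField ≃ Fin n)
    (G : Subgroup (Equiv.Perm (Fin n))) : Prop :=
  ∀ σ : Equiv.Perm (Fin n),
    σ ∈ G ↔ ∃ g : f.Gal, Equiv.permCongr e (galPermHom f g) = σ

/-- Under the identification `e` of the complex roots of `f ∈ ℚ[x]` with `Fin n`, the
image of the Galois group of `f` over `ℚ` in `Perm (Fin n)` is exactly `G`. -/
def QGalGroupIs {n : ℕ} (f : Polynomial ℚ) (e : f.rootSet ℂ ≃ Fin n)
    (G : Subgroup (Equiv.Perm (Fin n))) : Prop :=
  ∀ σ : Equiv.Perm (Fin n),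
    σ ∈ G ↔ ∃ g : f.Gal, Equiv.permCongr e (Polynomial.Gal.galActionHom f ℂ g) = σ

end

noncomputable section

/-- The polynomial `xⁿ + a₁xⁿ⁻¹ + ⋯ + a_{n−1}x + t` over `ℚ(t)`, where the coefficient
`a_r` has been replaced by `b`. -/
def oneParamPoly (n r : ℕ) (a : ℕ → ℤ) (b : ℤ) : Polynomial (RatFunc ℚ) :=
  X ^ n +
    (∑ j ∈ Finset.Icc 1 (n - 1),
      C (((if j = r then b else a j) : ℤ) : RatFunc ℚ) * X ^ (n - j)) +
    C (RatFunc.X : RatFunc ℚ)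

namespace Polynomial

/-- The `i`-th digit of `f` in base `v`. -/
def digitBase {R : Type*} [CommRing R] (v f : R[X]) (i : ℕ) : R[X] :=
  ((· /ₘ v)^[i] f) %ₘ v

section CommRing

variable {R S : Type*} [CommRing R] [CommRing S]

lemma map_iterate_divByMonic (φ : R →+* S) {v : R[X]} (hv : v.Monic) (f : R[X]) (i : ℕ) :
    ((· /ₘ v)^[i] f).map φ = (· /ₘ v.map φ)^[i] (f.map φ) := by
  induction i generalizing f with
  | zero => rfl
  | succ i ih => simp only [Function.iterate_succ_apply, ih, map_divByMonic φ hv]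

lemma map_digitBase (φ : R →+* S) {v : R[X]} (hv : v.Monic) (f : R[X]) (i : ℕ) :
    (digitBase v f i).map φ = digitBase (v.map φ) (f.map φ) i := by
  rw [digitBase, digitBase, map_modByMonic φ hv, map_iterate_divByMonic φ hv]

lemma comp_eq_C_add_mul_divX_comp (u v : R[X]) :
    C (u.coeff 0) + v * u.divX.comp v = u.comp v := by
  conv_rhs => rw [← divX_mul_X_add u]
  simp only [add_comp, mul_comp, X_comp, C_comp]
  ring

lemma exists_eq_comp_iff_digitBase {v : R[X]} (hv : v.Monic) (hd : 0 < v.natDegree) (f : R[X]) :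
    (∃ u : R[X], f = u.comp v) ↔ ∀ i j, 0 < j → (digitBase v f i).coeff j = 0 := by
  nontriviality R
  have hdeg : ∀ c : R, (C c).degree < v.degree := fun c =>
    degree_C_le.trans_lt (natDegree_pos_iff_degree_pos.mp hd)
  constructor
  · rintro ⟨u, rfl⟩ i j hj
    have key : ∀ u : R[X], (u.comp v) /ₘ v = u.divX.comp v ∧ (u.comp v) %ₘ v = C (u.coeff 0) :=
      fun u => div_modByMonic_unique _ _ hv ⟨comp_eq_C_add_mul_divX_comp u v, hdeg _⟩
    have iter : (· /ₘ v)^[i] (u.comp v) = (divX^[i] u).comp v := by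
      induction i generalizing u with
      | zero => rfl
      | succ i ih => simp only [Function.iterate_succ_apply, (key _).1, ih]
    rw [digitBase, iter, (key _).2, coeff_C_of_ne_zero hj.ne']
  · intro h
    induction hn : f.natDegree using Nat.strong_induction_on generalizing f with
    | _ n ih =>
      have h0 : f %ₘ v = C ((f %ₘ v).coeff 0) := by
        ext j
        rcases Nat.eq_zero_or_pos j with rfl | hj
        · simp
        · rw [coeff_C_of_ne_zero hj.ne']
          exact h 0 j hj
      have hf := modByMonic_add_div f v
      by_cases hlt : f.natDegree < v.natDegree
      · exact ⟨C ((f %ₘ v).coeff 0), by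
          rw [C_comp, ← h0, (modByMonic_eq_self_iff hv).2 (degree_lt_degree hlt)]⟩
      · obtain ⟨u, hu⟩ := ih (f /ₘ v).natDegree (by rw [natDegree_divByMonic _ hv]; omega)
          (f /ₘ v) (fun i j hj => h (i + 1) j hj) rfl
        refine ⟨C ((f %ₘ v).coeff 0) + X * u, ?_⟩
        rw [add_comp, C_comp, mul_comp, X_comp, ← h0, ← hu, hf]

lemma coeff_sum_pow_mul_pow {v w : R[X]} (hv : v.Monic) (hw : w.Monic) {d : ℕ}
    (hvd : v.natDegree = d) (hwd : w.natDegree = d) (k : ℕ) :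
    (∑ i ∈ Finset.range k, v ^ i * w ^ (k - 1 - i)).coeff (d * (k - 1)) = k ∧
      (∑ i ∈ Finset.range k, v ^ i * w ^ (k - 1 - i)).natDegree ≤ d * (k - 1) := by
  have hdeg : ∀ i ∈ Finset.range k, (v ^ i * w ^ (k - 1 - i)).natDegree = d * (k - 1) := by
    intro i hi
    rw [(hv.pow i).natDegree_mul (hw.pow _), hv.natDegree_pow, hw.natDegree_pow, hvd, hwd,
      mul_comm i, mul_comm (k - 1 - i), ← mul_add]
    congr 1
    have := Finset.mem_range.1 hi
    omega
  refine ⟨?_, natDegree_sum_le_of_forall_le _ _ fun i hi => (hdeg i hi).le⟩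
  rw [finsetSum_coeff, Finset.sum_congr rfl (g := fun _ => (1 : R))]
  · simp
  · intro i hi
    rw [← hdeg i hi]
    exact ((hv.pow i).mul (hw.pow _)).coeff_natDegree

/-- Over a `ℚ`-algebra a monic polynomial of degree `d * k` has an approximate `k`-th root. -/
lemma exists_approx_root [Algebra ℚ R] {f : R[X]} (hf : f.Monic) {d k : ℕ} (hd : 0 < d)
    (hk : 0 < k) (hfd : f.natDegree = d * k) :
    ∃ v : R[X], v.Monic ∧ v.natDegree = d ∧ ∀ m, d * (k - 1) < m → f.coeff m = (v ^ k).coeff m := by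
  have : Nontrivial R := by
    by_contra h
    rw [not_nontrivial_iff_subsingleton] at h
    rw [natDegree_of_subsingleton] at hfd
    exact (Nat.mul_pos hd hk).ne hfd
  have hdk : d * k = d * (k - 1) + d := by
    obtain ⟨k, rfl⟩ : ∃ l, k = l + 1 := ⟨k - 1, by omega⟩
    simp; ring
  suffices H : ∀ j, j < d → ∃ v : R[X], v.Monic ∧ v.natDegree = d ∧
      ∀ m, d * k - j ≤ m → f.coeff m = (v ^ k).coeff m by
    obtain ⟨v, h1, h2, h3⟩ := H (d - 1) (by omega)
    exact ⟨v, h1, h2, fun m hm => h3 m (by omega)⟩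
  intro j
  induction j with
  | zero =>
    refine fun _ => ⟨X ^ d, monic_X_pow d, natDegree_X_pow d, fun m hm => ?_⟩
    rw [← pow_mul, coeff_X_pow]
    split_ifs with h
    · rw [h, ← hfd]; exact hf
    · exact coeff_eq_zero_of_natDegree_lt (by omega)
  | succ j ih =>
    intro hj
    obtain ⟨v, hv, hvd, hvc⟩ := ih (by omega)
    set c : R := f.coeff (d * k - (j + 1)) - (v ^ k).coeff (d * k - (j + 1)) with hc
    set δ : R[X] := C (algebraMap ℚ R (k : ℚ)⁻¹ * c) * X ^ (d - (j + 1)) with hδ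
    have hδd : δ.degree < v.degree := by
      rw [degree_eq_natDegree hv.ne_zero, hvd]
      exact (degree_C_mul_X_pow_le _ _).trans_lt (by exact_mod_cast (by omega))
    have hw : (v + δ).Monic := hv.add_of_left hδd
    have hwd : (v + δ).natDegree = d := by rw [natDegree_add_eq_left_of_degree_lt hδd, hvd]
    refine ⟨v + δ, hw, hwd, fun m hm => ?_⟩
    have hsub : (v + δ) ^ k = v ^ k + C (algebraMap ℚ R (k : ℚ)⁻¹ * c) *
        ((∑ i ∈ Finset.range k, (v + δ) ^ i * v ^ (k - 1 - i)) * X ^ (d - (j + 1))) := by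
      have := (Commute.all (v + δ) v).mul_geom_sum₂ k
      rw [add_sub_cancel_left] at this
      rw [← sub_eq_iff_eq_add', ← this, hδ]
      ring
    obtain ⟨hs1, hs2⟩ := coeff_sum_pow_mul_pow hw hv hwd hvd k
    rw [hsub, coeff_add, coeff_C_mul, coeff_mul_X_pow', if_pos (by omega)]
    rcases eq_or_lt_of_le hm with hm | hm
    · rw [show m - (d - (j + 1)) = d * (k - 1) by omega, hs1, ← hm,
        mul_right_comm, show (k : R) = algebraMap ℚ R k by simp, ← map_mul,
        inv_mul_cancel₀ (by exact_mod_cast hk.ne'), map_one, one_mul, hc]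
      ring
    · rw [coeff_eq_zero_of_natDegree_lt (n := m - (d - (j + 1))) (by omega), mul_zero, add_zero]
      exact hvc m (by omega)

end CommRing

section Field

variable {F : Type*} [Field F]

lemma exists_eq_add_C_of_coeff_pow_eq [CharZero F] {v w : F[X]} (hv : v.Monic) (hw : w.Monic)
    {d k : ℕ} (hk : 0 < k) (hvd : v.natDegree = d) (hwd : w.natDegree = d)
    (h : ∀ m, d * (k - 1) < m → (v ^ k).coeff m = (w ^ k).coeff m) : ∃ c, v = w + C c := by
  obtain ⟨h1, h2⟩ := coeff_sum_pow_mul_pow hv hw hvd hwd k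
  set s := ∑ i ∈ Finset.range k, v ^ i * w ^ (k - 1 - i)
  have hk0 : (k : F) ≠ 0 := by exact_mod_cast hk.ne'
  have hs : s.natDegree = d * (k - 1) :=
    le_antisymm h2 (le_natDegree_of_ne_zero (by rw [h1]; exact hk0))
  have hs0 : s ≠ 0 := by rintro hs0; rw [hs0, coeff_zero] at h1; exact hk0 h1.symm
  suffices hz : (v - w).natDegree = 0 by
    obtain ⟨c, hc⟩ := natDegree_eq_zero.1 hz
    exact ⟨c, by rw [hc]; ring⟩
  by_contra hne
  have hvw : v - w ≠ 0 := by rintro h0; simp [h0] at hne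
  have hmul := (Commute.all v w).mul_geom_sum₂ k
  have hdeg : (v ^ k - w ^ k).natDegree = (v - w).natDegree + d * (k - 1) := by
    rw [← hmul, natDegree_mul hvw hs0, hs]
  have hne0 : v ^ k - w ^ k ≠ 0 := by rw [← hmul]; exact mul_ne_zero hvw hs0
  have := leadingCoeff_ne_zero.2 hne0
  rw [leadingCoeff, coeff_sub, h _ (by omega), sub_self] at this
  exact this rfl

lemma coeff_comp_eq_coeff_pow {u v : F[X]} (hu : u.Monic) (hk : 0 < u.natDegree)
    {m : ℕ} (hm : v.natDegree * (u.natDegree - 1) < m) :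
    (u.comp v).coeff m = (v ^ u.natDegree).coeff m := by
  have h : u.comp v = v ^ u.natDegree + (u - X ^ u.natDegree).comp v := by simp
  rw [h, coeff_add, add_eq_left]
  apply coeff_eq_zero_of_natDegree_lt
  rw [natDegree_comp, mul_comm]
  refine lt_of_le_of_lt (Nat.mul_le_mul_left _ ?_) hm
  have hlt : (u - X ^ u.natDegree).natDegree < u.natDegree := by
    have := degree_sub_lt_left (p := u) (q := X ^ u.natDegree)
      (by rw [degree_X_pow, degree_eq_natDegree hu.ne_zero]) hu.ne_zero (by simp [hu.leadingCoeff])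
    by_cases h0 : u - X ^ u.natDegree = 0
    · rw [h0]; simpa
    · exact natDegree_lt_natDegree h0 this
  omega

lemma monic_of_monic_comp {u v : F[X]} (hv : v.Monic) (hd : 0 < v.natDegree)
    (h : (u.comp v).Monic) : u.Monic := by
  have := leadingCoeff_comp (p := u) (q := v) hd.ne'
  rw [h.leadingCoeff, hv.leadingCoeff, one_pow, mul_one] at this
  exact this.symm

end Field

section CriticalPoints

/-- The normalised resultant `n⁻ⁿ Res_x(f'(x), T - f(x))`, whose roots are the critical values
of a monic polynomial `f` of degree `n`. -/
def critValPoly {R : Type*} [CommRing R] [Algebra ℚ R] (n : ℕ) (f : R[X]) : R[X] :=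
  C (algebraMap ℚ R ((n : ℚ) ^ n)⁻¹) *
    resultant ((derivative f).map C) (C X - f.map C) (n - 1) n

lemma map_critValPoly {R S : Type*} [CommRing R] [CommRing S] [Algebra ℚ R] [Algebra ℚ S]
    (φ : R →+* S) (n : ℕ) (f : R[X]) :
    (critValPoly n f).map φ = critValPoly n (f.map φ) := by
  have hφ : ∀ q : ℚ, φ (algebraMap ℚ R q) = algebraMap ℚ S q := fun q =>
    DFunLike.congr_fun (Subsingleton.elim (φ.comp (algebraMap ℚ R)) (algebraMap ℚ S)) q
  have hC : (mapRingHom φ).comp C = C.comp φ := by ext; simp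
  rw [critValPoly, critValPoly, Polynomial.map_mul, map_C, hφ, ← coe_mapRingHom,
    ← resultant_map_map]
  have e1 : ((derivative f).map C).map (mapRingHom φ) = (derivative (f.map φ)).map C := by
    rw [map_map, hC, ← map_map, derivative_map]
  have e2 : (C X - f.map C).map (mapRingHom φ) = C X - (f.map φ).map C := by
    rw [Polynomial.map_sub, map_map, hC, ← map_map, map_C, coe_mapRingHom, map_X]
  rw [e1, e2, coe_mapRingHom]

variable {k : Type*} [Field k]

/-- Some critical point is nondegenerate and is the only critical point with its critical
value. -/
def HasIsolatedCritPoint (f : k[X]) : Prop :=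
  ∃ c, f.derivative.eval c = 0 ∧ f.derivative.derivative.eval c ≠ 0 ∧
    ∀ e, f.derivative.eval e = 0 → f.eval e = f.eval c → e = c

variable [CharZero k] [IsAlgClosed k]

lemma critValPoly_eq_prod {n : ℕ} {f : k[X]} (hf : f.Monic) (hfn : f.natDegree = n) (hn : 0 < n) :
    critValPoly n f = (f.derivative.roots.map fun c => X - C (f.eval c)).prod := by
  have hn0 : (n : k) ≠ 0 := by exact_mod_cast hn.ne'
  have hd : f.derivative.natDegree = n - 1 := by rw [natDegree_derivative, hfn]
  have hl : f.derivative.leadingCoeff = n := by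
    rw [leadingCoeff_derivative, hf.leadingCoeff, hfn]; simp
  have hs : (f.derivative.map (C : k →+* k[X])).Splits := (IsAlgClosed.splits _).map _
  have hdeg : (C X - f.map (C : k →+* k[X])).natDegree ≤ n := by
    refine (natDegree_sub_le _ _).trans ?_
    simp [natDegree_map_eq_of_injective C_injective, hfn]
  have key := resultant_eq_prod_eval (f.derivative.map (C : k →+* k[X])) (C X - f.map C) n hdeg hs
  rw [natDegree_map_eq_of_injective C_injective, hd, leadingCoeff_map_of_injective C_injective,
    hl, (IsAlgClosed.splits f.derivative).roots_map_of_injective C_injective] at key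
  rw [critValPoly, key, ← mul_assoc, ← C_pow, ← C_mul]
  simp [hn0, Multiset.map_map]

lemma monic_critValPoly {n : ℕ} {f : k[X]} (hf : f.Monic) (hfn : f.natDegree = n) (hn : 0 < n) :
    (critValPoly n f).Monic := by
  rw [critValPoly_eq_prod hf hfn hn]
  exact monic_multiset_prod_of_monic _ _ fun c _ => monic_X_sub_C _

lemma natDegree_critValPoly {n : ℕ} {f : k[X]} (hf : f.Monic) (hfn : f.natDegree = n)
    (hn : 0 < n) : (critValPoly n f).natDegree = n - 1 := by
  have h := natDegree_multiset_prod_X_sub_C_eq_card (f.derivative.roots.map f.eval)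
  rw [Multiset.map_map, Multiset.card_map, ← (IsAlgClosed.splits _).natDegree_eq_card_roots] at h
  rw [critValPoly_eq_prod hf hfn hn]
  exact h.trans (by rw [natDegree_derivative, hfn])

lemma dvd_derivative_sq_iff {D : k[X]} (hD : D ≠ 0) :
    D ∣ derivative D ^ 2 ↔ ∀ t, D.eval t = 0 → (derivative D).eval t = 0 := by
  classical
  constructor
  · intro h t ht
    have := eval_dvd (x := t) h
    rwa [ht, zero_dvd_iff, eval_pow, sq_eq_zero_iff] at this
  · intro h
    by_cases h0 : derivative D = 0
    · simp [h0]
    rw [(IsAlgClosed.splits D).dvd_iff_roots_le_roots hD (pow_ne_zero _ h0), Multiset.le_iff_count]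
    intro t
    rw [roots_pow, Multiset.count_nsmul, count_roots, count_roots]
    by_cases ht : D.IsRoot t
    · rw [derivative_rootMultiplicity_of_root ht]
      have : 0 < rootMultiplicity t (derivative D) := (rootMultiplicity_pos h0).2 (h t ht)
      rw [derivative_rootMultiplicity_of_root ht] at this
      omega
    · simp [rootMultiplicity_eq_zero ht]

lemma hasIsolatedCritPoint_iff {n : ℕ} {f : k[X]} (hf : f.Monic) (hfn : f.natDegree = n)
    (hn : 0 < n) :
    HasIsolatedCritPoint f ↔ derivative (critValPoly n f) ^ 2 %ₘ critValPoly n f ≠ 0 := by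
  classical
  have hn0 : (n : k) ≠ 0 := by exact_mod_cast hn.ne'
  have hf0 : f.derivative ≠ 0 := by
    rw [← leadingCoeff_ne_zero, leadingCoeff_derivative, hf.leadingCoeff, hfn]; simpa using hn.ne'
  have hmonic := monic_critValPoly hf hfn hn
  have hder : ∀ c ∈ f.derivative.roots, (derivative (critValPoly n f)).eval (f.eval c) =
      ((f.derivative.roots.erase c).map fun e => f.eval c - f.eval e).prod := by
    intro c hc
    rw [critValPoly_eq_prod hf hfn hn]
    conv_lhs => rw [← Multiset.cons_erase hc]
    simp [derivative_mul, eval_multiset_prod, Multiset.map_map]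
  rw [Ne, modByMonic_eq_zero_iff_dvd hmonic, dvd_derivative_sq_iff hmonic.ne_zero]
  push Not
  have hcount : ∀ c ∈ f.derivative.roots,
      (c ∉ f.derivative.roots.erase c ↔ f.derivative.derivative.eval c ≠ 0) := by
    intro c hc
    have hc' : f.derivative.IsRoot c := isRoot_of_mem_roots hc
    have := one_lt_rootMultiplicity_iff_isRoot hf0 (t := c)
    rw [← Multiset.count_pos, Multiset.count_erase_self, count_roots]
    change _ ↔ ¬ (derivative (derivative f)).IsRoot c
    have : ¬ (0 < rootMultiplicity c (derivative f) - 1) ↔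
        ¬ 1 < rootMultiplicity c (derivative f) := by omega
    simp_all
  constructor
  · rintro ⟨c, hc, hc2, huniq⟩
    have hcr : c ∈ f.derivative.roots := (mem_roots hf0).2 hc
    refine ⟨f.eval c, ?_, ?_⟩
    · rw [critValPoly_eq_prod hf hfn hn, eval_multiset_prod, Multiset.prod_eq_zero_iff]
      simp only [Multiset.map_map, Multiset.mem_map]
      exact ⟨c, hcr, by simp⟩
    · rw [hder c hcr, Ne, Multiset.prod_eq_zero_iff, Multiset.mem_map]
      rintro ⟨e, he, hfe⟩
      have hec := huniq e (isRoot_of_mem_roots (Multiset.mem_of_mem_erase he))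
        (sub_eq_zero.1 hfe).symm
      subst hec
      exact (hcount e hcr).2 hc2 he
  · rintro ⟨t, ht, ht'⟩
    rw [critValPoly_eq_prod hf hfn hn, eval_multiset_prod, Multiset.prod_eq_zero_iff] at ht
    simp only [Multiset.map_map, Multiset.mem_map, Function.comp_apply, eval_sub, eval_X,
      eval_C, sub_eq_zero] at ht
    obtain ⟨c, hcr, rfl⟩ := ht
    rw [hder c hcr, Ne, Multiset.prod_eq_zero_iff, Multiset.mem_map] at ht'
    push Not at ht'
    refine ⟨c, isRoot_of_mem_roots hcr, (hcount c hcr).1 fun h => ht' c h (sub_self _), ?_⟩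
    intro e he hec
    by_contra hne
    exact ht' e ((Multiset.mem_erase_of_ne hne).2 ((mem_roots hf0).2 he)) (by rw [hec, sub_self])

end CriticalPoints

section Generic

/-- The polynomial `f` is not a composition of polynomials of smaller degree. -/
def IsIndecomposable {k : Type*} [Field k] (f : k[X]) : Prop :=
  ∀ u v : k[X], v.Monic → f = u.comp v → v.natDegree = 1 ∨ v.natDegree = f.natDegree

variable {k : Type*} [Field k]

variable (k) in
/-- The generic monic polynomial of degree `n`. -/
def genericMonic (n : ℕ) : (MvPolynomial (Fin n) k)[X] :=
  X ^ n + ∑ i : Fin n, C (MvPolynomial.X i) * X ^ (i : ℕ)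

lemma monic_genericMonic (n : ℕ) : (genericMonic k n).Monic :=
  monic_X_pow_add (degree_sum_fin_lt _)

lemma natDegree_genericMonic (n : ℕ) : (genericMonic k n).natDegree = n := by
  rw [genericMonic, natDegree_add_eq_left_of_degree_lt, natDegree_X_pow]
  rw [degree_X_pow]
  exact degree_sum_fin_lt _

lemma map_eval_genericMonic {n : ℕ} {f : k[X]} (hf : f.Monic) (hfn : f.natDegree = n) :
    (genericMonic k n).map (MvPolynomial.eval fun i : Fin n => f.coeff i) = f := by
  conv_rhs => rw [hf.as_sum, hfn, ← Fin.sum_univ_eq_sum_range fun i => C (f.coeff i) * X ^ i]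
  simp [genericMonic, Polynomial.map_sum]

variable [CharZero k] [IsAlgClosed k]

lemma monic_critValPoly_genericMonic {n : ℕ} (hn : 0 < n) :
    (critValPoly n (genericMonic k n)).Monic := by
  have hmap : ∀ (a : Fin n → k) (j : ℕ),
      MvPolynomial.eval a ((critValPoly n (genericMonic k n)).coeff j) =
        (critValPoly n ((genericMonic k n).map (MvPolynomial.eval a))).coeff j := fun a j => by
    rw [← map_critValPoly, coeff_map]
  have hm : ∀ a : Fin n → k, ((genericMonic k n).map (MvPolynomial.eval a)).Monic := fun a =>
    (monic_genericMonic n).map _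
  have hd : ∀ a : Fin n → k, ((genericMonic k n).map (MvPolynomial.eval a)).natDegree = n :=
    fun a => by rw [(monic_genericMonic n).natDegree_map, natDegree_genericMonic]
  refine monic_of_natDegree_le_of_coeff_eq_one (n - 1) ?_ ?_
  · refine natDegree_le_iff_coeff_eq_zero.2 fun j hj => MvPolynomial.funext fun a => ?_
    rw [hmap, map_zero]
    exact coeff_eq_zero_of_natDegree_lt (by rwa [natDegree_critValPoly (hm a) (hd a) hn])
  · refine MvPolynomial.funext fun a => ?_
    rw [hmap, map_one]
    have := monic_critValPoly (hm a) (hd a) hn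
    rwa [Monic, leadingCoeff, natDegree_critValPoly (hm a) (hd a) hn] at this

lemma exists_mvPolynomial_hasIsolatedCritPoint {n : ℕ} (hn : 0 < n) {f₀ : k[X]} (hf₀ : f₀.Monic)
    (hfn : f₀.natDegree = n) (h : HasIsolatedCritPoint f₀) :
    ∃ P : MvPolynomial (Fin n) k, P.eval (fun i : Fin n => f₀.coeff i) ≠ 0 ∧
      ∀ f : k[X], f.Monic → f.natDegree = n → P.eval (fun i : Fin n => f.coeff i) ≠ 0 →
        HasIsolatedCritPoint f := by
  set D := critValPoly n (genericMonic k n) with hD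
  have hmap : ∀ f : k[X], f.Monic → f.natDegree = n →
      (derivative D ^ 2 %ₘ D).map (MvPolynomial.eval fun i : Fin n => f.coeff i) =
        derivative (critValPoly n f) ^ 2 %ₘ critValPoly n f := fun f hf hfn => by
    rw [map_modByMonic _ (monic_critValPoly_genericMonic hn), Polynomial.map_pow,
      ← derivative_map, hD, map_critValPoly, map_eval_genericMonic hf hfn]
  rw [hasIsolatedCritPoint_iff hf₀ hfn hn, ← hmap f₀ hf₀ hfn] at h
  obtain ⟨j, hj⟩ : ∃ j, ((derivative D ^ 2 %ₘ D).map
      (MvPolynomial.eval fun i : Fin n => f₀.coeff i)).coeff j ≠ 0 := by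
    by_contra! h'
    exact h (Polynomial.ext (by simpa using h'))
  refine ⟨(derivative D ^ 2 %ₘ D).coeff j, by rwa [coeff_map] at hj, fun f hf hfn hne => ?_⟩
  rw [hasIsolatedCritPoint_iff hf hfn hn, ← hmap f hf hfn]
  intro h0
  rw [← coeff_map, h0, coeff_zero] at hne
  exact hne rfl

omit [IsAlgClosed k] in
lemma exists_mvPolynomial_forall_ne_comp {n d : ℕ} (hn : 0 < n) (hd : 0 < d) (hdn : d ∣ n)
    {f₀ : k[X]} (hf₀ : f₀.Monic) (hfn : f₀.natDegree = n)
    (h : ∀ u v : k[X], v.Monic → v.natDegree = d → f₀ ≠ u.comp v) :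
    ∃ P : MvPolynomial (Fin n) k, P.eval (fun i : Fin n => f₀.coeff i) ≠ 0 ∧
      ∀ f : k[X], f.Monic → f.natDegree = n → P.eval (fun i : Fin n => f.coeff i) ≠ 0 →
        ∀ u v : k[X], v.Monic → v.natDegree = d → f ≠ u.comp v := by
  obtain ⟨l, hl⟩ := hdn
  have hl0 : 0 < l := Nat.pos_of_ne_zero fun h => by simp [h] at hl; omega
  obtain ⟨V, hV, hVd, hVc⟩ := exists_approx_root (monic_genericMonic (k := k) n) hd hl0
    (by rw [natDegree_genericMonic, hl])
  have hVm : ∀ f : k[X], (V.map (MvPolynomial.eval fun i : Fin n => f.coeff i)).natDegree = d :=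
    fun f => by rw [hV.natDegree_map, hVd]
  have key := fun f : k[X] => exists_eq_comp_iff_digitBase
    (hV.map (MvPolynomial.eval fun i : Fin n => f.coeff i)) (by rw [hVm]; exact hd) f
  have hne : ¬ ∃ u : k[X], f₀ = u.comp (V.map (MvPolynomial.eval fun i : Fin n => f₀.coeff i)) := by
    rintro ⟨u, hu⟩
    exact h u _ (hV.map _) (hVm f₀) hu
  rw [key] at hne
  push Not at hne
  obtain ⟨i, j, hj, hij⟩ := hne
  have hmap : ∀ f : k[X], f.Monic → f.natDegree = n →
      ((digitBase V (genericMonic k n) i).coeff j).eval (fun i : Fin n => f.coeff i) =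
      (digitBase (V.map (MvPolynomial.eval fun i : Fin n => f.coeff i)) f i).coeff j :=
    fun f hf hfn => by
      rw [← coeff_map, map_digitBase _ hV, map_eval_genericMonic hf hfn]
  refine ⟨(digitBase V (genericMonic k n) i).coeff j, by rwa [hmap f₀ hf₀ hfn], ?_⟩
  intro f hf hfn hfP u v hv hvd hfu
  rw [hmap f hf hfn] at hfP
  have hu : u.Monic := monic_of_monic_comp hv (by omega) (hfu ▸ hf)
  have hud : u.natDegree = l := by
    have := congrArg natDegree hfu
    rw [natDegree_comp, hfn, hl, hvd, mul_comm] at this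
    exact (Nat.eq_of_mul_eq_mul_right hd this).symm
  obtain ⟨c, hc⟩ := exists_eq_add_C_of_coeff_pow_eq hv
    (hV.map (MvPolynomial.eval fun i : Fin n => f.coeff i)) hl0 hvd (hVm f) fun m hm => by
      rw [← hud, ← coeff_comp_eq_coeff_pow hu (by omega) (by rw [hvd, hud]; exact hm), ← hfu, hud,
        ← Polynomial.map_pow, coeff_map, ← hVc m hm, ← coeff_map, map_eval_genericMonic hf hfn]
  refine hfP ((key f).1 ⟨u.comp (X + C c), ?_⟩ i j hj)
  rw [comp_assoc, add_comp, X_comp, C_comp, ← hc, hfu]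

omit [IsAlgClosed k] in
lemma exists_mvPolynomial_isIndecomposable {n : ℕ} (hn : 0 < n) {f₀ : k[X]} (hf₀ : f₀.Monic)
    (hfn : f₀.natDegree = n) (h : IsIndecomposable f₀) :
    ∃ P : MvPolynomial (Fin n) k, P.eval (fun i : Fin n => f₀.coeff i) ≠ 0 ∧
      ∀ f : k[X], f.Monic → f.natDegree = n → P.eval (fun i : Fin n => f.coeff i) ≠ 0 →
        IsIndecomposable f := by
  have key : ∀ d : n.divisors, ∃ P : MvPolynomial (Fin n) k,
      P.eval (fun i : Fin n => f₀.coeff i) ≠ 0 ∧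
      ∀ f : k[X], f.Monic → f.natDegree = n → P.eval (fun i : Fin n => f.coeff i) ≠ 0 →
        ∀ u v : k[X], v.Monic → v.natDegree = d → f = u.comp v → (d : ℕ) = 1 ∨ (d : ℕ) = n := by
    intro d
    by_cases hd : (d : ℕ) = 1 ∨ (d : ℕ) = n
    · exact ⟨1, by simp, fun _ _ _ _ _ _ _ _ _ => hd⟩
    · obtain ⟨P, hP0, hP⟩ := exists_mvPolynomial_forall_ne_comp hn
        (Nat.pos_of_mem_divisors d.2) (Nat.dvd_of_mem_divisors d.2) hf₀ hfn
        fun u v hv hvd hu => hd (by simpa [hvd, hfn] using h u v hv hu)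
      exact ⟨P, hP0, fun f hf hfn hfP u v hv hvd hu => absurd hu (hP f hf hfn hfP u v hv hvd)⟩
  choose P hP0 hP using key
  refine ⟨∏ d, P d, by simpa [map_prod, Finset.prod_eq_zero_iff] using hP0, ?_⟩
  intro f hf hfn hfP u v hv hu
  rw [map_prod, Finset.prod_ne_zero_iff] at hfP
  have hmem : v.natDegree ∈ n.divisors := by
    refine Nat.mem_divisors.2 ⟨⟨u.natDegree, ?_⟩, hn.ne'⟩
    rw [← hfn, hu, natDegree_comp, mul_comm]
  rw [hfn]
  exact hP ⟨_, hmem⟩ f hf hfn (hfP _ (Finset.mem_univ _)) u v hv rfl hu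

end Generic

section Binomial

variable {k : Type*} [Field k]

lemma monic_X_pow_add_X_pow {n m : ℕ} (h : m < n) : (X ^ n + X ^ m : k[X]).Monic :=
  monic_X_pow_add (by rw [degree_X_pow]; exact_mod_cast h)

lemma natDegree_X_pow_add_X_pow {n m : ℕ} (h : m < n) : (X ^ n + X ^ m : k[X]).natDegree = n := by
  rw [natDegree_add_eq_left_of_degree_lt, natDegree_X_pow]
  rw [degree_X_pow, degree_X_pow]
  exact_mod_cast h

lemma derivative_X_pow_add_X_pow {m : ℕ} (r : ℕ) (hm : 0 < m) :
    derivative (X ^ (m + r) + X ^ m : k[X]) =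
      X ^ (m - 1) * (C ((m + r : ℕ) : k) * X ^ r + C (m : k)) := by
  obtain ⟨m, rfl⟩ := Nat.exists_eq_succ_of_ne_zero hm.ne'
  have : m + 1 + r - 1 = m + r := by omega
  simp only [derivative_add, derivative_X_pow, Nat.succ_eq_add_one, this]
  simp only [Nat.add_sub_cancel]
  ring

variable [CharZero k]

omit [CharZero k] in
lemma pow_eq_of_isRoot_derivative {m r : ℕ} (hm : 0 < m) {c : k}
    (hc : (derivative (X ^ (m + r) + X ^ m)).eval c = 0)
    (hc0 : (X ^ (m + r) + X ^ m).eval c ≠ 0) : c ≠ 0 ∧ ((m + r : ℕ) : k) * c ^ r = -m := by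
  have h0 : c ≠ 0 := by
    rintro rfl
    simp [hm.ne'] at hc0
  refine ⟨h0, ?_⟩
  rw [derivative_X_pow_add_X_pow r hm] at hc
  simp only [eval_mul, eval_pow, eval_X, eval_add, eval_C, mul_eq_zero, pow_eq_zero_iff', h0] at hc
  exact eq_neg_of_add_eq_zero_left (by simpa using hc)

lemma eval_derivative_derivative_ne_zero {m r : ℕ} (hm : 0 < m) (hr : 0 < r) {c : k}
    (hc : c ≠ 0) (h : ((m + r : ℕ) : k) * c ^ r = -m) :
    (derivative (derivative (X ^ (m + r) + X ^ m))).eval c ≠ 0 := by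
  have h1 : ((m + r : ℕ) : k) * c ^ r + m = 0 := by rw [h]; ring
  have hmr : ((m + r : ℕ) : k) ≠ 0 := by exact_mod_cast (by omega)
  have hr' : (r : k) ≠ 0 := by exact_mod_cast hr.ne'
  rw [derivative_X_pow_add_X_pow r hm, derivative_mul]
  simp only [eval_add, eval_mul, eval_C, eval_pow, eval_X, h1, mul_zero, zero_add, derivative_add,
    derivative_C, derivative_mul, derivative_X_pow, zero_mul, add_zero]
  exact mul_ne_zero (pow_ne_zero _ hc) (mul_ne_zero hmr (mul_ne_zero hr' (pow_ne_zero _ hc)))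

lemma eq_of_eval_X_pow_add_X_pow_eq {m r : ℕ} (hr : 0 < r) (hmr : m.Coprime r)
    {c e : k} (hc0 : c ≠ 0) (hc : ((m + r : ℕ) : k) * c ^ r = -m)
    (he : ((m + r : ℕ) : k) * e ^ r = -m)
    (h : (X ^ (m + r) + X ^ m).eval e = (X ^ (m + r) + X ^ m).eval c) : e = c := by
  have hmr0 : ((m + r : ℕ) : k) ≠ 0 := by exact_mod_cast (by omega)
  have hr' : (r : k) ≠ 0 := by exact_mod_cast hr.ne'
  have h1 : e ^ r = c ^ r := mul_left_cancel₀ hmr0 (he.trans hc.symm)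
  have h2 : e ^ m = c ^ m := by
    simp only [eval_add, eval_mul, eval_pow, eval_X, pow_add, h1] at h
    have h3 : c ^ r + 1 ≠ 0 := by
      intro h3
      apply hr'
      have : c ^ r = -1 := eq_neg_of_add_eq_zero_left h3
      rw [this] at hc
      push_cast at hc
      linear_combination -hc
    exact mul_right_cancel₀ h3 (by linear_combination h)
  have h3 : (e / c) ^ m.gcd r = 1 := pow_gcd_eq_one.2
    ⟨by rw [div_pow, h2, div_self (pow_ne_zero _ hc0)],
      by rw [div_pow, h1, div_self (pow_ne_zero _ hc0)]⟩
  rw [hmr, pow_one] at h3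
  exact (div_eq_one_iff_eq hc0).1 h3

variable [IsAlgClosed k]

lemma hasIsolatedCritPoint_X_pow_add_X_pow {m r : ℕ} (hm : 0 < m) (hr : 0 < r)
    (hmr : m.Coprime r) : HasIsolatedCritPoint (X ^ (m + r) + X ^ m : k[X]) := by
  have hmr0 : ((m + r : ℕ) : k) ≠ 0 := by exact_mod_cast (by omega)
  have hr' : (r : k) ≠ 0 := by exact_mod_cast hr.ne'
  have hm' : (m : k) ≠ 0 := by exact_mod_cast hm.ne'
  obtain ⟨c, hc⟩ := IsAlgClosed.exists_pow_nat_eq (-m / (m + r : ℕ) : k) hr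
  have hc' : ((m + r : ℕ) : k) * c ^ r = -m := by rw [hc]; field_simp
  have hc0 : c ≠ 0 := by
    rintro rfl
    simp [hr.ne', hm'] at hc'
  have hval : (X ^ (m + r) + X ^ m).eval c ≠ 0 := by
    have : ((m + r : ℕ) : k) * (X ^ (m + r) + X ^ m).eval c = c ^ m * r := by
      simp only [eval_add, eval_mul, eval_pow, eval_X, pow_add]
      push_cast at hc' ⊢
      linear_combination c ^ m * hc'
    intro h
    rw [h, mul_zero] at this
    exact mul_ne_zero (pow_ne_zero _ hc0) hr' this.symm
  refine ⟨c, ?_, eval_derivative_derivative_ne_zero hm hr hc0 hc', fun e he hec => ?_⟩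
  · rw [derivative_X_pow_add_X_pow r hm]
    simp [-Nat.cast_add, hc']
  · exact eq_of_eval_X_pow_add_X_pow_eq hr hmr hc0 hc'
      (pow_eq_of_isRoot_derivative hm he (by rwa [hec])).2 hec

/-- If every critical point of `u` is a root of `u`, then every root of `u` is a critical point. -/
lemma eval_derivative_eq_zero_of_forall {u : k[X]} (hu : 2 ≤ u.natDegree)
    (h : ∀ e, u.derivative.eval e = 0 → u.eval e = 0) {a : k} (ha : u.eval a = 0) :
    u.derivative.eval a = 0 := by
  classical
  have hu0 : u ≠ 0 := by rintro rfl; simp at hu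
  have hd : u.derivative.natDegree = u.natDegree - 1 := natDegree_derivative _
  have hd0 : u.derivative ≠ 0 := by intro h; rw [h, natDegree_zero] at hd; omega
  have hcard : ∀ p : k[X], Multiset.card p.roots = p.natDegree := fun p =>
    (IsAlgClosed.splits p).natDegree_eq_card_roots.symm
  have hsub : u.derivative.roots.toFinset ⊆ u.roots.toFinset := by
    intro e
    simp only [Multiset.mem_toFinset, mem_roots hd0, mem_roots hu0]
    exact h e
  have h1 := Multiset.sum_count_eq_card (s := u.roots.toFinset) (m := u.roots) (by simp)
  have h2 := Multiset.sum_count_eq_card (s := u.roots.toFinset) (m := u.derivative.roots)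
    fun e he => hsub (Multiset.mem_toFinset.2 he)
  have h3 : ∑ e ∈ u.roots.toFinset, u.roots.count e =
      ∑ e ∈ u.roots.toFinset, (u.derivative.roots.count e + 1) := by
    refine Finset.sum_congr rfl fun e he => ?_
    have he' : u.IsRoot e := by simpa [mem_roots hu0] using he
    have := (rootMultiplicity_pos hu0).2 he'
    rw [count_roots, count_roots, derivative_rootMultiplicity_of_root he']
    omega
  rw [Finset.sum_add_distrib, h2, h1, hcard, hcard, hd, Finset.sum_const, smul_eq_mul,
    mul_one] at h3
  have h4 : u.roots.toFinset.card = 1 := by omega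
  obtain ⟨b, hb⟩ := Finset.card_eq_one.1 h4
  obtain ⟨e, he⟩ := IsAlgClosed.exists_root u.derivative
    (by rw [degree_eq_natDegree hd0, hd]; exact_mod_cast (by omega))
  have hb' : ∀ x, u.eval x = 0 → x = b := fun x hx => by
    have : x ∈ u.roots.toFinset := by simpa [mem_roots hu0] using hx
    simpa [hb] using this
  rw [hb' a ha, ← hb' e (h e he)]
  exact he

lemma isIndecomposable_X_pow_add_X_pow {m r : ℕ} (hm : 0 < m) (hr : 0 < r)
    (hmr : m.Coprime r) : IsIndecomposable (X ^ (m + r) + X ^ m : k[X]) := by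
  intro u v hv huv
  have hr' : (r : k) ≠ 0 := by exact_mod_cast hr.ne'
  have hdeg : m + r = u.natDegree * v.natDegree := by
    rw [← natDegree_comp, ← huv, natDegree_X_pow_add_X_pow (by omega)]
  rw [natDegree_X_pow_add_X_pow (by omega)]
  by_contra! hd
  have hv0 : v.natDegree ≠ 0 := by rintro h; rw [h] at hdeg; omega
  have hu0 : u.natDegree ≠ 0 := by rintro h; rw [h] at hdeg; omega
  have hu1 : u.natDegree ≠ 1 := by rintro h; rw [h] at hdeg; omega
  have hder : ∀ x, (derivative (X ^ (m + r) + X ^ m)).eval x =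
      v.derivative.eval x * u.derivative.eval (v.eval x) := fun x => by
    rw [huv, derivative_comp, eval_mul, eval_comp]
  have hval : ∀ x, (X ^ (m + r) + X ^ m).eval x = u.eval (v.eval x) := fun x => by
    rw [huv, eval_comp]
  have hcrit : ∀ e, u.derivative.eval e = 0 → u.eval e = 0 := by
    intro e he
    by_contra hue
    have hvdeg : (v - C e).natDegree = v.natDegree := natDegree_sub_C
    have hvm : (v - C e).Monic := hv.sub_of_left (by
      refine degree_C_le.trans_lt ?_
      rw [degree_eq_natDegree hv.ne_zero]
      exact_mod_cast Nat.pos_of_ne_zero hv0)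
    obtain ⟨c, hc⟩ := IsAlgClosed.exists_root (v - C e)
      (by rw [degree_eq_natDegree hvm.ne_zero, hvdeg]; exact_mod_cast hv0)
    have hprop : ∀ x, (v - C e).IsRoot x →
        (X ^ (m + r) + X ^ m).eval x = u.eval e ∧ x ≠ 0 ∧ ((m + r : ℕ) : k) * x ^ r = -m := by
      intro x hx
      have hx' : v.eval x = e := by simpa [sub_eq_zero] using hx
      have h1 : (X ^ (m + r) + X ^ m).eval x = u.eval e := by rw [hval, hx']
      exact ⟨h1, pow_eq_of_isRoot_derivative hm (by rw [hder, hx', he, mul_zero]) (by rwa [h1])⟩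
    obtain ⟨hc1, hc2, hc3⟩ := hprop c hc
    have hroots : (v - C e).roots = Multiset.replicate v.natDegree c := by
      rw [← hvdeg, (IsAlgClosed.splits (v - C e)).natDegree_eq_card_roots, Multiset.eq_replicate]
      refine ⟨rfl, fun x hx => ?_⟩
      obtain ⟨hx1, -, hx3⟩ := hprop x (isRoot_of_mem_roots hx)
      exact eq_of_eval_X_pow_add_X_pow_eq hr hmr hc2 hc3 hx3 (hx1.trans hc1.symm)
    have hmult : 1 < (v - C e).rootMultiplicity c := by
      classical
      rw [← count_roots, hroots, Multiset.count_replicate_self]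
      omega
    have hv' : v.derivative.eval c = 0 := by
      have := ((one_lt_rootMultiplicity_iff_isRoot hvm.ne_zero).1 hmult).2
      simpa using this
    apply eval_derivative_derivative_ne_zero hm hr hc2 hc3
    have hc' : v.eval c = e := by simpa [sub_eq_zero] using hc
    rw [huv, derivative_comp, derivative_mul, derivative_comp]
    simp [hv', hc', he, eval_comp]
  obtain ⟨x, hx⟩ := IsAlgClosed.exists_pow_nat_eq (-1 : k) hr
  have hx0 : x ≠ 0 := by
    rintro rfl
    simp [hr.ne'] at hx
  have hux : u.eval (v.eval x) = 0 := by
    rw [← hval]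
    simp [pow_add, hx]
  have h := hder x
  rw [eval_derivative_eq_zero_of_forall (by omega) hcrit hux, mul_zero,
    derivative_X_pow_add_X_pow r hm] at h
  simp [hx, hx0, hr'] at h

end Binomial

section Scaling

variable {k : Type*} [Field k]

lemma scaleRoots_eq_comp (f : k[X]) {s : k} (hs : s ≠ 0) :
    f.scaleRoots s = C (s ^ f.natDegree) * f.comp (C s⁻¹ * X) := by
  ext i
  rw [coeff_scaleRoots, coeff_C_mul, comp_C_mul_X_coeff]
  rcases le_or_gt i f.natDegree with hi | hi
  · rw [← Nat.sub_add_cancel hi, pow_add, Nat.sub_add_cancel hi]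
    rw [inv_pow, mul_comm (f.coeff i), mul_assoc, mul_left_comm (s ^ i),
      mul_inv_cancel₀ (pow_ne_zero i hs), mul_one, mul_comm]
  · simp [coeff_eq_zero_of_natDegree_lt hi]

lemma HasIsolatedCritPoint.of_scaleRoots {f : k[X]} {s : k} (hs : s ≠ 0)
    (h : HasIsolatedCritPoint (f.scaleRoots s)) : HasIsolatedCritPoint f := by
  obtain ⟨c, hc, hc2, huniq⟩ := h
  have hval : ∀ x, (f.scaleRoots s).eval x = s ^ f.natDegree * f.eval (s⁻¹ * x) := fun x => by
    simp [scaleRoots_eq_comp f hs, eval_comp]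
  have hder : derivative (f.scaleRoots s) =
      C (s ^ f.natDegree * s⁻¹) * (derivative f).comp (C s⁻¹ * X) := by
    rw [scaleRoots_eq_comp f hs, derivative_C_mul, derivative_comp, derivative_C_mul, derivative_X,
      mul_one, C_mul, mul_assoc]
  have hval' : ∀ x, (derivative (f.scaleRoots s)).eval x =
      s ^ f.natDegree * s⁻¹ * f.derivative.eval (s⁻¹ * x) := fun x => by
    simp [hder, eval_comp]
  have hval'' : ∀ x, (derivative (derivative (f.scaleRoots s))).eval x =
      s ^ f.natDegree * s⁻¹ * s⁻¹ * f.derivative.derivative.eval (s⁻¹ * x) := fun x => by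
    rw [hder, derivative_C_mul, derivative_comp, derivative_C_mul, derivative_X]
    simp [eval_comp]
    ring
  have hs1 : s ^ f.natDegree ≠ 0 := pow_ne_zero _ hs
  refine ⟨s⁻¹ * c, ?_, ?_, fun e he hec => ?_⟩
  · simpa [hval', hs] using hc
  · simpa [hval'', hs] using hc2
  · have h1 : s⁻¹ * (s * e) = e := by field_simp
    have := huniq (s * e) (by rw [hval', h1, he, mul_zero]) (by rw [hval, hval, h1, hec])
    rw [← this, h1]

lemma IsIndecomposable.of_scaleRoots {f : k[X]} {s : k} (hs : s ≠ 0)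
    (h : IsIndecomposable (f.scaleRoots s)) : IsIndecomposable f := by
  intro u v hv huv
  have := h (C (s ^ f.natDegree) * u.comp (C (s ^ v.natDegree)⁻¹ * X)) (v.scaleRoots s)
    ((monic_scaleRoots_iff s).2 hv) ?_
  · simpa only [natDegree_scaleRoots] using this
  · have hs1 : s ^ v.natDegree ≠ 0 := pow_ne_zero _ hs
    have h1 : (C (s ^ v.natDegree)⁻¹ * X).comp (v.scaleRoots s) = v.comp (C s⁻¹ * X) := by
      rw [mul_comp, C_comp, X_comp, scaleRoots_eq_comp v hs, ← mul_assoc, ← C_mul,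
        inv_mul_cancel₀ hs1, C_1, one_mul]
    rw [mul_comp, C_comp, comp_assoc, h1, ← comp_assoc, ← huv, scaleRoots_eq_comp f hs]

end Scaling

section Count

/-- The polynomial `X ^ n + a₁ X ^ (n - 1) + ⋯ + aₙ₋₁ X` with integer coefficients. -/
def monicIntPoly (R : Type*) [CommRing R] (n : ℕ) (a : ℕ → ℤ) : R[X] :=
  X ^ n + ∑ j ∈ Finset.Icc 1 (n - 1), C (a j : R) * X ^ (n - j)

section CommRing

variable {R : Type*} [CommRing R]

lemma degree_sum_Icc_lt (n : ℕ) (a : ℕ → ℤ) :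
    (∑ j ∈ Finset.Icc 1 (n - 1), C (a j : R) * X ^ (n - j) : R[X]).degree < n := by
  refine (degree_sum_le _ _).trans_lt ((Finset.sup_lt_iff (WithBot.bot_lt_coe n)).2 ?_)
  intro j hj
  rw [Finset.mem_Icc] at hj
  refine (degree_C_mul_X_pow_le _ _).trans_lt ?_
  have : n - j < n := by omega
  exact WithBot.coe_lt_coe.2 this

lemma monic_monicIntPoly (n : ℕ) (a : ℕ → ℤ) : (monicIntPoly R n a).Monic :=
  monic_X_pow_add (degree_sum_Icc_lt n a)

lemma natDegree_monicIntPoly [Nontrivial R] (n : ℕ) (a : ℕ → ℤ) :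
    (monicIntPoly R n a).natDegree = n := by
  rw [monicIntPoly, natDegree_add_eq_left_of_degree_lt, natDegree_X_pow]
  rw [degree_X_pow]
  exact degree_sum_Icc_lt n a

lemma coeff_monicIntPoly {n : ℕ} (a : ℕ → ℤ) {i : ℕ} (hi : i < n) :
    (monicIntPoly R n a).coeff i = if i = 0 then 0 else (a (n - i) : R) := by
  simp only [monicIntPoly, coeff_add, coeff_X_pow, hi.ne, if_false, zero_add, finsetSum_coeff,
    coeff_C_mul, mul_ite, mul_one, mul_zero]
  split_ifs with h
  · refine Finset.sum_eq_zero fun j hj => if_neg ?_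
    rw [Finset.mem_Icc] at hj
    omega
  · rw [Finset.sum_eq_single (n - i)]
    · exact if_pos (by omega)
    · intro j hj hne
      rw [Finset.mem_Icc] at hj
      exact if_neg (by omega)
    · intro hj
      rw [Finset.mem_Icc] at hj
      omega

lemma map_monicIntPoly {S : Type*} [CommRing S] (φ : R →+* S) (n : ℕ) (a : ℕ → ℤ) :
    (monicIntPoly R n a).map φ = monicIntPoly S n a := by
  simp [monicIntPoly, Polynomial.map_sum]

end CommRing

variable {k : Type*} [Field k] [CharZero k] [IsAlgClosed k]

lemma exists_card_le_forall_of_mvPolynomial {n r : ℕ} (hr : 0 < r) (hrn : r < n)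
    {P : MvPolynomial (Fin n) k}
    (hP : P.eval (fun i : Fin n => (X ^ n + X ^ (n - r) : k[X]).coeff i) ≠ 0) (a : ℕ → ℤ) :
    ∃ S : Finset ℤ, S.card ≤ P.totalDegree * n + 1 ∧ ∀ b ∉ S, ∃ s : k, s ≠ 0 ∧
      P.eval (fun i : Fin n =>
        ((monicIntPoly k n fun j => if j = r then b else a j).scaleRoots s).coeff i) ≠ 0 := by
  classical
  let g : Fin n → k[X] := fun i => if (i : ℕ) = 0 then 0 else
    if n - i = r then 1 else C (a (n - i) : k) * X ^ (n - i : ℕ)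
  set Q := MvPolynomial.aeval g P with hQdef
  have hQ : ∀ s, Q.eval s = P.eval fun i => (g i).eval s := fun s => by
    rw [hQdef, ← coe_evalRingHom, ← MvPolynomial.coe_aeval_eq_eval, RingHom.coe_coe,
      MvPolynomial.aeval_def, MvPolynomial.aeval_def, MvPolynomial.hom_eval₂]
    congr 1
    ext; simp
  have hQdeg : Q.natDegree ≤ P.totalDegree * n := by
    refine MvPolynomial.aeval_natDegree_le P le_rfl g fun i => ?_
    simp only [g]
    split_ifs
    · simp
    · simp
    · exact (natDegree_C_mul_X_pow_le _ _).trans (Nat.sub_le _ _)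
  have hQ0 : Q ≠ 0 := by
    intro h
    apply hP
    rw [← eval_zero (x := (0 : k)), ← h, hQ]
    congr 2
    ext i
    have hi := i.2
    simp only [g, coeff_add, coeff_X_pow, hi.ne, if_false, zero_add]
    by_cases h0 : (i : ℕ) = 0
    · rw [if_pos h0, if_neg (by omega), eval_zero]
    · rw [if_neg h0]
      by_cases h1 : n - i = r
      · rw [if_pos h1, if_pos (by omega), eval_one]
      · rw [if_neg h1, if_neg (by omega)]
        simp
        right; omega
  refine ⟨insert 0 (Q.roots.toFinset.image fun s =>
    if h : ∃ b : ℤ, s ^ r * (b : k) = 1 then h.choose else 0), ?_, fun b hb => ?_⟩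
  · refine (Finset.card_insert_le _ _).trans (Nat.add_le_add_right ?_ 1)
    exact (Finset.card_image_le.trans (Multiset.toFinset_card_le _)).trans
      ((card_roots' Q).trans hQdeg)
  · rw [Finset.mem_insert, not_or] at hb
    have hb0 : (b : k) ≠ 0 := by exact_mod_cast hb.1
    obtain ⟨s, hs⟩ := IsAlgClosed.exists_pow_nat_eq ((b : k)⁻¹) hr
    have hsb : s ^ r * (b : k) = 1 := by rw [hs, inv_mul_cancel₀ hb0]
    have hs0 : s ≠ 0 := by
      rintro rfl
      simp [hr.ne'] at hsb
    refine ⟨s, hs0, fun h => hb.2 ?_⟩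
    rw [Finset.mem_image]
    refine ⟨s, ?_, ?_⟩
    · rw [Multiset.mem_toFinset, mem_roots hQ0, IsRoot.def, hQ, ← h]
      congr 2
      ext i
      rw [coeff_scaleRoots, natDegree_monicIntPoly, coeff_monicIntPoly _ i.2]
      simp only [g]
      split_ifs with h1 h2
      · simp
      · rw [h2, eval_one, mul_comm, hsb]
      · simp
    · have hex : ∃ b : ℤ, s ^ r * (b : k) = 1 := ⟨b, hsb⟩
      rw [dif_pos hex]
      have := mul_left_cancel₀ (pow_ne_zero r hs0) (hex.choose_spec.trans hsb.symm)
      exact_mod_cast this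

variable (k) in
lemma exists_card_le_forall_good {n r : ℕ} (hr : 0 < r) (hrn : r < n) (hnr : n.Coprime r) :
    ∃ c : ℕ, ∀ a : ℕ → ℤ, ∃ S : Finset ℤ, S.card ≤ c ∧ ∀ b ∉ S,
      HasIsolatedCritPoint (monicIntPoly k n fun j => if j = r then b else a j) ∧
      IsIndecomposable (monicIntPoly k n fun j => if j = r then b else a j) := by
  have hm : 0 < n - r := by omega
  have hmr : (n - r).Coprime r := (Nat.coprime_sub_self_left hrn.le).2 hnr
  have hn : 0 < n := by omega
  have h1 := hasIsolatedCritPoint_X_pow_add_X_pow (k := k) hm hr hmr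
  have h2 := isIndecomposable_X_pow_add_X_pow (k := k) hm hr hmr
  rw [Nat.sub_add_cancel hrn.le] at h1 h2
  have hlt : n - r < n := by omega
  obtain ⟨P₁, hP₁, H₁⟩ := exists_mvPolynomial_hasIsolatedCritPoint hn
    (monic_X_pow_add_X_pow hlt) (natDegree_X_pow_add_X_pow hlt) h1
  obtain ⟨P₂, hP₂, H₂⟩ := exists_mvPolynomial_isIndecomposable hn
    (monic_X_pow_add_X_pow hlt) (natDegree_X_pow_add_X_pow hlt) h2
  refine ⟨(P₁ * P₂).totalDegree * n + 1, fun a => ?_⟩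
  obtain ⟨S, hS, H⟩ := exists_card_le_forall_of_mvPolynomial hr hrn (P := P₁ * P₂)
    (by rw [map_mul]; exact mul_ne_zero hP₁ hP₂) a
  refine ⟨S, hS, fun b hb => ?_⟩
  obtain ⟨s, hs, hPs⟩ := H b hb
  rw [map_mul, mul_ne_zero_iff] at hPs
  have hmon := (monic_scaleRoots_iff s).2
    (monic_monicIntPoly (R := k) n fun j => if j = r then b else a j)
  have hdeg := (natDegree_scaleRoots (monicIntPoly k n fun j => if j = r then b else a j) s).trans
    (natDegree_monicIntPoly _ _)
  exact ⟨(H₁ _ hmon hdeg hPs.1).of_scaleRoots hs, (H₂ _ hmon hdeg hPs.2).of_scaleRoots hs⟩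

end Count

section Valuation

lemma exists_algebraMap_eq_of_isIntegral {k S : Type*} [Field k] [IsAlgClosed k] [CommRing S]
    [IsDomain S] [Algebra k S] {x : S} (hx : IsIntegral k x) : ∃ c, algebraMap k S c = x :=
  minpoly.mem_range_of_degree_eq_one k x
    (IsAlgClosed.degree_eq_one_of_irreducible k (minpoly.irreducible hx))

lemma exists_valuationSubring_of_transcendental {k S : Type*} [Field k] [IsAlgClosed k] [Field S]
    [Algebra k S] {t : S} (ht : Transcendental k t) :
    ∃ V : ValuationSubring S, V.valuation.IsTrivialOn k ∧ 1 < V.valuation t := by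
  have hcl : IsIntegrallyClosedIn (algebraMap k S).range S := by
    refine Subring.isIntegrallyClosedIn_iff.2 fun x hx => ?_
    obtain ⟨p, hp, hpx⟩ := hx
    obtain ⟨q, rfl, -, hq⟩ := lifts_and_degree_eq_and_monic (f := (algebraMap k S).rangeRestrict)
      (p := p) (by
        rw [lifts_iff_coeff_lifts]
        exact fun n => (algebraMap k S).rangeRestrict_surjective _) hp
    refine exists_algebraMap_eq_of_isIntegral ⟨q, hq, ?_⟩
    rw [eval₂_map] at hpx
    exact hpx
  have hmem : t ∉ (algebraMap k S).range := by
    rintro ⟨c, rfl⟩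
    exact ht (isAlgebraic_algebraMap c)
  obtain ⟨V, hV, htV⟩ := Subring.exists_le_valuationSubring_of_isIntegrallyClosedIn hmem
  have hle : ∀ c, V.valuation (algebraMap k S c) ≤ 1 := fun c =>
    (V.valuation_le_one_iff _).2 (hV ⟨c, rfl⟩)
  refine ⟨V, ⟨fun c hc => (hle c).antisymm ?_⟩, ?_⟩
  · have := hle c⁻¹
    rw [map_inv₀, map_inv₀] at this
    exact (inv_le_one₀ (by simpa [zero_lt_iff] using hc)).1 this
  · rw [← not_le, V.valuation_le_one_iff]
    exact htV

variable {Γ : Type*} [LinearOrderedCommGroupWithZero Γ]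

lemma valuation_coeff_prod_X_sub_C_le {S : Type*} [CommRing S] [IsDomain S] (v : Valuation S Γ)
    {M : Γ} {s : Multiset S} (hs : ∀ a ∈ s, v a ≤ M) {i j : ℕ} (h : i + j = Multiset.card s) :
    v ((s.map fun a => X - C a).prod.coeff j) ≤ M ^ i := by
  induction s using Multiset.induction_on generalizing i j with
  | empty =>
    obtain ⟨rfl, rfl⟩ : i = 0 ∧ j = 0 := by simpa using h
    simp
  | cons a s ih =>
    have ih' := fun {i j} => ih (fun b hb => hs b (Multiset.mem_cons_of_mem hb)) (i := i) (j := j)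
    have ha := hs a (Multiset.mem_cons_self a s)
    rw [Multiset.card_cons] at h
    rw [Multiset.map_cons, Multiset.prod_cons, sub_mul, coeff_sub, coeff_C_mul]
    refine (v.map_sub _ _).trans (max_le ?_ ?_)
    · cases j with
      | zero => simp
      | succ j => rw [coeff_X_mul]; exact ih' (by omega)
    · cases i with
      | zero =>
        rw [coeff_eq_zero_of_natDegree_lt, mul_zero, map_zero]
        · exact zero_le
        · rw [natDegree_multiset_prod_X_sub_C_eq_card]
          omega
      | succ i =>
        rw [map_mul, pow_succ']
        exact mul_le_mul' ha (ih' (by omega))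

variable {k K S : Type*} [Field k] [Field K] [Field S] [Algebra k[X] K]
  [IsFractionRing k[X] K] [Algebra K S] [Algebra k[X] S] [IsScalarTower k[X] K S]
  [Algebra k S] [IsScalarTower k k[X] S]

lemma exists_algebraMap_eq_of_valuation_lt [IsAlgClosed k] [FiniteDimensional K S] [IsGalois K S]
    (v : Valuation S Γ) [v.IsTrivialOn k] (ht : 1 < v (algebraMap k[X] S X)) {y : S}
    (hy : IsIntegral k[X] y) {J : Finset S} (hJ : ∀ σ : Gal(S/K), σ y ∈ J) {N : Γ} (hN : 1 ≤ N)
    (hJN : ∀ c ∈ J, v c ≤ N) (hlt : N ^ J.card < v (algebraMap k[X] S X)) :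
    ∃ c : k, algebraMap k S c = y := by
  classical
  set m := minpoly k[X] y with hm
  have hmK : minpoly K y = m.map (algebraMap k[X] K) :=
    minpoly.isIntegrallyClosed_eq_field_fractions' K hy
  have hmS : m.map (algebraMap k[X] S) = (minpoly K y).map (algebraMap K S) := by
    rw [hmK, map_map, ← IsScalarTower.algebraMap_eq]
  have hsplit : (m.map (algebraMap k[X] S)).Splits := by
    rw [hmS]; exact Normal.splits (F := K) (K := S) inferInstance y
  set s := (m.map (algebraMap k[X] S)).roots with hs
  have hprod : m.map (algebraMap k[X] S) = (s.map fun a => X - C a).prod :=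
    hsplit.eq_prod_roots_of_monic ((minpoly.monic hy).map _)
  have hsJ : ∀ a ∈ s, a ∈ J := by
    intro a ha
    have ha' := isRoot_of_mem_roots ha
    rw [hmS, IsRoot.def, eval_map_algebraMap] at ha'
    obtain ⟨σ, rfl⟩ := minpoly.exists_algEquiv_of_root' (Algebra.IsAlgebraic.isAlgebraic y) ha'
    exact hJ σ
  have hnodup : s.Nodup := by
    refine nodup_roots ?_
    rw [hmS]
    have hsep : (minpoly K y).Separable := Algebra.IsSeparable.isSeparable K y
    exact hsep.map
  have hcard : Multiset.card s ≤ J.card := by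
    rw [← Multiset.toFinset_card_of_nodup hnodup]
    exact Finset.card_le_card fun a ha => hsJ a (Multiset.mem_toFinset.1 ha)
  have hcoeff : ∀ j, v (algebraMap k[X] S (m.coeff j)) < v (algebraMap k[X] S X) := by
    intro j
    rw [← coeff_map, hprod]
    rcases le_or_gt j (Multiset.card s) with hj | hj
    · refine (valuation_coeff_prod_X_sub_C_le v (fun a ha => hJN a (hsJ a ha))
        (Nat.sub_add_cancel hj)).trans_lt (lt_of_le_of_lt ?_ hlt)
      exact pow_le_pow_right₀ hN ((Nat.sub_le _ _).trans hcard)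
    · rw [coeff_eq_zero_of_natDegree_lt, map_zero]
      · exact zero_lt_one.trans ht
      · rwa [natDegree_multiset_prod_X_sub_C_eq_card]
  have hconst : ∀ j, m.coeff j = C ((m.coeff j).coeff 0) := by
    intro j
    apply eq_C_of_natDegree_eq_zero
    by_contra hne
    have h0 : m.coeff j ≠ 0 := by intro h; simp [h] at hne
    have h1 := hcoeff j
    have h2 : algebraMap k[X] S (m.coeff j) = aeval (algebraMap k[X] S X) (m.coeff j) := by
      rw [aeval_algebraMap_apply, aeval_X_left_apply]
    rw [h2, valuation_aeval_eq_valuation_X_pow_natDegree_of_one_lt_valuation_X _ ht h0] at h1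
    exact absurd h1 (not_lt.2 (le_self_pow₀ ht.le hne))
  have hm0 : (m.map constantCoeff).map C = m := by
    ext1 j
    rw [coeff_map, coeff_map, constantCoeff_apply, ← hconst]
  refine exists_algebraMap_eq_of_isIntegral ⟨m.map constantCoeff, (minpoly.monic hy).map _, ?_⟩
  have := minpoly.aeval k[X] y
  rw [← hm, ← hm0, aeval_def, eval₂_map] at this
  rwa [IsScalarTower.algebraMap_eq k k[X] S]

end Valuation

section Blocks

lemma valuation_aeval_le_one {Γ k S : Type*} [LinearOrderedCommGroupWithZero Γ] [Field k]
    [Field S] [Algebra k S] (v : Valuation S Γ) [hv : v.IsTrivialOn k] {x : S} (hx : v x ≤ 1)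
    (p : k[X]) : v (aeval x p) ≤ 1 := by
  rw [aeval_eq_sum_range]
  refine v.map_sum_le fun i _ => ?_
  rw [Algebra.smul_def, map_mul, map_pow]
  refine mul_le_one' ?_ (pow_le_one' hx _)
  by_cases h : p.coeff i = 0
  · simp [h]
  · exact (hv.eq_one _ h).le

lemma isIntegral_of_aeval_add_eq_zero {k S : Type*} [Field k] [CommRing S] [Algebra k[X] S]
    [Algebra k S] [IsScalarTower k k[X] S] {f : k[X]} (hf : f.Monic) (hn : f.natDegree ≠ 0)
    {z : S} (hz : aeval z f + algebraMap k[X] S X = 0) : IsIntegral k[X] z := by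
  refine .of_aeval_monic (hf.map (C : k →+* k[X])) (by rwa [natDegree_map]) ?_
  have h : aeval z (f.map (C : k →+* k[X])) = aeval z f := aeval_map_algebraMap k[X] z f
  rw [h, eq_neg_of_add_eq_zero_left hz]
  exact isIntegral_algebraMap.neg

open Classical in
/-- The product of `X - z j` over the class of `i`. -/
def classPoly {ι S : Type*} [Fintype ι] [CommRing S] (z : ι → S) (s : Setoid ι) (i : ι) : S[X] :=
  ∏ j with s j i, (X - C (z j))

section ClassPoly

variable {ι S : Type*} [Fintype ι]

lemma monic_classPoly [CommRing S] (z : ι → S) (s : Setoid ι) (i : ι) : (classPoly z s i).Monic :=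
  monic_prod_of_monic _ _ fun _ _ => monic_X_sub_C _

open Classical in
lemma natDegree_classPoly [CommRing S] [Nontrivial S] (z : ι → S) (s : Setoid ι) (i : ι) :
    (classPoly z s i).natDegree = (Finset.univ.filter fun j => s j i).card :=
  natDegree_finsetProd_X_sub_C_eq_card _ _

lemma classPoly_eq_iff [CommRing S] [IsDomain S] {z : ι → S} (hz : Function.Injective z)
    (s : Setoid ι) (i j : ι) : classPoly z s j = classPoly z s i ↔ s j i := by
  classical
  constructor
  · intro h
    have h0 : (classPoly z s i).eval (z j) = 0 := by
      rw [← h, classPoly, eval_prod]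
      exact Finset.prod_eq_zero (i := j) (by simp) (by simp)
    rw [classPoly, eval_prod, Finset.prod_eq_zero_iff] at h0
    obtain ⟨l, hl, hlj⟩ := h0
    have : z j = z l := by simpa [sub_eq_zero] using hlj
    rw [hz this]
    simpa using hl
  · intro h
    rw [classPoly, classPoly]
    congr 1
    ext l
    simpa using ⟨fun h' => s.trans h' h, fun h' => s.trans h' (s.symm h)⟩

lemma prod_image_classPoly [CommRing S] [IsDomain S] [DecidableEq S[X]] {z : ι → S}
    (hz : Function.Injective z) (s : Setoid ι) :
    ∏ q ∈ Finset.univ.image (classPoly z s), q = ∏ i, (X - C (z i)) := by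
  classical
  refine Finset.prod_image' _ fun i _ => ?_
  simp only [classPoly_eq_iff hz]
  rfl

lemma map_classPoly [CommRing S] {G : Type*} [Group G] [MulAction G ι] (φ : G → S →+* S)
    {z : ι → S} (hφ : ∀ σ i, z (σ • i) = φ σ (z i)) {s : Setoid ι}
    (hs : ∀ (σ : G) i j, s i j → s (σ • i) (σ • j)) (σ : G) (i : ι) :
    (classPoly z s i).map (φ σ) = classPoly z s (σ • i) := by
  classical
  rw [classPoly, classPoly, Polynomial.map_prod]
  refine Finset.prod_equiv (MulAction.toPerm σ) (fun j => ?_) fun j _ => by simp [hφ]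
  simp only [Finset.mem_filter_univ, MulAction.toPerm_apply]
  refine ⟨hs σ j i, fun h => ?_⟩
  simpa using hs σ⁻¹ _ _ h

end ClassPoly

variable {k K S : Type*} [Field k] [IsAlgClosed k] [Field K] [Field S]
  [Algebra k[X] K] [IsFractionRing k[X] K] [Algebra K S] [Algebra k[X] S] [IsScalarTower k[X] K S]
  [Algebra k S] [IsScalarTower k k[X] S]

variable [FiniteDimensional K S] [IsGalois K S]
  {ι : Type*} [Fintype ι] [MulAction Gal(S/K) ι] [MulAction.IsPretransitive Gal(S/K) ι]

lemma coeff_classPoly_mem {f : k[X]} {z : ι → S}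
    (hz : Function.Injective z) (hσ : ∀ (σ : Gal(S/K)) i, z (σ • i) = σ (z i))
    (hf : f.Monic) (hn : f.natDegree = Fintype.card ι)
    (hroot : ∀ i, aeval (z i) f + algebraMap k[X] S X = 0) {s : Setoid ι}
    (hs : ∀ (σ : Gal(S/K)) i j, s i j → s (σ • i) (σ • j)) (i : ι) {j : ℕ} (hj : 0 < j) :
    ∃ c : k, algebraMap k S c = (classPoly z s i).coeff j := by
  classical
  have hinj : Function.Injective (algebraMap k[X] S) := by
    rw [IsScalarTower.algebraMap_eq k[X] K S]
    exact (algebraMap K S).injective.comp (IsFractionRing.injective k[X] K)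
  obtain ⟨V, hV, ht⟩ := exists_valuationSubring_of_transcendental
    ((transcendental_algebraMap_iff (R := k) hinj).2 (transcendental_X k))
  set v := V.valuation
  set t := algebraMap k[X] S X with ht_def
  have hval : ∀ i, v (aeval (z i) f) = v t := fun i => by
    rw [eq_neg_of_add_eq_zero_left (hroot i), Valuation.map_neg]
  have hgt : ∀ i, 1 < v (z i) := fun i => by
    by_contra! h
    exact absurd (valuation_aeval_le_one v h f) (not_le.2 (by rwa [hval]))
  have hpow : ∀ i, v (z i) ^ Fintype.card ι = v t := fun i => by
    rw [← hval i, ← hn]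
    exact (valuation_aeval_eq_valuation_X_pow_natDegree_of_one_lt_valuation_X _ (hgt i)
      hf.ne_zero).symm
  have hcard0 : Fintype.card ι ≠ 0 := (Fintype.card_pos_iff.2 ⟨i⟩).ne'
  set M := v (z i) with hM
  have hM1 : 1 < M := hgt i
  have hzM : ∀ l, v (z l) ≤ M := fun l =>
    ((pow_left_inj₀ zero_le zero_le hcard0).1 ((hpow l).trans (hpow i).symm)).le
  set d := (classPoly z s i).natDegree with hd
  have hφ := map_classPoly (fun σ : Gal(S/K) => (σ : S →+* S)) hσ hs
  have hdeg : ∀ l, (classPoly z s l).natDegree = d := fun l => by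
    obtain ⟨σ, rfl⟩ := MulAction.exists_smul_eq Gal(S/K) i l
    rw [← hφ, (monic_classPoly z s i).natDegree_map]
  have hd0 : 0 < d := by
    rw [hd, natDegree_classPoly]
    exact Finset.card_pos.2 ⟨i, by simp⟩
  set J := Finset.univ.image fun l => (classPoly z s l).coeff j with hJ
  have hJcard : d * J.card ≤ Fintype.card ι := by
    refine Finset.mul_card_image_le_card _ d fun c hc => ?_
    obtain ⟨l, -, rfl⟩ := Finset.mem_image.1 hc
    rw [← hdeg l, natDegree_classPoly]
    refine Finset.card_le_card fun l' hl' => ?_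
    have : s l' l := by simpa using hl'
    simp [(classPoly_eq_iff hz s l l').2 this]
  have hJ0 : 0 < J.card := Finset.card_pos.2 ⟨_, Finset.mem_image_of_mem _ (Finset.mem_univ i)⟩
  refine exists_algebraMap_eq_of_valuation_lt (K := K) v ht (J := J) (N := M ^ (d - 1))
    ?_ (fun σ => ?_) (one_le_pow₀ hM1.le) (fun c hc => ?_) ?_
  · refine isIntegral_coeff_prod _ _ (fun l _ j' => ?_) j
    have hl := isIntegral_of_aeval_add_eq_zero hf (hn.trans_ne hcard0) (hroot l)
    rw [coeff_sub, coeff_X, coeff_C]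
    split_ifs <;> simp [isIntegral_one, isIntegral_zero, hl.neg, isIntegral_one.sub hl]
  · refine Finset.mem_image.2 ⟨σ • i, Finset.mem_univ _, ?_⟩
    rw [← hφ, coeff_map]
    rfl
  · obtain ⟨l, -, rfl⟩ := Finset.mem_image.1 hc
    rcases le_or_gt j d with hjd | hjd
    · have hcl : classPoly z s l = (((Finset.univ.filter fun j => s j l).val.map z).map
          fun a => X - C a).prod := by
        rw [Multiset.map_map]; rfl
      have hcl' : Multiset.card ((Finset.univ.filter fun j => s j l).val.map z) = d := by
        rw [← hdeg l, natDegree_classPoly, Multiset.card_map]; rfl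
      rw [hcl]
      refine (valuation_coeff_prod_X_sub_C_le v (M := M) ?_
        ((Nat.sub_add_cancel hjd).trans hcl'.symm)).trans ?_
      · intro a ha
        obtain ⟨l', -, rfl⟩ := Multiset.mem_map.1 ha
        exact hzM l'
      · exact pow_le_pow_right₀ hM1.le (by omega)
    · rw [coeff_eq_zero_of_natDegree_lt (by rwa [hdeg]), map_zero]
      exact zero_le
  · rw [← pow_mul, ← hpow i]
    refine pow_lt_pow_right₀ hM1 ?_
    have : (d - 1) * J.card + J.card = d * J.card := by
      rw [← Nat.succ_mul]; congr; omega
    omega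

lemma IsIndecomposable.setoid_eq_top [CharZero k] {f : k[X]} (hind : IsIndecomposable f) {z : ι → S}
    (hz : Function.Injective z) (hσ : ∀ (σ : Gal(S/K)) i, z (σ • i) = σ (z i))
    (hf : f.Monic) (hn : f.natDegree = Fintype.card ι)
    (hprod : f.map (algebraMap k S) + C (algebraMap k[X] S X) = ∏ i, (X - C (z i)))
    {s : Setoid ι} (hs : ∀ (σ : Gal(S/K)) i j, s i j → s (σ • i) (σ • j))
    {i₀ j₀ : ι} (hne : i₀ ≠ j₀) (hij : s j₀ i₀) (i : ι) : s i i₀ := by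
  classical
  have hroot : ∀ i, aeval (z i) f + algebraMap k[X] S X = 0 := fun i => by
    have := congrArg (eval (z i)) hprod
    rw [eval_add, eval_C, eval_map_algebraMap, eval_prod] at this
    rw [this]
    exact Finset.prod_eq_zero (Finset.mem_univ i) (by simp)
  have hφ := map_classPoly (fun σ : Gal(S/K) => (σ : S →+* S)) hσ hs
  have hw := monic_classPoly z s i₀
  set d := (classPoly z s i₀).natDegree with hd
  have hd2 : 2 ≤ d := by
    rw [hd, natDegree_classPoly]
    exact Finset.one_lt_card.2 ⟨i₀, by simp, j₀, by simpa using hij, hne⟩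
  obtain ⟨v, hvw, hvd, hv⟩ : ∃ v : k[X], v.map (algebraMap k S) =
      classPoly z s i₀ - C ((classPoly z s i₀).coeff 0) ∧ v.natDegree = d ∧ v.Monic := by
    have hlift : classPoly z s i₀ - C ((classPoly z s i₀).coeff 0) ∈ lifts (algebraMap k S) := by
      rw [lifts_iff_coeff_lifts]
      rintro (_ | j)
      · exact ⟨0, by simp⟩
      · rw [coeff_sub, coeff_C_succ, sub_zero]
        exact coeff_classPoly_mem hz hσ hf hn hroot hs i₀ j.succ_pos
    have hmon : (classPoly z s i₀ - C ((classPoly z s i₀).coeff 0)).Monic := by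
      refine hw.sub_of_left (degree_C_le.trans_lt ?_)
      rw [degree_eq_natDegree hw.ne_zero, ← hd]
      exact_mod_cast (by omega : 0 < d)
    obtain ⟨v, hv1, hv2, hv3⟩ := lifts_and_natDegree_eq_and_monic hlift hmon
    exact ⟨v, hv1, by rw [hv2, natDegree_sub_C], hv3⟩
  have hall : ∀ i, classPoly z s i =
      v.map (algebraMap k S) + C ((classPoly z s i - v.map (algebraMap k S)).coeff 0) := by
    intro i
    obtain ⟨σ, rfl⟩ := MulAction.exists_smul_eq Gal(S/K) i₀ i
    have hσv : (v.map (algebraMap k S)).map (σ : S →+* S) = v.map (algebraMap k S) := by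
      rw [map_map]
      congr 1
      ext c
      have : algebraMap k S c = algebraMap K S (algebraMap k[X] K (C c)) := by
        rw [← IsScalarTower.algebraMap_apply, IsScalarTower.algebraMap_apply k k[X] S]
        rfl
      simp [this]
    have h1 := hφ σ i₀
    rw [eq_sub_iff_add_eq.1 hvw |>.symm, Polynomial.map_add, hσv, map_C] at h1
    rw [← h1]
    simp
  have hcomp : f.map (algebraMap k S) =
      ((∏ q ∈ Finset.univ.image (classPoly z s), (X + C ((q - v.map (algebraMap k S)).coeff 0))) -
        C (algebraMap k[X] S X)).comp (v.map (algebraMap k S)) := by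
    rw [sub_comp, C_comp, prod_comp, eq_sub_iff_add_eq, hprod, ← prod_image_classPoly hz s]
    refine Finset.prod_congr rfl fun q hq => ?_
    obtain ⟨i, -, rfl⟩ := Finset.mem_image.1 hq
    rw [add_comp, X_comp, C_comp]
    exact hall i
  obtain ⟨u, hu⟩ : ∃ u : k[X], f = u.comp v := by
    rw [exists_eq_comp_iff_digitBase hv (by omega)]
    intro i j hj
    have := (exists_eq_comp_iff_digitBase (hv.map (algebraMap k S))
      (by rw [hv.natDegree_map]; omega) _).1 ⟨_, hcomp⟩ i j hj
    rw [← map_digitBase _ hv, coeff_map] at this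
    exact (algebraMap k S).injective (this.trans (map_zero _).symm)
  have hdn : d = Fintype.card ι := by
    rcases hind u v hv hu with h | h
    · omega
    · rw [← hvd, h, hn]
  rw [hd, natDegree_classPoly, Finset.card_eq_iff_eq_univ] at hdn
  have := Finset.mem_univ i
  rw [← hdn] at this
  simpa using this

end Blocks

section Transposition

lemma exists_mem_inertia_ne_one (G : Type*) {A B : Type*} [CommRing A] [CommRing B] [Algebra A B]
    [IsDedekindDomain A] [IsDedekindDomain B] [Module.Finite A B] [Module.IsTorsionFree A B]
    [Group G] [Finite G] [MulSemiringAction G B] [IsGaloisGroup G A B] {p : Ideal A} (hp : p ≠ ⊥)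
    (P : Ideal B) [P.IsPrime] [p.IsPrime] [P.LiesOver p] [PerfectField p.ResidueField]
    (h : p.map (algebraMap A B) ≤ P ^ 2) : ∃ g ∈ P.inertia G, g ≠ 1 := by
  have hcard := Ideal.card_inertia_eq_ramificationIdxIn (G := G) p P
  rw [Ideal.ramificationIdxIn_eq_ramificationIdx p P G,
    ← Ideal.ramificationIdx'_eq_ramificationIdx p P hp] at hcard
  have h1 := (Ideal.ramificationIdx'_ne_one_iff (h.trans (Ideal.pow_le_self two_ne_zero))).2 h
  by_contra! hcon
  refine h1 (hcard.symm.trans ?_)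
  rw [(Subgroup.eq_bot_iff_forall _).2 hcon, Subgroup.card_bot]

lemma natDegree_le_card_toFinset_roots_add_one {k : Type*} [Field k] [CharZero k] [IsAlgClosed k]
    [DecidableEq k] {f : k[X]} (hn : f.natDegree ≠ 0) {c : k}
    (hc : f.derivative.derivative.eval c ≠ 0)
    (hc' : ∀ e, f.derivative.eval e = 0 → f.eval e = f.eval c → e = c) :
    f.natDegree ≤ (f - C (f.eval c)).roots.toFinset.card + 1 := by
  set q := f - C (f.eval c) with hq
  have hqn : q.natDegree = f.natDegree := natDegree_sub_C
  have hq0 : q ≠ 0 := fun h => hn (by rw [← hqn, h, natDegree_zero])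
  have hqd : q.derivative = f.derivative := by simp [hq]
  rw [← hqn, (IsAlgClosed.splits q).natDegree_eq_card_roots, ← Finset.card_val,
    Multiset.toFinset_val, ← Multiset.card_cons c]
  refine Multiset.card_le_card (Multiset.le_iff_count.2 fun e => ?_)
  rw [count_roots, Multiset.count_cons, Multiset.count_dedup]
  by_cases he : q.IsRoot e
  · rw [if_pos ((mem_roots hq0).2 he)]
    split_ifs with hec
    · subst hec
      by_contra! h
      refine hc ?_
      simpa [hqd] using (lt_rootMultiplicity_iff_isRoot_iterate_derivative hq0).1 h 2 le_rfl
    · by_contra! h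
      have h' := ((one_lt_rootMultiplicity_iff_isRoot hq0).1 h).2
      rw [hqd] at h'
      exact hec (hc' e h' (by simpa [hq, sub_eq_zero] using he))
  · simp [rootMultiplicity_eq_zero he]

lemma exists_toPermHom_isSwap {k B : Type*} [Field k] [CharZero k] [IsAlgClosed k] [CommRing B]
    [Algebra k[X] B] [Algebra k B] [IsScalarTower k k[X] B] [IsDedekindDomain B]
    [Module.Finite k[X] B] [Module.IsTorsionFree k[X] B] {G : Type*} [Group G] [Finite G]
    [MulSemiringAction G B] [IsGaloisGroup G k[X] B] {f : k[X]} (hf : f.Monic)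
    (hcrit : HasIsolatedCritPoint f) {F : k[X][X]} (hF : F = f.map C + C X)
    (hsplit : (F.map (algebraMap k[X] B)).Splits) [DecidableEq (F.rootSet B)] :
    ∃ g : G, g ≠ 1 ∧ (MulAction.toPermHom G (F.rootSet B) g = 1 ∨
      (MulAction.toPermHom G (F.rootSet B) g).IsSwap) := by
  obtain ⟨c, hc, hcc, hc'⟩ := hcrit
  set p : Ideal k[X] := Ideal.span {X + C (f.eval c)} with hp
  have hprime : Prime (X + C (f.eval c)) := by
    simpa using prime_X_sub_C (-f.eval c)
  have : p.IsPrime := (Ideal.span_singleton_prime hprime.ne_zero).2 hprime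
  have hp0 : p ≠ ⊥ := by simpa [hp] using hprime.ne_zero
  have : CharZero p.ResidueField := charZero_of_injective_algebraMap (algebraMap k _).injective
  obtain ⟨P, hP, hPp⟩ := (inferInstance : Nonempty (p.primesOver B))
  have hn : f.natDegree ≠ 0 := fun h => by
    rw [hf.natDegree_eq_zero.1 h] at hcc
    simp at hcc
  have haevalF {T : Type _} [CommRing T] [Algebra k[X] T] [Algebra k T] [IsScalarTower k k[X] T]
      (x : T) : aeval x F = aeval x f + algebraMap k[X] T X := by
    rw [hF, map_add, aeval_C]
    congr 1
    exact aeval_map_algebraMap k[X] x f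
  have haP : algebraMap k[X] B (X + C (f.eval c)) ∈ P := by
    rw [← Ideal.mem_comap, ← Ideal.under_def, ← hPp.over]
    exact Ideal.mem_span_singleton_self _
  have hcF : aeval (algebraMap k B c) F = algebraMap k[X] B (X + C (f.eval c)) := by
    rw [haevalF, aeval_algebraMap_apply, map_add, add_comm, coe_aeval_eq_eval,
      IsScalarTower.algebraMap_apply k k[X] B, algebraMap_eq]
  have hFm : F.Monic := by
    rw [hF]
    refine (hf.map C).add_of_left (degree_C_le.trans_lt ?_)
    rw [degree_map, degree_eq_natDegree hf.ne_zero]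
    exact_mod_cast Nat.pos_of_ne_zero hn
  have hle : p.map (algebraMap k[X] B) ≤ P ^ 2 := by
    rw [hp, Ideal.map_span, Set.image_singleton, Ideal.span_singleton_le_iff_mem, ← hcF]
    obtain ⟨z, hz, hzP⟩ : ∃ z ∈ F.aroots B, algebraMap k B c - z ∈ P := by
      have h := hsplit.eq_prod_roots_of_monic (hFm.map _)
      have h' := congrArg (eval (algebraMap k B c)) h
      rw [eval_map_algebraMap, eval_multiset_prod, Multiset.map_map] at h'
      rw [← hcF, h', hP.multiset_prod_mem_iff_exists_mem] at haP
      simpa using haP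
    obtain ⟨H, hH⟩ := dvd_iff_isRoot.2 (isRoot_of_mem_roots hz)
    have hd : aeval (algebraMap k B c) F.derivative = 0 := by
      have : F.derivative = f.derivative.map C := by simp [hF]
      have h2 : aeval (algebraMap k B c) (f.derivative.map C) =
        aeval (algebraMap k B c) f.derivative := aeval_map_algebraMap k[X] _ _
      rw [this, h2, aeval_algebraMap_apply, coe_aeval_eq_eval, hc, map_zero]
    have hF' : aeval (algebraMap k B c) F =
        (algebraMap k B c - z) * H.eval (algebraMap k B c) := by
      rw [← eval_map_algebraMap, hH]
      simp
    rw [← eval_map_algebraMap, ← derivative_map, hH, derivative_mul] at hd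
    have hHP : H.eval (algebraMap k B c) ∈ P := by
      have : H.eval (algebraMap k B c) =
          -((algebraMap k B c - z) * H.derivative.eval (algebraMap k B c)) := by
        rw [eq_neg_iff_add_eq_zero]
        simpa using hd
      rw [this]
      exact P.neg_mem (P.mul_mem_right _ hzP)
    rw [hF', pow_two]
    exact Ideal.mul_mem_mul hzP hHP
  obtain ⟨g, hg, hg1⟩ := exists_mem_inertia_ne_one G hp0 P hle
  refine ⟨g, hg1, hsplit.toPermHom_apply_eq_one_or_isSwap_of_ncard_le_of_mem_inertia P ?_ g hg⟩
  classical
  have hinj : Function.Injective (algebraMap k (B ⧸ P)) := (algebraMap k (B ⧸ P)).injective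
  calc (F.rootSet B).ncard ≤ F.natDegree := by
        rw [rootSet_def, Set.ncard_coe_finset]
        exact (Multiset.toFinset_card_le _).trans ((card_roots' _).trans natDegree_map_le)
    _ = f.natDegree := by rw [hF, natDegree_add_C, natDegree_map]
    _ ≤ _ := natDegree_le_card_toFinset_roots_add_one hn hcc hc'
    _ ≤ _ := by
        gcongr
        rw [← Finset.card_image_of_injective _ hinj, ← Set.ncard_coe_finset]
        refine Set.ncard_le_ncard ?_ (rootSet_finite _ _)
        intro x hx
        obtain ⟨e, he, rfl⟩ := Finset.mem_image.1 hx
        have hfe : f.eval e = f.eval c := by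
          have := (mem_roots'.1 (Multiset.mem_toFinset.1 he)).2
          simpa [sub_eq_zero] using this
        refine mem_rootSet'.2 ⟨(hFm.map _).ne_zero, ?_⟩
        rw [haevalF, aeval_algebraMap_apply, coe_aeval_eq_eval, hfe,
          IsScalarTower.algebraMap_apply k k[X], ← map_add, algebraMap_eq, add_comm,
          IsScalarTower.algebraMap_apply k[X] B]
        exact Ideal.Quotient.eq_zero_iff_mem.2 haP

end Transposition

section SymmetricGroup

lemma surjective_toPermHom_of_isSwap {G ι : Type*} [Group G] [MulAction G ι] [Finite ι]
    [DecidableEq ι] {g : G} (hg : (MulAction.toPermHom G ι g).IsSwap)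
    (h : ∀ s : Setoid ι, (∀ (g : G) i j, s i j → s (g • i) (g • j)) →
      ∀ i j, i ≠ j → s j i → ∀ l, s l i) :
    Function.Surjective (MulAction.toPermHom G ι) := by
  set H := (MulAction.toPermHom G ι).range with hH
  let s : Setoid ι :=
    { r := fun i j => Equiv.swap i j ∈ H
      iseqv :=
        { refl := fun i => by rw [Equiv.swap_self]; exact H.one_mem
          symm := fun {i j} hij => by rwa [Equiv.swap_comm]
          trans := fun hij hjl => SubmonoidClass.swap_mem_trans _ hij hjl } }
  have hs : ∀ (g : G) i j, s i j → s (g • i) (g • j) := by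
    rintro g i j ⟨g', hg'⟩
    refine ⟨g * g' * g⁻¹, ?_⟩
    rw [map_mul, map_mul, hg', map_inv]
    exact (Equiv.swap_apply_apply (MulAction.toPerm g : Equiv.Perm ι) i j).symm
  obtain ⟨i, j, hij, hgs⟩ := hg
  have hall := h s hs j i hij.symm ⟨g, hgs⟩
  rw [← MonoidHom.range_eq_top, eq_top_iff, ← Equiv.Perm.closure_isSwap, Subgroup.closure_le]
  rintro _ ⟨x, y, -, rfl⟩
  exact s.trans (hall x) (s.symm (hall y))

lemma irreducible_map_C_add_C_X {k : Type*} [Field k] (f : k[X]) :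
    Irreducible (f.map C + C X : k[X][X]) := by
  rw [← MulEquiv.irreducible_iff (Bivariate.swap (R := k)), map_add, Bivariate.swap_X]
  have : Bivariate.swap (f.map C) = C f := by
    rw [← Bivariate.swap_symm, AlgEquiv.symm_apply_eq, Bivariate.swap_C]
  rw [this, add_comm]
  simpa using irreducible_X_sub_C (-f)

lemma Monic.map_C_add_C_X {k : Type*} [Field k] {f : k[X]} (hf : f.Monic)
    (hn : f.natDegree ≠ 0) : (f.map C + C X : k[X][X]).Monic := by
  refine (hf.map C).add_of_left (degree_C_le.trans_lt ?_)
  rw [hf.degree_map, degree_eq_natDegree hf.ne_zero]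
  exact_mod_cast Nat.pos_of_ne_zero hn

lemma Monic.irreducible_map_algebraMap_map_C_add_C_X {k : Type*} (K : Type*) [Field k] [Field K]
    [Algebra k[X] K] [IsFractionRing k[X] K] {f : k[X]} (hf : f.Monic) (hn : f.natDegree ≠ 0) :
    Irreducible ((f.map C + C X : k[X][X]).map (algebraMap k[X] K)) := by
  refine (hf.map_C_add_C_X hn).irreducible_iff_irreducible_map_fraction_map.1 ?_
  exact irreducible_map_C_add_C_X f

variable {k K S : Type*} [Field k] [CharZero k] [IsAlgClosed k] [Field K] [Field S]
  [Algebra k[X] K] [IsFractionRing k[X] K] [Algebra K S] [Algebra k[X] S] [IsScalarTower k[X] K S]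
  [Algebra k S] [IsScalarTower k k[X] S]

theorem natCard_gal_eq_factorial {f : k[X]} (hf : f.Monic) (hcrit : HasIsolatedCritPoint f)
    (hind : IsIndecomposable f) {F : k[X][X]} (hF : F = f.map C + C X)
    [IsSplittingField K S (F.map (algebraMap k[X] K))] :
    Nat.card Gal(S/K) = f.natDegree.factorial := by
  classical
  set P := F.map (algebraMap k[X] K) with hP
  have hn : f.natDegree ≠ 0 := fun h => by
    obtain ⟨c, -, hc, -⟩ := hcrit
    rw [hf.natDegree_eq_zero.1 h] at hc
    simp at hc
  have hFm : F.Monic := hF ▸ hf.map_C_add_C_X hn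
  have hFn : F.natDegree = f.natDegree := by rw [hF, natDegree_add_C, natDegree_map]
  have hPirr : Irreducible P := by
    rw [hP, hF]
    exact hf.irreducible_map_algebraMap_map_C_add_C_X K hn
  have : CharZero K := charZero_of_injective_algebraMap (IsFractionRing.injective k[X] K)
  have hsep : P.Separable := hPirr.separable
  have : FiniteDimensional K S := IsSplittingField.finiteDimensional S P
  have : IsGalois K S := .of_separable_splitting_field hsep
  have hinj : Function.Injective (algebraMap k[X] S) := by
    rw [IsScalarTower.algebraMap_eq k[X] K S]
    exact (algebraMap K S).injective.comp (IsFractionRing.injective k[X] K)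
  have hFS : F.map (algebraMap k[X] S) = P.map (algebraMap K S) := by
    rw [hP, map_map, ← IsScalarTower.algebraMap_eq]
  let B := integralClosure k[X] S
  have : IsDedekindDomain B := integralClosure.isDedekindDomain k[X] K S
  have : IsFractionRing B S := integralClosure.isFractionRing_of_finite_extension K S
  have : Module.Finite k[X] B := IsIntegralClosure.finite k[X] K S B
  have : FaithfulSMul k[X] S := (faithfulSMul_iff_algebraMap_injective _ _).2 hinj
  have : Module.IsTorsionFree k[X] B := inferInstance
  have : IsGaloisGroup Gal(S/K) k[X] B := .of_isFractionRing _ k[X] B K S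
  have hFB : (F.map (algebraMap k[X] B)).map (algebraMap B S) = F.map (algebraMap k[X] S) := by
    rw [map_map, ← IsScalarTower.algebraMap_eq]
  have hsplitS : (P.map (algebraMap K S)).Splits := IsSplittingField.splits S P
  have hrange : ∀ x ∈ (P.map (algebraMap K S)).roots, x ∈ (algebraMap B S).range := by
    intro x hx
    refine ⟨⟨x, F, hFm, ?_⟩, rfl⟩
    rw [← hFS] at hx
    rw [← eval_map]
    exact isRoot_of_mem_roots hx
  have hsplit : (F.map (algebraMap k[X] B)).Splits := by
    refine .of_splits_map_of_injective (i := algebraMap B S) Subtype.val_injective ?_ ?_ <;>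
      rwa [hFB, hFS]
  have hprodB := hsplit.eq_prod_roots_of_monic (hFm.map _)
  have hroots : (F.map (algebraMap k[X] B)).roots.map (algebraMap B S) =
      (P.map (algebraMap K S)).roots := by
    rw [← hFS, ← hFB, hsplit.roots_map_of_injective Subtype.val_injective]
  have hnodup : (F.map (algebraMap k[X] B)).roots.Nodup :=
    .of_map _ (hroots ▸ nodup_roots hsep.map)
  have hfin : (F.rootSet B).toFinset = (F.map (algebraMap k[X] B)).roots.toFinset := by
    ext b
    simp [mem_rootSet', mem_roots', IsRoot, eval_map_algebraMap]
  have hcard : Fintype.card (F.rootSet B) = f.natDegree := by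
    rw [← hFn, ← hFm.natDegree_map (algebraMap k[X] B), hsplit.natDegree_eq_card_roots,
      ← Multiset.toFinset_card_of_nodup hnodup, ← hfin, Set.toFinset_card]
  have hprod : f.map (algebraMap k S) + C (algebraMap k[X] S X) =
      ∏ i : F.rootSet B, (X - C ((i : B) : S)) := by
    have h1 : f.map (algebraMap k S) + C (algebraMap k[X] S X) = F.map (algebraMap k[X] S) := by
      rw [hF, Polynomial.map_add, map_map, map_C, IsScalarTower.algebraMap_eq k k[X] S]
      rfl
    rw [h1, ← hFB, hprodB, Polynomial.map_multiset_prod, Multiset.map_map,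
      Finset.prod_set_coe (F.rootSet B) (f := fun b : B => X - C (b : S)), hfin,
      Finset.prod, Multiset.toFinset_val, hnodup.dedup]
    congr 1
    refine Multiset.map_congr rfl fun b _ => ?_
    simp
  have hmem : ∀ i : F.rootSet B, aeval ((i : B) : S) P = 0 := fun i => by
    rw [hP, aeval_map_algebraMap]
    exact (aeval_algebraMap_apply S (i : B) F).trans
      (by rw [(mem_rootSet'.1 i.2).2, map_zero])
  have htrans : MulAction.IsPretransitive Gal(S/K) (F.rootSet B) := by
    refine ⟨fun x y => ?_⟩
    have hx := minpoly.eq_of_irreducible hPirr (hmem x)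
    have hy := minpoly.eq_of_irreducible hPirr (hmem y)
    obtain ⟨g, hg⟩ := (Normal.minpoly_eq_iff_mem_orbit S).mp (hy.symm.trans hx)
    exact ⟨g, Subtype.ext (Subtype.ext hg)⟩
  have hbot : ∀ g : Gal(S/K), MulAction.toPermHom Gal(S/K) (F.rootSet B) g = 1 → g = 1 := by
    intro g hg
    have : (g : S →ₐ[K] S) = AlgHom.id K S := by
      refine AlgHom.ext_of_adjoin_eq_top (IsSplittingField.adjoin_rootSet S P) fun x hx => ?_
      obtain ⟨b, rfl⟩ := hrange x (by simpa [rootSet] using hx)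
      have hb : b ∈ F.rootSet B := by
        refine mem_rootSet'.2 ⟨(hFm.map _).ne_zero, Subtype.val_injective ?_⟩
        have := (mem_rootSet'.1 hx).2
        rw [hP, aeval_map_algebraMap, aeval_algebraMap_apply] at this
        exact this
      exact congrArg (fun i : F.rootSet B => ((i : B) : S)) (DFunLike.congr_fun hg ⟨b, hb⟩)
    exact AlgEquiv.ext fun x => DFunLike.congr_fun this x
  obtain ⟨g, hg1, hg⟩ := exists_toPermHom_isSwap (G := Gal(S/K)) hf hcrit hF hsplit
  have hsurj := surjective_toPermHom_of_isSwap (hg.resolve_left fun h => hg1 (hbot g h))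
    fun s hs i j hij hsij => hind.setoid_eq_top (K := K) (z := fun i : F.rootSet B => ((i : B) : S))
      (Subtype.val_injective.comp Subtype.val_injective) (fun _ _ => rfl) hf hcard.symm hprod hs
      hij hsij
  rw [Nat.card_congr (Equiv.ofBijective _ ⟨(injective_iff_map_eq_one _).2 hbot, hsurj⟩),
    Nat.card_perm, Nat.card_eq_fintype_card, hcard]

end SymmetricGroup

section Transfer

lemma natCard_gal_map_le {K L : Type*} [Field K] [Field L] (φ : K →+* L) {p : K[X]} (hp : p ≠ 0) :
    Nat.card (p.map φ).Gal ≤ Nat.card p.Gal := by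
  let := φ.toAlgebra
  let S := (p.map φ).SplittingField
  have hsplit : Fact (p.map (algebraMap K S)).Splits := ⟨by
    rw [IsScalarTower.algebraMap_eq K L S, ← map_map]
    exact SplittingField.splits (p.map φ)⟩
  refine Nat.card_le_card_of_injective
    (fun g : (p.map φ).Gal => Gal.restrict p S (AlgEquiv.restrictScalars K (g : S ≃ₐ[L] S)))
    fun g h hgh => Gal.ext _ fun x hx => ?_
  have hx' : x ∈ p.rootSet S := by
    rw [mem_rootSet'] at hx ⊢
    exact ⟨(Polynomial.map_ne_zero_iff (algebraMap K S).injective).2 hp,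
      (aeval_map_algebraMap L x p).symm.trans hx.2⟩
  have h1 := Gal.restrict_smul (AlgEquiv.restrictScalars K (g : S ≃ₐ[L] S)) ⟨x, hx'⟩
  have h2 := Gal.restrict_smul (AlgEquiv.restrictScalars K (h : S ≃ₐ[L] S)) ⟨x, hx'⟩
  rw [show Gal.restrict p S _ = _ from hgh] at h1
  exact h1.symm.trans h2

lemma natCard_rootSet_splittingField {K : Type*} [Field K] {p : K[X]} (hp : p.Separable) :
    Nat.card (p.rootSet p.SplittingField) = p.natDegree := by
  rw [Nat.card_eq_fintype_card, card_rootSet_eq_natDegree hp (SplittingField.splits p)]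

lemma galIsSymm_of_factorial_le {K : Type*} [Field K] {p : K[X]} (hp : p.Separable)
    (h : p.natDegree.factorial ≤ Nat.card p.Gal) : GalIsSymm p := by
  have : Fact (p.map (algebraMap K p.SplittingField)).Splits := ⟨SplittingField.splits p⟩
  refine (Gal.galActionHom_injective p p.SplittingField).bijective_of_nat_card_le ?_
  rwa [Nat.card_perm, natCard_rootSet_splittingField hp]

end Transfer

end Polynomial

lemma exists_map_oneParamPoly_eq (n r : ℕ) (a : ℕ → ℤ) (b : ℤ) :
    ∃ φ : RatFunc ℚ →+* RatFunc ℂ, (oneParamPoly n r a b).map φ =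
      ((monicIntPoly ℂ n fun j => if j = r then b else a j).map C + C X).map
        (algebraMap ℂ[X] (RatFunc ℂ)) := by
  have hinj : Function.Injective
      ((algebraMap ℂ[X] (RatFunc ℂ)).comp (mapRingHom (algebraMap ℚ ℂ))) :=
    (RatFunc.algebraMap_injective ℂ).comp (map_injective _ (algebraMap ℚ ℂ).injective)
  refine ⟨IsFractionRing.lift hinj, ?_⟩
  have h : oneParamPoly n r a b =
      monicIntPoly (RatFunc ℚ) n (fun j => if j = r then b else a j) + C RatFunc.X := rfl
  rw [h, Polynomial.map_add, Polynomial.map_add, map_monicIntPoly, map_monicIntPoly,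
    map_monicIntPoly, map_C, map_C, ← RatFunc.algebraMap_X, IsFractionRing.lift_algebraMap]
  simp

/-- (Dietmann.) Let `n > r ≥ 1` be coprime and let integers `a_j`
(`1 ≤ j ≤ n−1`, `j ≠ r`) be given. Then for all but `O_n(1)` integers `a_r`, the
polynomial `xⁿ + a₁xⁿ⁻¹ + ⋯ + a_{n−1}x + t` has Galois group `Sₙ` over `ℚ(t)`;
the exceptional count depends only on `n`. -/
theorem one_parameter_symmetric (n : ℕ) :
    ∃ c : ℕ, ∀ r : ℕ, 1 ≤ r → r < n → Nat.Coprime n r → ∀ a : ℕ → ℤ,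
      ∃ S : Finset ℤ, S.card ≤ c ∧ ∀ b : ℤ, b ∉ S →
        Nat.card ((oneParamPoly n r a b).rootSet
            (oneParamPoly n r a b).SplittingField) = n ∧
          GalIsSymm (oneParamPoly n r a b) := by
  have key (r : ℕ) : ∃ c : ℕ, 1 ≤ r → r < n → Nat.Coprime n r → ∀ a : ℕ → ℤ,
      ∃ S : Finset ℤ, S.card ≤ c ∧ ∀ b ∉ S,
        HasIsolatedCritPoint (monicIntPoly ℂ n fun j => if j = r then b else a j) ∧
          IsIndecomposable (monicIntPoly ℂ n fun j => if j = r then b else a j) := by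
    by_cases h : 1 ≤ r ∧ r < n ∧ Nat.Coprime n r
    · obtain ⟨c, hc⟩ := exists_card_le_forall_good ℂ h.1 h.2.1 h.2.2
      exact ⟨c, fun _ _ _ => hc⟩
    · exact ⟨0, fun h1 h2 h3 => (h ⟨h1, h2, h3⟩).elim⟩
  choose c hc using key
  refine ⟨∑ r ∈ Finset.range n, c r, fun r hr hrn hnr a => ?_⟩
  obtain ⟨S, hS, hgood⟩ := hc r hr hrn hnr a
  refine ⟨S, hS.trans (Finset.single_le_sum (fun _ _ => Nat.zero_le _)
    (Finset.mem_range.2 hrn)), fun b hb => ?_⟩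
  obtain ⟨hcrit, hind⟩ := hgood b hb
  obtain ⟨φ, hφ⟩ := exists_map_oneParamPoly_eq n r a b
  set f := monicIntPoly ℂ n fun j => if j = r then b else a j
  set p := oneParamPoly n r a b
  have hf : f.Monic := monic_monicIntPoly ..
  have hfn : f.natDegree = n := natDegree_monicIntPoly ..
  have hn : f.natDegree ≠ 0 := by omega
  have hsep : p.Separable := by
    rw [← separable_map φ, hφ]
    exact (hf.irreducible_map_algebraMap_map_C_add_C_X _ hn).separable
  have hpn : p.natDegree = n := by
    rw [← natDegree_map φ, hφ, (hf.map_C_add_C_X hn).natDegree_map, natDegree_add_C,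
      natDegree_map, hfn]
  refine ⟨(natCard_rootSet_splittingField hsep).trans hpn, galIsSymm_of_factorial_le hsep ?_⟩
  refine le_trans (le_of_eq ?_) (natCard_gal_map_le φ hsep.ne_zero)
  rw [hpn, ← hfn, hφ]
  have := IsScalarTower.to₁₂₄ ℂ ℂ[X] (RatFunc ℂ)
    ((f.map C + C X).map (algebraMap ℂ[X] (RatFunc ℂ))).SplittingField
  exact (natCard_gal_eq_factorial (K := RatFunc ℂ) hf hcrit hind rfl).symm

end
end

section
/- Let n ≥ 2 and let G be a transitive subgroup of S_n. Let C, P ∈ ℕ be sufficiently large in terms of n, let 𝔤 = C³P, and let a_1,…,a_n ∈ ℤ ∩ [−P,P] be such that the complex roots α_1,…,α_n of x^n + a_1 x^{n−1} + ⋯ + a_n are pairwise distinct. Then there exist w = (w_1,…,w_{|G|}) ∈ ℕ^{|G|} and e = (e_1,…,e_n) ∈ ℕ^n with ‖w‖_∞ ≤ C and ‖e‖_∞ ≤ C such that the values r_σ = Σ_{1≤k≤|G|} w_k Σ_{τ∈G} Π_{1≤i≤n} (α_{στ(i)} + 𝔤)^{k·e_i}, as σG ranges over the left cosets of G in S_n,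 are pairwise distinct (equivalently, the resolvent polynomial Φ_{w,e,𝔤}(y) = Π_{σ∈S_n/G} (y − r_σ) is separable). -/
open Polynomial

attribute [local instance] Polynomial.Gal.splits_ℚ_ℂ

noncomputable section

/-- A subgroup of the permutations of `β` is transitive. -/
def IsTransitiveSub {β : Type*} (G : Subgroup (Equiv.Perm β)) : Prop :=
  ∀ x y : β, ∃ σ ∈ G, σ x = y

/-- The monic polynomial `xⁿ + a₁xⁿ⁻¹ + ⋯ + aₙ ∈ ℚ[x]` with integer coefficients `a`. -/
def intPoly (n : ℕ) (a : ℕ → ℤ) : Polynomial ℚ :=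
  Polynomial.X ^ n + ∑ j ∈ Finset.Icc 1 n, Polynomial.C ((a j : ℚ)) * Polynomial.X ^ (n - j)

/-- The value `r_σ = Σ_{1≤k≤|G|} w_k Σ_{τ∈G} Π_{1≤i≤n} (α_{στ(i)} + 𝔤)^{k·eᵢ}`
attached to a coset representative `σ` of `G` in `Sₙ`. -/
def resolventRoot {n : ℕ} (G : Subgroup (Equiv.Perm (Fin n)))
    (w : Fin (Nat.card G) → ℕ) (v : Fin n → ℕ) (g : ℤ) (α : Fin n → ℂ)
    (σ : Equiv.Perm (Fin n)) : ℂ :=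
  ∑ k : Fin (Nat.card G), (w k : ℂ) *
    ∑ᶠ τ : G, ∏ i : Fin n,
      (α (σ ((τ : Equiv.Perm (Fin n)) i)) + (g : ℂ)) ^ (((k : ℕ) + 1) * v i)

/-- The resolvent polynomial `Φ_{w,e,𝔤}(y) = Π_{σ ∈ Sₙ/G} (y − r_σ)`, the product being
over the left cosets of `G` in `Sₙ`. -/
def resolventPoly {n : ℕ} (G : Subgroup (Equiv.Perm (Fin n)))
    (w : Fin (Nat.card G) → ℕ) (v : Fin n → ℕ) (g : ℤ) (α : Fin n → ℂ) :
    Polynomial ℂ :=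
  ∏ᶠ q : Equiv.Perm (Fin n) ⧸ G,
    (Polynomial.X - Polynomial.C (resolventRoot G w v g α q.out))

end

/-- A finite family of sets of lattice points, each of which meets every line in some fixed
coordinate direction at most once, does not cover a large enough box. -/
theorem exists_le_forall_notMem_of_line_subsingleton {ι S : Type*} [Finite ι] [Fintype S]
    (M : ℕ) (hM : Fintype.card S ≤ M) (B : S → Set (ι → ℕ))
    (h : ∀ s, ∃ i, ∀ e ∈ B s, ∀ e' ∈ B s, e i ≤ M → e' i ≤ M →
      (∀ j, j ≠ i → e j = e' j) → e i = e' i) :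
    ∃ e : ι → ℕ, (∀ i, e i ≤ M) ∧ ∀ s, e ∉ B s := by
  classical
  have := Fintype.ofFinite ι
  let toNat : (ι → Fin (M + 1)) → ι → ℕ := fun f i => f i
  let bad : S → Finset (ι → Fin (M + 1)) := fun s => {f | toNat f ∈ B s}
  have card_bad (s : S) : (bad s).card * (M + 1) ≤ Fintype.card (ι → Fin (M + 1)) := by
    obtain ⟨i, hi⟩ := h s
    have key : (bad s ×ˢ (Finset.univ : Finset (Fin (M + 1)))).card ≤
        (Finset.univ : Finset (ι → Fin (M + 1))).card := by
      refine Finset.card_le_card_of_injOn (fun p => Function.update p.1 i p.2)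
        (fun _ _ => Finset.mem_coe.2 (Finset.mem_univ _)) ?_
      rintro ⟨f, x⟩ hf ⟨f', x'⟩ hf' hff
      simp only [Finset.coe_product, Set.mem_prod, Finset.mem_coe, bad, Finset.mem_filter,
        Finset.mem_univ, true_and, and_true] at hf hf'
      have hne : ∀ j, j ≠ i → f j = f' j := fun j hj => by
        simpa [hj] using congrFun hff j
      have hx : x = x' := by simpa using congrFun hff i
      have hfi : toNat f i = toNat f' i :=
        hi _ hf _ hf' (Nat.lt_succ_iff.1 (f i).2) (Nat.lt_succ_iff.1 (f' i).2)
          fun j hj => congrArg Fin.val (hne j hj)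
      refine Prod.ext (funext fun j => ?_) hx
      by_cases hj : j = i
      · subst hj; exact Fin.ext hfi
      · exact hne j hj
    simpa [Finset.card_product] using key
  by_contra! hcover
  have hsub : (Finset.univ : Finset (ι → Fin (M + 1))) ⊆ Finset.univ.biUnion bad := by
    intro f _
    obtain ⟨s, hs⟩ := hcover (toNat f) fun i => Nat.lt_succ_iff.1 (f i).2
    exact Finset.mem_biUnion.2 ⟨s, Finset.mem_univ _, by simpa [bad] using hs⟩
  have h1 : Fintype.card (ι → Fin (M + 1)) ≤ ∑ s, (bad s).card :=
    (Finset.card_le_card hsub).trans Finset.card_biUnion_le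
  have h2 : (∑ s, (bad s).card) * (M + 1) ≤ M * Fintype.card (ι → Fin (M + 1)) := by
    rw [Finset.sum_mul]
    refine (Finset.sum_le_sum fun s _ => card_bad s).trans ?_
    rw [Finset.sum_const, Finset.card_univ, smul_eq_mul]
    exact Nat.mul_le_mul_right _ hM
  have h3 : 0 < Fintype.card (ι → Fin (M + 1)) := Fintype.card_pos
  nlinarith

/-- In characteristic zero, two families of `N` elements whose first `N` power sums agree
coincide as multisets. -/
theorem map_univ_eq_of_sum_pow_eq {ι K : Type*} [Fintype ι] [Field K] [CharZero K]
    (f g : ι → K)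
    (h : ∀ k, 0 < k → k ≤ Fintype.card ι → ∑ i, f i ^ k = ∑ i, g i ^ k) :
    (Finset.univ : Finset ι).val.map f = (Finset.univ : Finset ι).val.map g := by
  have hesymm : ∀ k, k ≤ Fintype.card ι →
      MvPolynomial.aeval f (MvPolynomial.esymm ι K k) =
        MvPolynomial.aeval g (MvPolynomial.esymm ι K k) := by
    intro k
    induction k using Nat.strong_induction_on with
    | _ k ih =>
      intro hk
      rcases Nat.eq_zero_or_pos k with rfl | hpos
      · simp
      · have hk0 : (k : K) ≠ 0 := by exact_mod_cast hpos.ne'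
        have newton (x : ι → K) :=
          congrArg (MvPolynomial.aeval x) (MvPolynomial.mul_esymm_eq_sum ι K k)
        simp only [map_mul, map_natCast, map_sum, map_pow, map_neg, map_one] at newton
        refine mul_left_cancel₀ hk0 ?_
        rw [newton f, newton g]
        congr 1
        refine Finset.sum_congr rfl fun a ha => ?_
        obtain ⟨ha, hlt⟩ := Finset.mem_filter.1 ha
        rw [Finset.HasAntidiagonal.mem_antidiagonal] at ha
        rw [ih a.1 hlt (by omega)]
        congr 1
        simpa [MvPolynomial.psum] using h a.2 (by omega) (by omega)
  have hprod : (((Finset.univ : Finset ι).val.map f).map fun t => X - C t).prod =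
      (((Finset.univ : Finset ι).val.map g).map fun t => X - C t).prod := by
    rw [Multiset.prod_X_sub_X_eq_sum_esymm, Multiset.prod_X_sub_X_eq_sum_esymm]
    simp only [Multiset.card_map]
    refine Finset.sum_congr rfl fun j hj => ?_
    have hj' : j ≤ Fintype.card ι := by
      have := Finset.mem_range.1 hj
      change j < Fintype.card ι + 1 at this
      omega
    have := hesymm j hj'
    rw [MvPolynomial.aeval_esymm_eq_multiset_esymm,
      MvPolynomial.aeval_esymm_eq_multiset_esymm] at this
    rw [this]
  simpa only [roots_multiset_prod_X_sub_C] using congrArg Polynomial.roots hprod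

/-- The power maps of bounded exponent are injective on a common neighbourhood of `1`. -/
theorem exists_pos_forall_pow_injOn_ball (M : ℕ) :
    ∃ δ : ℝ, 0 < δ ∧ δ ≤ 1 ∧ ∀ u v : ℂ, ‖u - 1‖ < δ → ‖v - 1‖ < δ →
      ∀ m, 0 < m → m ≤ M → u ^ m = v ^ m → u = v := by
  have hev : ∀ᶠ p : ℂ × ℂ in nhds (1, 1), ∀ m ∈ Finset.Icc 1 M,
      ∑ i ∈ Finset.range m, p.1 ^ i * p.2 ^ (m - 1 - i) ≠ 0 := by
    rw [Filter.eventually_all_finset]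
    intro m hm
    have hcont : Continuous fun p : ℂ × ℂ =>
        ∑ i ∈ Finset.range m, p.1 ^ i * p.2 ^ (m - 1 - i) := by fun_prop
    refine hcont.continuousAt.eventually_ne ?_
    have := (Finset.mem_Icc.1 hm).1
    simp
    omega
  obtain ⟨ε, hε, hball⟩ := Metric.eventually_nhds_iff.1 hev
  refine ⟨min ε 1, lt_min hε one_pos, min_le_right _ _, fun u v hu hv m hm hmM huv => ?_⟩
  have hne := hball (y := (u, v))
    (by
      rw [Prod.dist_eq, max_lt_iff, dist_eq_norm, dist_eq_norm]
      exact ⟨hu.trans_le (min_le_left _ _), hv.trans_le (min_le_left _ _)⟩)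
    m (Finset.mem_Icc.2 ⟨hm, hmM⟩)
  have hgeom := (Commute.all u v).geom_sum₂_mul m
  rw [huv, sub_self] at hgeom
  exact sub_eq_zero.1 ((mul_eq_zero.1 hgeom).resolve_left hne)

/-- A crude bound for the roots of an integer polynomial in terms of its coefficients. -/
theorem norm_le_of_intPoly_root {n P : ℕ} (hn : 1 ≤ n) (hP : 1 ≤ P) (a : ℕ → ℤ)
    (ha : ∀ j ∈ Finset.Icc 1 n, |a j| ≤ (P : ℤ)) (z : ℂ)
    (hz : (Polynomial.map (algebraMap ℚ ℂ) (intPoly n a)).eval z = 0) :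
    ‖z‖ ≤ n * P := by
  have hnP : (1 : ℝ) ≤ n * P := by exact_mod_cast Nat.mul_pos hn hP
  rcases le_or_gt ‖z‖ 1 with h1 | h1
  · exact h1.trans hnP
  have heq : z ^ n = -∑ j ∈ Finset.Icc 1 n, (a j : ℂ) * z ^ (n - j) := by
    rw [eq_neg_iff_add_eq_zero, ← hz]
    simp [intPoly, Polynomial.eval_finsetSum, Polynomial.map_sum]
  have hle : ‖z‖ ^ n ≤ n * P * ‖z‖ ^ (n - 1) := by
    rw [← norm_pow, heq, norm_neg]
    refine (norm_sum_le _ _).trans ?_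
    have hterm : ∀ j ∈ Finset.Icc 1 n, ‖(a j : ℂ) * z ^ (n - j)‖ ≤ P * ‖z‖ ^ (n - 1) := by
      intro j hj
      rw [norm_mul, norm_pow, Complex.norm_intCast]
      have hj1 := (Finset.mem_Icc.1 hj).1
      refine mul_le_mul (by exact_mod_cast ha j hj)
        (pow_le_pow_right₀ h1.le (by omega)) (by positivity) (by positivity)
    refine (Finset.sum_le_sum hterm).trans (le_of_eq ?_)
    simp [mul_assoc]
  obtain ⟨k, rfl⟩ := Nat.exists_eq_add_of_le' hn
  rw [pow_succ', Nat.add_sub_cancel] at hle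
  exact le_of_mul_le_mul_right hle (by positivity)

/-- If the power maps of exponent at most `M` separate the values of `β`, then some exponent
vector makes the monomials attached to all permutations distinct. -/
theorem exists_injective_prod_pow {n M : ℕ} (hM : Nat.factorial n ^ 2 ≤ M) (β : Fin n → ℂ)
    (hβ : ∀ i, β i ≠ 0)
    (hpow : ∀ i j m, 0 < m → m ≤ M → β i ^ m = β j ^ m → i = j) :
    ∃ v : Fin n → ℕ, (∀ i, v i ≤ M) ∧
      Function.Injective fun ρ : Equiv.Perm (Fin n) => ∏ i, β (ρ i) ^ v i := by
  classical
  have hcard : Fintype.card {p : Equiv.Perm (Fin n) × Equiv.Perm (Fin n) // p.1 ≠ p.2} ≤ M := by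
    refine (Fintype.card_subtype_le _).trans ?_
    rwa [Fintype.card_prod, Fintype.card_perm, Fintype.card_fin, ← sq]
  obtain ⟨v, hv, hv'⟩ := exists_le_forall_notMem_of_line_subsingleton M hcard
    (fun p => {e : Fin n → ℕ | ∏ i, β (p.1.1 i) ^ e i = ∏ i, β (p.1.2 i) ^ e i}) <| by
      rintro ⟨⟨ρ, ρ'⟩, hne⟩
      obtain ⟨i, hi⟩ : ∃ i, ρ i ≠ ρ' i := by
        by_contra! hcon
        exact hne (Equiv.ext hcon)
      refine ⟨i, ?_⟩
      have key : ∀ e e' : Fin n → ℕ,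
          ∏ i, β (ρ i) ^ e i = ∏ i, β (ρ' i) ^ e i →
          ∏ i, β (ρ i) ^ e' i = ∏ i, β (ρ' i) ^ e' i →
          e' i ≤ M → (∀ j, j ≠ i → e j = e' j) → ¬ e i < e' i := by
        intro e e' he he' hle hee hlt
        refine hi (hpow (ρ i) (ρ' i) (e' i - e i) (by omega) (by omega) ?_)
        have split (π : Equiv.Perm (Fin n)) :
            ∏ j, β (π j) ^ e' j = (∏ j, β (π j) ^ e j) * β (π i) ^ (e' i - e i) := by
          rw [← Finset.mul_prod_erase Finset.univ (fun j => β (π j) ^ e' j) (Finset.mem_univ i),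
            ← Finset.mul_prod_erase Finset.univ (fun j => β (π j) ^ e j) (Finset.mem_univ i),
            mul_right_comm, ← pow_add, Nat.add_sub_cancel' hlt.le]
          congr 1
          exact Finset.prod_congr rfl fun j hj => by rw [hee j (Finset.ne_of_mem_erase hj)]
        rw [split ρ, split ρ', he] at he'
        exact mul_left_cancel₀ (Finset.prod_ne_zero_iff.2 fun j _ => pow_ne_zero _ (hβ _)) he'
      intro e he e' he' hle hle' hee
      exact le_antisymm (not_lt.1 (key e' e he' he hle fun j hj => (hee j hj).symm))
        (not_lt.1 (key e e' he he' hle' hee))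
  refine ⟨v, hv, fun ρ ρ' h => ?_⟩
  by_contra hne
  exact (hv' ⟨(ρ, ρ'), hne⟩ h).elim

/-- If the monomials attached to all permutations are distinct, then some bounded weight vector
makes the weighted power sums over the left cosets of `G` distinct. -/
theorem exists_weights_separating_cosets {Γ : Type*} [Group Γ] [Fintype Γ] (G : Subgroup Γ)
    {M : ℕ} (hM : Fintype.card Γ ^ 2 ≤ M) (x : Γ → ℂ) (hx : Function.Injective x) :
    ∃ w : Fin (Nat.card G) → ℕ, (∀ k, w k ≤ M) ∧ ∀ σ σ' : Γ,
      ∑ k, (w k : ℂ) * ∑ᶠ τ : G, x (σ * τ) ^ ((k : ℕ) + 1) =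
        ∑ k, (w k : ℂ) * ∑ᶠ τ : G, x (σ' * τ) ^ ((k : ℕ) + 1) → σ⁻¹ * σ' ∈ G := by
  classical
  have hcard : Fintype.card {p : Γ × Γ // p.1⁻¹ * p.2 ∉ G} ≤ M := by
    refine (Fintype.card_subtype_le _).trans ?_
    rwa [Fintype.card_prod, ← sq]
  set s : Γ → Fin (Nat.card G) → ℂ :=
    fun σ k => ∑ᶠ τ : G, x (σ * τ) ^ ((k : ℕ) + 1) with hs
  have hsep : ∀ σ σ' : Γ, s σ = s σ' → σ⁻¹ * σ' ∈ G := by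
    intro σ σ' hss
    have hmulti := map_univ_eq_of_sum_pow_eq (fun τ : G => x (σ * τ)) (fun τ : G => x (σ' * τ))
      fun k hk hkG => by
        rw [← Nat.card_eq_fintype_card] at hkG
        have := congrFun hss ⟨k - 1, by omega⟩
        simpa only [hs, finsum_eq_sum_of_fintype, Nat.sub_add_cancel hk] using this
    have hmem : x (σ' * (1 : G)) ∈
        (Finset.univ : Finset G).val.map fun τ : G => x (σ * τ) := by
      rw [hmulti]
      exact Multiset.mem_map_of_mem _ (Finset.mem_univ (1 : G))
    obtain ⟨τ, -, hτ⟩ := Multiset.mem_map.1 hmem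
    have := hx hτ
    rw [OneMemClass.coe_one, mul_one] at this
    rw [← this, inv_mul_cancel_left]
    exact τ.2
  obtain ⟨w, hw, hw'⟩ := exists_le_forall_notMem_of_line_subsingleton M hcard
    (fun p => {w : Fin (Nat.card G) → ℕ |
      ∑ k, (w k : ℂ) * s p.1.1 k = ∑ k, (w k : ℂ) * s p.1.2 k}) <| by
      rintro ⟨⟨σ, σ'⟩, hp⟩
      obtain ⟨k, hk⟩ : ∃ k, s σ k ≠ s σ' k := by
        by_contra! hcon
        exact hp (hsep σ σ' (funext hcon))
      refine ⟨k, fun w hw w' hw' _ _ hww => ?_⟩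
      have hdiff (ρ : Γ) : ∑ j, (w j : ℂ) * s ρ j - ∑ j, (w' j : ℂ) * s ρ j =
          ((w k : ℂ) - w' k) * s ρ k := by
        rw [← Finset.sum_sub_distrib, Finset.sum_eq_single k]
        · ring
        · intro j _ hj
          rw [hww j hj, sub_self]
        · exact fun h => (h (Finset.mem_univ k)).elim
      have heq : ((w k : ℂ) - w' k) * s σ k = ((w k : ℂ) - w' k) * s σ' k := by
        rw [← hdiff, ← hdiff]
        exact congrArg₂ (· - ·) hw hw'
      have hzero : (w k : ℂ) - w' k = 0 := by
        by_contra h0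
        exact hk (mul_left_cancel₀ h0 heq)
      exact_mod_cast sub_eq_zero.1 hzero
  refine ⟨w, hw, fun σ σ' h => ?_⟩
  by_contra hne
  exact (hw' ⟨(σ, σ'), hne⟩ h).elim

/-- (Chow–Dietmann, separable resolvents.) For `C, P` sufficiently
large in terms of `n`, `𝔤 = C³P`, and `a₁, …, aₙ ∈ [−P, P]` such that the complex roots
of `xⁿ + a₁xⁿ⁻¹ + ⋯ + aₙ` are pairwise distinct, there exist `w`, `e` with
`‖w‖_∞, ‖e‖_∞ ≤ C` whose resolvent values `r_σ` are pairwise distinct as `σG` ranges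
over the left cosets of `G` in `Sₙ` (i.e. the resolvent `Φ_{w,e,𝔤}` is separable). -/
theorem separable_resolvent_exists (n : ℕ) (hn : 2 ≤ n) :
    ∃ c₀ : ℕ,
      ∀ G : Subgroup (Equiv.Perm (Fin n)), IsTransitiveSub G →
      ∀ C P : ℕ, c₀ ≤ C → c₀ ≤ P →
      ∀ a : ℕ → ℤ, (∀ j ∈ Finset.Icc 1 n, |a j| ≤ (P : ℤ)) →
      ∀ α : Fin n → ℂ,
        Polynomial.map (algebraMap ℚ ℂ) (intPoly n a) =
          ∏ i : Fin n, (Polynomial.X - Polynomial.C (α i)) →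
        Function.Injective α →
        ∃ (w : Fin (Nat.card G) → ℕ) (v : Fin n → ℕ),
          (∀ k, w k ≤ C) ∧ (∀ i, v i ≤ C) ∧
          ∀ σ σ' : Equiv.Perm (Fin n),
            resolventRoot G w v ((C : ℤ) ^ 3 * (P : ℤ)) α σ =
              resolventRoot G w v ((C : ℤ) ^ 3 * (P : ℤ)) α σ' →
            σ⁻¹ * σ' ∈ G := by
  set M := Nat.factorial n ^ 2 with hM
  obtain ⟨δ, hδ, hδ1, hinj⟩ := exists_pos_forall_pow_injOn_ball M
  obtain ⟨K, hK⟩ := exists_nat_gt ((n : ℝ) / δ)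
  refine ⟨max (max M K) 1, fun G _ C P hC hP a ha α hα hαinj => ?_⟩
  have hMC : M ≤ C := ((le_max_left _ _).trans (le_max_left _ _)).trans hC
  have hKC : K ≤ C := ((le_max_right _ _).trans (le_max_left _ _)).trans hC
  have hC1 : 1 ≤ C := (le_max_right _ _).trans hC
  have hP1 : 1 ≤ P := (le_max_right _ _).trans hP
  have hCR : (1 : ℝ) ≤ C := by exact_mod_cast hC1
  have hPR : (1 : ℝ) ≤ P := by exact_mod_cast hP1
  set g : ℤ := (C : ℤ) ^ 3 * (P : ℤ) with hg
  have hgnorm : ‖(g : ℂ)‖ = (C : ℝ) ^ 3 * P := by simp [hg]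
  have hgpos : 0 < ‖(g : ℂ)‖ := by rw [hgnorm]; positivity
  have hg0 : (g : ℂ) ≠ 0 := norm_pos_iff.1 hgpos
  let β : Fin n → ℂ := fun i => α i + g
  have hclose : ∀ i, ‖β i / g - 1‖ < δ := by
    intro i
    have hroot : ‖α i‖ ≤ n * P := by
      refine norm_le_of_intPoly_root (by omega) hP1 a ha (α i) ?_
      rw [hα, Polynomial.eval_prod]
      exact Finset.prod_eq_zero (Finset.mem_univ i) (by simp)
    have hnC : (n : ℝ) < δ * C := by
      have : (n : ℝ) / δ < C := hK.trans_le (by exact_mod_cast hKC)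
      rwa [div_lt_iff₀' hδ] at this
    have hC3 : (C : ℝ) ≤ (C : ℝ) ^ 3 := le_self_pow₀ hCR (by norm_num)
    have hβg : β i / g - 1 = α i / g := by
      simp only [β]
      field_simp
      ring
    rw [hβg, norm_div, div_lt_iff₀ hgpos, hgnorm]
    calc ‖α i‖ ≤ n * P := hroot
      _ < δ * C * P := by gcongr
      _ ≤ δ * ((C : ℝ) ^ 3 * P) := by
        rw [mul_assoc]
        gcongr
  have hβ0 : ∀ i, β i ≠ 0 := by
    intro i hi
    have := hclose i
    rw [hi, zero_div, zero_sub, norm_neg, norm_one] at this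
    linarith
  obtain ⟨v, hv, hvinj⟩ := exists_injective_prod_pow (M := M) le_rfl β hβ0 <| by
    intro i j m hm hmM hij
    have hdiv : β i / (g : ℂ) = β j / g :=
      hinj _ _ (hclose i) (hclose j) m hm hmM (by rw [div_pow, div_pow, hij])
    exact hαinj (add_right_cancel ((div_left_inj' hg0).1 hdiv))
  obtain ⟨w, hw, hwsep⟩ := exists_weights_separating_cosets G (M := M)
    (by rw [Fintype.card_perm, Fintype.card_fin]) _ hvinj
  have hres (σ : Equiv.Perm (Fin n)) : resolventRoot G w v g α σ =
      ∑ k, (w k : ℂ) * ∑ᶠ τ : G, (∏ i, β ((σ * τ) i) ^ v i) ^ ((k : ℕ) + 1) := by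
    simp only [resolventRoot, ← Finset.prod_pow, ← pow_mul, Equiv.Perm.mul_apply, β,
      mul_comm]
  refine ⟨w, v, fun k => (hw k).trans hMC, fun i => (hv i).trans hMC, fun σ σ' h => ?_⟩
  rw [hres, hres] at h
  exact hwsep σ σ' h
end

section
/- Let n ≥ 2, let G be a transitive subgroup of S_n, let w ∈ ℕ^{|G|}, e ∈ ℕ^n, 𝔤 ∈ ℤ, and let a_1,…,a_n ∈ ℤ be such that f(x) = x^n + a_1 x^{n−1} + ⋯ + a_n has Galois group S_n over ℚ. Then the resolvent polynomial Φ_{w,e,𝔤}(y) = Π_{σ∈S_n/G} (y − r_σ) has rational (indeed integer) coefficients, and if Φ_{w,e,𝔤} is separable then it is irreducible over ℚ. -/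
open Polynomial

attribute [local instance] Polynomial.Gal.splits_ℚ_ℂ

section CosetValue

variable {R S : Type*} [CommRing R] [CommRing S] {n : ℕ} (G : Subgroup (Equiv.Perm (Fin n)))
  (w : Fin (Nat.card G) → ℕ) (v : Fin n → ℕ) (g : ℤ)

/-- The expression `resolventRoot`, evaluated at a tuple in an arbitrary commutative ring. -/
noncomputable def cosetValue (β : Fin n → R) (σ : Equiv.Perm (Fin n)) : R :=
  ∑ k : Fin (Nat.card G), (w k : R) *
    ∑ᶠ τ : G, ∏ i : Fin n,
      (β (σ ((τ : Equiv.Perm (Fin n)) i)) + (g : R)) ^ (((k : ℕ) + 1) * v i)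

lemma resolventRoot_eq_cosetValue (α : Fin n → ℂ) (σ : Equiv.Perm (Fin n)) :
    resolventRoot G w v g α σ = cosetValue G w v g α σ := rfl

lemma map_cosetValue (φ : R →+* S) (β : Fin n → R) (σ : Equiv.Perm (Fin n)) :
    φ (cosetValue G w v g β σ) = cosetValue G w v g (fun i => φ (β i)) σ := by
  classical
  simp only [cosetValue, finsum_eq_sum_of_fintype, map_sum, map_mul, map_prod, map_pow, map_add,
    map_natCast, map_intCast]

lemma cosetValue_comp (β : Fin n → R) (π σ : Equiv.Perm (Fin n)) :
    cosetValue G w v g (fun i => β (π i)) σ = cosetValue G w v g β (π * σ) := rfl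

lemma cosetValue_mul_right (β : Fin n → R) (σ : Equiv.Perm (Fin n)) (h : G) :
    cosetValue G w v g β (σ * h) = cosetValue G w v g β σ := by
  refine Finset.sum_congr rfl fun k _ => congrArg _ ?_
  exact finsum_comp_equiv (Equiv.mulLeft h)
    (f := fun τ : G => ∏ i : Fin n,
      (β (σ ((τ : Equiv.Perm (Fin n)) i)) + (g : R)) ^ (((k : ℕ) + 1) * v i))

lemma cosetValue_congr_coset (β : Fin n → R) {σ τ : Equiv.Perm (Fin n)}
    (h : (σ : Equiv.Perm (Fin n) ⧸ G) = τ) :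
    cosetValue G w v g β σ = cosetValue G w v g β τ := by
  simpa using (cosetValue_mul_right G w v g β σ ⟨σ⁻¹ * τ, QuotientGroup.eq.mp h⟩).symm

lemma cosetValue_out_smul (β : Fin n → R) (π : Equiv.Perm (Fin n))
    (q : Equiv.Perm (Fin n) ⧸ G) :
    cosetValue G w v g β (π • q).out = cosetValue G w v g β (π * q.out) :=
  cosetValue_congr_coset G w v g β <| by
    conv_rhs => rw [← smul_eq_mul, ← MulAction.Quotient.smul_coe]
    simp only [QuotientGroup.out_eq']

lemma isIntegral_cosetValue {β : Fin n → R} (hβ : ∀ i, IsIntegral ℤ (β i))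
    (σ : Equiv.Perm (Fin n)) : IsIntegral ℤ (cosetValue G w v g β σ) := by
  have h := map_cosetValue G w v g (algebraMap (integralClosure ℤ R) R)
    (fun i => ⟨β i, hβ i⟩) σ
  change _ = cosetValue G w v g β σ at h
  exact h ▸ (cosetValue G w v g _ σ : integralClosure ℤ R).2

end CosetValue

/-- A polynomial over `F` whose roots in `L` are simple and form a single orbit under
automorphisms is irreducible. -/
lemma irreducible_of_conjugate_roots {F L ι : Type*} [Field F] [Field L] [Algebra F L]
    [Fintype ι] [Nonempty ι] {ρ : ι → L} (hρ : Function.Injective ρ)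
    (hconj : ∀ i j, ∃ φ : L ≃ₐ[F] L, φ (ρ i) = ρ j) {P : F[X]}
    (hP : P.map (algebraMap F L) = ∏ i, (X - C (ρ i))) : Irreducible P := by
  obtain ⟨i₀⟩ := ‹Nonempty ι›
  have hmonic : P.Monic := monic_of_injective (algebraMap F L).injective <| by
    rw [hP]; exact monic_prod_X_sub_C _ _
  have hroot : aeval (ρ i₀) P = 0 := by
    rw [← eval_map_algebraMap, hP, eval_prod]
    exact Finset.prod_eq_zero (Finset.mem_univ i₀) (by simp)
  have hint : IsIntegral F (ρ i₀) := ⟨P, hmonic, hroot⟩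
  have hdvd : P.map (algebraMap F L) ∣ (minpoly F (ρ i₀)).map (algebraMap F L) := by
    rw [hP]
    refine Finset.prod_dvd_of_coprime
      (fun i _ j _ hij => pairwise_coprime_X_sub_C hρ hij) fun j _ => ?_
    obtain ⟨φ, hφ⟩ := hconj i₀ j
    rw [dvd_iff_isRoot, IsRoot, eval_map_algebraMap, ← hφ, aeval_algHom_apply, minpoly.aeval,
      map_zero]
  rw [eq_of_monic_of_associated hmonic (minpoly.monic hint)
    (associated_of_dvd_dvd ((map_dvd_map' _).mp hdvd) (minpoly.dvd F _ hroot))]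
  exact minpoly.irreducible hint

/-- A product of linear factors whose roots are algebraic integers permuted by the Galois group
has integer coefficients. -/
lemma exists_int_map_eq_prod_X_sub_C {K ι : Type*} [Field K] [Algebra ℚ K]
    [FiniteDimensional ℚ K] [IsGalois ℚ K] [Fintype ι] {ρ : ι → K}
    (hint : ∀ i, IsIntegral ℤ (ρ i))
    (hperm : ∀ φ : K ≃ₐ[ℚ] K, ∃ π : Equiv.Perm ι, ∀ i, φ (ρ i) = ρ (π i)) :
    ∃ P : ℤ[X], P.map (Int.castRingHom K) = ∏ i, (X - C (ρ i)) := by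
  rw [← mem_lifts, lifts_iff_coeff_lifts]
  intro m
  obtain ⟨c, hc⟩ := (IsGalois.mem_range_algebraMap_iff_fixed
      ((∏ i, (X - C (ρ i))).coeff m)).mpr fun φ => by
    obtain ⟨π, hπ⟩ := hperm φ
    have hfix : (∏ i, (X - C (ρ i))).map (φ : K →+* K) = ∏ i, (X - C (ρ i)) := by
      simpa [Polynomial.map_prod, hπ] using Equiv.prod_comp π fun i => X - C (ρ i)
    simpa [coeff_map] using congrArg (fun P => P.coeff m) hfix
  have hcoeff : IsIntegral ℤ ((∏ i, (X - C (ρ i))).coeff m) := by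
    have hlift : ∏ i, (X - C (ρ i)) ∈ lifts (algebraMap (integralClosure ℤ K) K) :=
      prod_mem fun i _ => (mem_lifts _).mpr
        ⟨X - C (⟨ρ i, hint i⟩ : integralClosure ℤ K), by
          simp only [Polynomial.map_sub, map_X, map_C]; rfl⟩
    obtain ⟨x, hx⟩ := (lifts_iff_coeff_lifts _).mp hlift m
    exact hx ▸ x.2
  rw [← hc, isIntegral_algebraMap_iff (algebraMap ℚ K).injective,
    IsIntegrallyClosed.isIntegral_iff] at hcoeff
  obtain ⟨z, rfl⟩ := hcoeff
  exact ⟨z, by simpa using hc⟩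

lemma isIntegral_of_isRoot_intPoly {K : Type*} [Field K] [Algebra ℚ K] {n : ℕ} {a : ℕ → ℤ}
    (hmonic : (intPoly n a).Monic) {x : K} (hx : aeval x (intPoly n a) = 0) :
    IsIntegral ℤ x := by
  let P : ℤ[X] := X ^ n + ∑ j ∈ Finset.Icc 1 n, C (a j) * X ^ (n - j)
  have hP : P.map (algebraMap ℤ ℚ) = intPoly n a := by
    simp [P, intPoly, Polynomial.map_sum]
  refine ⟨P, monic_of_injective (algebraMap ℤ ℚ).injective_int (hP ▸ hmonic), ?_⟩
  rw [← hP, aeval_map_algebraMap] at hx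
  exact hx

instance isGalois_splittingField {F : Type*} [Field F] [CharZero F] (p : F[X]) :
    IsGalois F p.SplittingField :=
  IsGalois.mk

/-- A numbering of the complex roots of `f` lifts to a Galois extension of `ℚ`; the Galois group
permutes the lifted roots, and realizes every permutation if its action is surjective. -/
lemma exists_isGalois_roots {f : ℚ[X]} {n : ℕ} (hf : f ≠ 0) {α : Fin n → ℂ}
    (hroots : f.map (algebraMap ℚ ℂ) = ∏ i : Fin n, (X - C (α i)))
    (hcard : Nat.card (f.rootSet ℂ) = n)
    (hsurj : Function.Surjective (Gal.galActionHom f ℂ)) :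
    ∃ (K : Type) (_ : Field K) (_ : Algebra ℚ K) (_ : FiniteDimensional ℚ K)
      (_ : IsGalois ℚ K) (ι : K →ₐ[ℚ] ℂ) (β : Fin n → K),
      (∀ i, ι (β i) = α i) ∧
      (∀ i, aeval (β i) f = 0) ∧
      (∀ φ : K ≃ₐ[ℚ] K, ∃ π : Equiv.Perm (Fin n), ∀ i, φ (β i) = β (π i)) ∧
      ∀ π : Equiv.Perm (Fin n), ∃ φ : K ≃ₐ[ℚ] K, ∀ i, φ (β i) = β (π i) := by
  have hmem (x : ℂ) : x ∈ f.rootSet ℂ ↔ ∃ i, α i = x := by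
    rw [mem_rootSet_of_ne hf, ← eval_map_algebraMap, hroots, eval_prod, Finset.prod_eq_zero_iff]
    simp [sub_eq_zero, eq_comm]
  let r : Fin n → f.rootSet ℂ := fun i => ⟨α i, (hmem _).mpr ⟨i, rfl⟩⟩
  have hr : Function.Surjective r := fun x => by
    obtain ⟨i, hi⟩ := (hmem x).mp x.2
    exact ⟨i, Subtype.ext hi⟩
  let e : Fin n ≃ f.rootSet ℂ :=
    Equiv.ofBijective r (hr.bijective_of_nat_card_le (by rw [hcard, Nat.card_fin]))
  let b (i : Fin n) : f.rootSet f.SplittingField := (Gal.rootsEquivRoots f ℂ).symm (e i)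
  have hb (φ : f.Gal) (π : Equiv.Perm (Fin n))
      (h : ∀ i, Gal.galActionHom f ℂ φ (e i) = e (π i)) (i : Fin n) :
      φ (b i) = b (π i) := by
    have h' : Gal.rootsEquivRoots f ℂ (φ • b i) = e (π i) := h i
    exact congrArg Subtype.val ((Gal.rootsEquivRoots f ℂ).eq_symm_apply.mpr h')
  refine ⟨f.SplittingField, inferInstance, SplittingField.instAlgebra_1 f,
    IsSplittingField.finiteDimensional _ f, inferInstance,
    IsScalarTower.toAlgHom ℚ f.SplittingField ℂ, fun i => b i, fun i => ?_,
    fun i => (mem_rootSet.mp (b i).2).2, fun φ => ?_, fun π => ?_⟩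
  · exact congrArg Subtype.val ((Gal.rootsEquivRoots f ℂ).apply_symm_apply (e i))
  · exact ⟨e.symm.permCongr (Gal.galActionHom f ℂ φ), hb φ _ fun i => by
      simp [Equiv.permCongr_apply]⟩
  · obtain ⟨φ, hφ⟩ := hsurj (e.permCongr π)
    exact ⟨φ, hb φ π fun i => by simp [hφ, Equiv.permCongr_apply]⟩

/-- (Chow–Dietmann, irreducible resolvents.) If
`f = xⁿ + a₁xⁿ⁻¹ + ⋯ + aₙ ∈ ℤ[x]` has Galois group `Sₙ` over `ℚ`, then the resolvent
`Φ_{w,e,𝔤}(y) = Π_{σ ∈ Sₙ/G} (y − r_σ)` has integer (in particular rational)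
coefficients, and if it is separable then it is irreducible over `ℚ`. -/
theorem resolvent_irreducible (n : ℕ) (hn : 2 ≤ n)
    (G : Subgroup (Equiv.Perm (Fin n))) (htrans : IsTransitiveSub G)
    (w : Fin (Nat.card G) → ℕ) (v : Fin n → ℕ) (g : ℤ)
    (a : ℕ → ℤ) (α : Fin n → ℂ)
    (hroots : Polynomial.map (algebraMap ℚ ℂ) (intPoly n a) =
      ∏ i : Fin n, (Polynomial.X - Polynomial.C (α i)))
    (hcard : Nat.card ((intPoly n a).rootSet ℂ) = n)
    (hSn : Function.Bijective (Polynomial.Gal.galActionHom (intPoly n a) ℂ)) :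
    (∃ Ψz : Polynomial ℤ,
      Ψz.map (Int.castRingHom ℂ) = resolventPoly G w v g α) ∧
    ∀ Ψ : Polynomial ℚ, Ψ.map (algebraMap ℚ ℂ) = resolventPoly G w v g α →
      (resolventPoly G w v g α).Separable → Irreducible Ψ := by
  classical
  have hmonic : (intPoly n a).Monic := monic_of_injective (algebraMap ℚ ℂ).injective <| by
    rw [hroots]; exact monic_prod_X_sub_C _ _
  obtain ⟨K, _, _, _, _, ι, β, hβα, hβroot, hperm, hsurj⟩ :=
    exists_isGalois_roots hmonic.ne_zero hroots hcard hSn.surjective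
  let ρ (q : Equiv.Perm (Fin n) ⧸ G) : K :=
    cosetValue G w v g β q.out
  have hρ (φ : K ≃ₐ[ℚ] K) (π : Equiv.Perm (Fin n)) (hφ : ∀ i, φ (β i) = β (π i))
      (q : Equiv.Perm (Fin n) ⧸ G) : φ (ρ q) = ρ (π • q) := by
    have h := map_cosetValue G w v g (φ : _ →+* K) β q.out
    simp only [RingHom.coe_coe, hφ] at h
    exact h.trans (cosetValue_out_smul G w v g β π q).symm
  have hιρ (q : Equiv.Perm (Fin n) ⧸ G) : resolventRoot G w v g α q.out = ι (ρ q) := by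
    rw [resolventRoot_eq_cosetValue, ← funext hβα]
    exact (map_cosetValue G w v g (ι : K →+* ℂ) β q.out).symm
  have hΦ : resolventPoly G w v g α = (∏ q, (X - C (ρ q))).map (ι : K →+* ℂ) := by
    simp only [RingHom.coe_coe, resolventPoly, finprod_eq_prod_of_fintype, hιρ, Polynomial.map_prod,
      Polynomial.map_sub, map_X, map_C]
  refine ⟨?_, fun Ψ hΨ hsep => ?_⟩
  · obtain ⟨P, hP⟩ := exists_int_map_eq_prod_X_sub_C (ρ := ρ)
      (fun q => isIntegral_cosetValue G w v g
        (fun i => isIntegral_of_isRoot_intPoly hmonic (hβroot i)) _)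
      (fun φ => (hperm φ).imp' MulAction.toPerm fun π hπ => hρ φ π hπ)
    exact ⟨P, by rw [hΦ, ← hP, Polynomial.map_map]; congr 1; exact RingHom.ext_int _ _⟩
  · rw [hΦ, separable_map, separable_prod_X_sub_C_iff] at hsep
    refine irreducible_of_conjugate_roots hsep (fun p q => ?_) <| map_injective (ι : K →+* ℂ) (RingHom.injective _) <| by
      rw [← hΦ, ← hΨ, Polynomial.map_map, ι.comp_algebraMap]
    obtain ⟨π, rfl⟩ := MulAction.exists_smul_eq (Equiv.Perm (Fin n)) p q
    obtain ⟨φ, hφ⟩ := hsurj π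
    exact ⟨φ, hρ φ π hφ p⟩
end

section
/- Let F ∈ ℤ[x_1,x_2] be a polynomial of total degree d ≥ 2 that is irreducible over ℂ (absolutely irreducible). Then for every ε > 0 there is a constant c(d,ε) such that for all H ≥ 2, the number of pairs (x_1,x_2) ∈ ℤ² with F(x_1,x_2) = 0 and |x_1| ≤ H, |x_2| ≤ H is at most c(d,ε) · H^{1/d + ε}. -/
namespace BombieriPila

open MvPolynomial

/-- The exponents of the monomials in two variables of total degree at most `n`. -/
noncomputable def lowDegree (n : ℕ) : Finset (Fin 2 →₀ ℕ) :=
  (Finset.range (n + 1)).biUnion fun k => Finset.finsuppAntidiag Finset.univ k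

lemma mem_lowDegree {n : ℕ} {e : Fin 2 →₀ ℕ} : e ∈ lowDegree n ↔ e.degree ≤ n := by
  simp [lowDegree, Finsupp.degree_eq_sum]

lemma sum_lowDegree (n : ℕ) (f : ℕ → ℕ) :
    ∑ e ∈ lowDegree n, f e.degree = ∑ k ∈ Finset.range (n + 1), (k + 1) * f k := by
  have h : ∀ (k : ℕ), ∀ e ∈ Finset.finsuppAntidiag (Finset.univ : Finset (Fin 2)) k,
      e.degree = k := by
    intro k e he
    rw [Finset.mem_finsuppAntidiag] at he
    rw [Finsupp.degree_eq_sum, he.1]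
  rw [lowDegree, Finset.sum_biUnion]
  · refine Finset.sum_congr rfl fun k _ => ?_
    rw [Finset.sum_congr rfl fun e he => by rw [h k e he], Finset.sum_const,
      Finset.card_finsuppAntidiag_nat_eq_choose]
    simp [Nat.choose_succ_self_right, add_comm]
  · intro a _ b _ hab
    refine Finset.disjoint_left.2 fun e ha hb => hab ?_
    rw [← h a e ha, h b e hb]

lemma two_mul_card_lowDegree (n : ℕ) : 2 * (lowDegree n).card = (n + 1) * (n + 2) := by
  have h := sum_lowDegree n fun _ => 1
  simp only [Finset.sum_const, smul_eq_mul, mul_one] at h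
  rw [h]
  clear h
  induction n with
  | zero => simp
  | succ n ih => rw [Finset.sum_range_succ, mul_add, ih]; ring

lemma three_mul_sum_degree_lowDegree (n : ℕ) :
    3 * ∑ e ∈ lowDegree n, e.degree = n * (n + 1) * (n + 2) := by
  rw [sum_lowDegree n fun k => k]
  induction n with
  | zero => simp
  | succ n ih => rw [Finset.sum_range_succ, mul_add, ih]; ring

/-- The exponents of total degree at most `n` which are not multiples of `l`. -/
noncomputable def standardMonomials (n : ℕ) (l : Fin 2 →₀ ℕ) : Finset (Fin 2 →₀ ℕ) :=
  (lowDegree n).filter fun e => ¬ l ≤ e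

lemma mem_standardMonomials {n : ℕ} {l e : Fin 2 →₀ ℕ} :
    e ∈ standardMonomials n l ↔ e.degree ≤ n ∧ ¬ l ≤ e := by
  simp [standardMonomials, mem_lowDegree]

lemma sum_standardMonomials (m : ℕ) (l : Fin 2 →₀ ℕ) (f : ℕ → ℕ) :
    ∑ e ∈ standardMonomials (m + l.degree) l, f e.degree +
      ∑ e ∈ lowDegree m, f (e.degree + l.degree) =
    ∑ e ∈ lowDegree (m + l.degree), f e.degree := by
  rw [← Finset.sum_filter_not_add_sum_filter (lowDegree (m + l.degree)) (fun e => l ≤ e)]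
  congr 1
  refine Finset.sum_bij (fun e _ => e + l) ?_ ?_ ?_ ?_
  · intro e he
    rw [mem_lowDegree] at he
    simp [mem_lowDegree, he]
  · intro a _ b _ h
    exact add_right_cancel h
  · intro e he
    rw [Finset.mem_filter, mem_lowDegree] at he
    refine ⟨e - l, ?_, tsub_add_cancel_of_le he.2⟩
    have := congrArg Finsupp.degree (tsub_add_cancel_of_le he.2)
    rw [map_add] at this
    rw [mem_lowDegree]
    omega
  · intro e _
    simp

lemma card_standardMonomials (m : ℕ) (l : Fin 2 →₀ ℕ) :
    2 * (standardMonomials (m + l.degree) l).card =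
      2 * l.degree * m + l.degree * (l.degree + 3) := by
  have h := sum_standardMonomials m l fun _ => 1
  simp only [Finset.sum_const, smul_eq_mul, mul_one] at h
  have h1 := two_mul_card_lowDegree m
  have h2 := two_mul_card_lowDegree (m + l.degree)
  nlinarith

lemma sum_degree_standardMonomials (m : ℕ) (l : Fin 2 →₀ ℕ) :
    2 * ∑ e ∈ standardMonomials (m + l.degree) l, e.degree ≤
      l.degree * (m + l.degree) * (m + l.degree + 1) := by
  have h := sum_standardMonomials m l fun k => k
  rw [Finset.sum_add_distrib, Finset.sum_const, smul_eq_mul] at h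
  have h1 := two_mul_card_lowDegree m
  have h2 := three_mul_sum_degree_lowDegree m
  have h3 := three_mul_sum_degree_lowDegree (m + l.degree)
  generalize ∑ e ∈ standardMonomials (m + l.degree) l, e.degree = E at *
  generalize ∑ e ∈ lowDegree (m + l.degree), e.degree = E' at *
  generalize ∑ e ∈ lowDegree m, e.degree = E'' at *
  generalize l.degree = d at *
  generalize (lowDegree m).card = c at *
  have h4 : 3 * d * (2 * c) = 3 * d * ((m + 1) * (m + 2)) := by rw [h1]
  have h5 : d ≤ d ^ 3 := by
    rcases Nat.eq_zero_or_pos d with rfl | hd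
    · simp
    · exact Nat.le_self_pow (by norm_num) d
  have h6 : 3 * d ^ 2 ≤ d ^ 3 + 2 * d := by
    rcases d with _ | _ | d
    · simp
    · simp
    · nlinarith
  nlinarith

lemma not_dvd_of_support_subset_standardMonomials {K : Type*} [Field K]
    {F A : MvPolynomial (Fin 2) K} {n : ℕ} (hA : A ≠ 0)
    (hs : A.support ⊆ standardMonomials n (MonomialOrder.degLex.degree F)) : ¬ F ∣ A := by
  rintro ⟨G, rfl⟩
  have hF : F ≠ 0 := left_ne_zero_of_mul hA
  have hG : G ≠ 0 := right_ne_zero_of_mul hA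
  have h := hs (MonomialOrder.degLex.degree_mem_support hA)
  rw [mem_standardMonomials, MonomialOrder.degree_mul hF hG] at h
  exact h.2 le_self_add

/-- The polynomial with coefficients `g` supported on the finite set of exponents `S`. -/
noncomputable def ofCoeffs {R : Type*} [CommRing R] (S : Finset (Fin 2 →₀ ℕ)) (g : S → R) :
    MvPolynomial (Fin 2) R :=
  ∑ e : S, monomial (e : Fin 2 →₀ ℕ) (g e)

section ofCoeffs

variable {R : Type*} [CommRing R] {S : Finset (Fin 2 →₀ ℕ)}

lemma coeff_ofCoeffs (g : S → R) (e : S) : (ofCoeffs S g).coeff e = g e := by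
  classical
  simp only [ofCoeffs, coeff_sum, coeff_monomial]
  rw [Finset.sum_eq_single e]
  · simp
  · intro b _ hb
    rw [if_neg fun h => hb (Subtype.ext h)]
  · simp

lemma support_ofCoeffs_subset (g : S → R) : (ofCoeffs S g).support ⊆ S := by
  classical
  intro e he
  rw [ofCoeffs] at he
  have he := support_sum he
  obtain ⟨f, -, hf⟩ := Finset.mem_biUnion.1 he
  have := support_monomial_subset hf
  rw [Finset.mem_singleton.1 this]
  exact f.2

lemma ofCoeffs_ne_zero {g : S → R} (hg : g ≠ 0) : ofCoeffs S g ≠ 0 := by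
  contrapose! hg
  ext e
  rw [← coeff_ofCoeffs g e, hg, coeff_zero, Pi.zero_apply]

lemma eval_ofCoeffs (g : S → R) (x : Fin 2 → R) :
    eval x (ofCoeffs S g) = ∑ e : S, g e * eval x (monomial (e : Fin 2 →₀ ℕ) 1) := by
  simp [ofCoeffs, eval_monomial]

lemma totalDegree_ofCoeffs_le {n : ℕ} (hS : ∀ e ∈ S, e.degree ≤ n) (g : S → R) :
    (ofCoeffs S g).totalDegree ≤ n := by
  refine Finset.sup_le fun e he => ?_
  simpa [Finsupp.degree_eq_sum, Finsupp.sum_fintype] using hS e (support_ofCoeffs_subset g he)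

end ofCoeffs

lemma finrank_restrictSupport {K : Type*} [Field K] (S : Finset (Fin 2 →₀ ℕ)) :
    Module.finrank K (restrictSupport K (S : Set (Fin 2 →₀ ℕ))) = S.card := by
  rw [Module.finrank_eq_card_basis (basisRestrictSupport K (S : Set (Fin 2 →₀ ℕ)))]
  simp

lemma mem_restrictSupport_lowDegree {K : Type*} [Field K] {n : ℕ} {A : MvPolynomial (Fin 2) K} :
    A ∈ restrictSupport K (lowDegree n : Set (Fin 2 →₀ ℕ)) ↔ A.totalDegree ≤ n := by
  rw [mem_restrictSupport_iff, totalDegree, Finset.sup_le_iff]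
  simp only [Set.subset_def, Finset.mem_coe, mem_lowDegree, Finsupp.degree_eq_sum,
    Finsupp.sum_fintype, implies_true]

lemma mul_monomial_eq_smul {K : Type*} [Field K] (A : MvPolynomial (Fin 2) K) (e : Fin 2 →₀ ℕ)
    (c : K) : A * monomial e c = c • (A * monomial e 1) := by
  rw [← mul_smul_comm, smul_monomial, smul_eq_mul, mul_one]

/-- Elimination of one variable between an irreducible plane curve `F = 0` and a curve `A = 0`
not containing it. -/
lemma exists_eliminant {K : Type*} [Field K] {F A : MvPolynomial (Fin 2) K}
    (hF : Irreducible F) (hFA : ¬ F ∣ A) {D : ℕ} (hD : A.totalDegree ≤ D) (i : Fin 2) :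
    ∃ R : Polynomial K, R ≠ 0 ∧ R.natDegree ≤ F.totalDegree * D ∧
      ∀ x : Fin 2 → K, eval x F = 0 → eval x A = 0 → R.eval (x i) = 0 := by
  classical
  set l := MonomialOrder.degLex.degree F with hl
  have hld : l.degree = F.totalDegree := degree_degLexDegree
  set d := F.totalDegree
  set S := lowDegree (d * D + D)
  set T := standardMonomials (d * D + l.degree) l with hT
  let v : S ⊕ T ⊕ Fin (d * D + 1) → MvPolynomial (Fin 2) K :=
    Sum.elim (fun e => F * monomial e.1 1) (Sum.elim (fun e => A * monomial e.1 1)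
      fun k => X i ^ (k : ℕ))
  have hv : ∀ j, v j ∈ restrictSupport K (lowDegree (d * D + d + D) : Set (Fin 2 →₀ ℕ)) := by
    intro j
    rw [mem_restrictSupport_lowDegree]
    have hmon : ∀ (e : Fin 2 →₀ ℕ), (monomial e (1 : K)).totalDegree ≤ e.degree := by
      intro e
      rw [totalDegree_monomial _ one_ne_zero, Finsupp.degree_eq_sum,
          Finsupp.sum_fintype _ _ (by simp)]
    rcases j with e | e | k
    · have h1 := mem_lowDegree.1 e.2
      have h2 := hmon e.1
      have h3 := totalDegree_mul F (monomial e.1 (1 : K))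
      change (F * monomial e.1 (1 : K)).totalDegree ≤ _
      omega
    · have h1 := (mem_standardMonomials.1 e.2).1
      have h2 := hmon e.1
      have h3 := totalDegree_mul A (monomial e.1 (1 : K))
      change (A * monomial e.1 (1 : K)).totalDegree ≤ _
      omega
    · change ((X i : MvPolynomial (Fin 2) K) ^ (k : ℕ)).totalDegree ≤ _
      rw [totalDegree_X_pow]
      have := k.2
      omega
  have hdep : ¬ LinearIndependent K v := by
    rw [linearIndependent_iff_card_le_finrank_span, not_le]
    have h1 : (Set.range v).finrank K ≤ (lowDegree (d * D + d + D)).card := by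
      rw [← finrank_restrictSupport (K := K)]
      have : Module.Finite K
          (restrictSupport K (lowDegree (d * D + d + D) : Set (Fin 2 →₀ ℕ))) :=
        Module.Finite.of_basis (basisRestrictSupport K _)
      refine Submodule.finrank_mono (Submodule.span_le.2 ?_)
      rintro _ ⟨j, rfl⟩
      exact hv j
    refine h1.trans_lt ?_
    rw [Fintype.card_sum, Fintype.card_sum, Fintype.card_coe, Fintype.card_coe, Fintype.card_fin]
    have h2 := two_mul_card_lowDegree (d * D + d + D)
    have h3 := two_mul_card_lowDegree (d * D + D)
    have h4 := card_standardMonomials (d * D) l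
    rw [← hT, hld] at h4
    change _ < S.card + (T.card + _)
    change 2 * S.card = _ at h3
    nlinarith
  obtain ⟨g, hg, j, hj⟩ := Fintype.not_linearIndependent_iff.1 hdep
  rw [Fintype.sum_sum_type, Fintype.sum_sum_type] at hg
  set U := ofCoeffs S fun e => g (Sum.inl e) with hU
  set V := ofCoeffs T fun e => g (Sum.inr (Sum.inl e)) with hV
  set R : Polynomial K := ∑ k : Fin (d * D + 1),
    Polynomial.monomial (k : ℕ) (g (Sum.inr (Sum.inr k))) with hR
  have hUVR : F * U + (A * V + Polynomial.aeval (X i) R) = 0 := by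
    rw [hU, hV, hR, ofCoeffs, ofCoeffs, Finset.mul_sum, Finset.mul_sum, map_sum]
    refine Eq.trans (congrArg₂ (· + ·) ?_ (congrArg₂ (· + ·) ?_ ?_)) hg
    · refine Finset.sum_congr rfl fun e _ => ?_
      simp only [v, Sum.elim_inl]
      exact mul_monomial_eq_smul F e.1 _
    · refine Finset.sum_congr rfl fun e _ => ?_
      simp only [v, Sum.elim_inl, Sum.elim_inr]
      exact mul_monomial_eq_smul A e.1 _
    · refine Finset.sum_congr rfl fun k _ => ?_
      simp only [v, Sum.elim_inr]
      rw [Polynomial.aeval_monomial, Algebra.smul_def]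
  have hcoeff : ∀ k : Fin (d * D + 1), R.coeff k = g (Sum.inr (Sum.inr k)) := by
    intro k
    rw [hR, Polynomial.finsetSum_coeff, Finset.sum_eq_single k]
    · simp
    · intro b _ hb
      rw [Polynomial.coeff_monomial, if_neg fun h => hb (Fin.ext h)]
    · simp
  refine ⟨R, ?_, ?_, ?_⟩
  · intro hR0
    rw [hR0, map_zero, add_zero] at hUVR
    have hFV : F ∣ V := by
      refine (hF.prime.dvd_or_dvd (b := V) ?_).resolve_left hFA
      exact ⟨-U, by linear_combination hUVR⟩
    have hV0 : V = 0 := by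
      by_contra hV0
      exact not_dvd_of_support_subset_standardMonomials hV0 (support_ofCoeffs_subset _) hFV
    rw [hV0, mul_zero, add_zero] at hUVR
    have hU0 : U = 0 := (mul_eq_zero.1 hUVR).resolve_left hF.ne_zero
    apply hj
    rcases j with e | e | k
    · rw [← coeff_ofCoeffs (fun e => g (Sum.inl e)) e, ← hU, hU0, coeff_zero]
    · rw [← coeff_ofCoeffs (fun e => g (Sum.inr (Sum.inl e))) e, ← hV, hV0, coeff_zero]
    · rw [← hcoeff k, hR0, Polynomial.coeff_zero]
  · refine Polynomial.natDegree_sum_le_of_forall_le _ _ fun k _ => ?_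
    exact (Polynomial.natDegree_monomial_le _).trans (Nat.lt_succ_iff.1 k.2)
  · intro x hxF hxA
    have := congrArg (eval x) hUVR
    rw [map_add, map_add, map_mul, map_mul, hxF, hxA, zero_mul, zero_mul, zero_add, zero_add,
      map_zero] at this
    rw [← this, ← coe_aeval_eq_eval, RingHom.coe_coe, ← Polynomial.aeval_algHom_apply, aeval_X,
      Polynomial.coe_aeval_eq_eval]

/-- A weak form of Bézout's theorem, for integral points. -/
lemma card_common_zeros_le {F A : MvPolynomial (Fin 2) ℂ}
    (hF : Irreducible F) (hFA : ¬ F ∣ A) {D : ℕ} (hD : A.totalDegree ≤ D) (T : Finset (ℤ × ℤ))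
    (hTF : ∀ P ∈ T, eval ![(P.1 : ℂ), (P.2 : ℂ)] F = 0)
    (hTA : ∀ P ∈ T, eval ![(P.1 : ℂ), (P.2 : ℂ)] A = 0) :
    T.card ≤ (F.totalDegree * D) ^ 2 := by
  classical
  obtain ⟨R, hR, hRd, hR0⟩ := exists_eliminant hF hFA hD 0
  obtain ⟨R', hR', hRd', hR0'⟩ := exists_eliminant hF hFA hD 1
  have h := Finset.card_le_card_of_injOn (s := T)
    (t := R.roots.toFinset ×ˢ R'.roots.toFinset) (fun P => ((P.1 : ℂ), (P.2 : ℂ))) ?_ ?_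
  · refine h.trans ?_
    rw [Finset.card_product, sq]
    exact Nat.mul_le_mul
      ((Multiset.toFinset_card_le _).trans ((Polynomial.card_roots' _).trans hRd))
      ((Multiset.toFinset_card_le _).trans ((Polynomial.card_roots' _).trans hRd'))
  · intro P hP
    simp only [Finset.coe_product, Set.mem_prod, Finset.mem_coe, Multiset.mem_toFinset,
      Polynomial.mem_roots hR, Polynomial.mem_roots hR', Polynomial.IsRoot]
    exact ⟨by simpa using hR0 _ (hTF P hP) (hTA P hP), by simpa using hR0' _ (hTF P hP) (hTA P hP)⟩
  · intro P _ Q _ h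
    simpa [Prod.ext_iff] using h

lemma derivative_aeval_C_X (F : MvPolynomial (Fin 2) ℤ) (x : ℤ) :
    Polynomial.derivative (aeval ![Polynomial.C x, Polynomial.X] F) =
      aeval ![Polynomial.C x, Polynomial.X] (pderiv 1 F) := by
  induction F using MvPolynomial.induction_on with
  | C a => simp
  | add p q hp hq => simp [hp, hq, -eq_intCast]
  | mul_X p i hp =>
    fin_cases i <;> simp [hp, pderiv_X, -eq_intCast] <;> ring

lemma eval_aeval_C_X (F : MvPolynomial (Fin 2) ℤ) (x y : ℤ) :
    (aeval ![Polynomial.C x, Polynomial.X] F : Polynomial ℤ).eval y = eval ![x, y] F := by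
  induction F using MvPolynomial.induction_on with
  | C a => simp
  | add p q hp hq => simp [hp, hq, -eq_intCast]
  | mul_X p i hp => fin_cases i <;> simp [hp, -eq_intCast]

lemma eval_aeval_X (F : MvPolynomial (Fin 2) ℤ) (g : Polynomial ℤ) (x : ℤ) :
    (aeval ![Polynomial.X, g] F : Polynomial ℤ).eval x = eval ![x, g.eval x] F := by
  induction F using MvPolynomial.induction_on with
  | C a => simp
  | add p q hp hq => simp [hp, hq, -eq_intCast]
  | mul_X p i hp => fin_cases i <;> simp [hp, -eq_intCast]

lemma dvd_eval_sub_eval {q x y x' y' : ℤ} (hx : q ∣ x - x') (hy : q ∣ y - y')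
    (F : MvPolynomial (Fin 2) ℤ) : q ∣ eval ![x, y] F - eval ![x', y'] F := by
  induction F using MvPolynomial.induction_on with
  | C a => simp
  | add p q hp hq =>
    rw [map_add, map_add, add_sub_add_comm]
    exact dvd_add hp hq
  | mul_X p i hp =>
    have hi : q ∣ (![x, y] i : ℤ) - ![x', y'] i := by fin_cases i <;> simpa
    rw [map_mul, map_mul, eval_X, eval_X]
    exact dvd_mul_sub_mul hp hi

/-- Hensel's lemma in polynomial form: the zeros of `F` in a residue class modulo `p` at which
`∂F/∂y` is invertible are close to the graph of a polynomial. -/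
lemma exists_polynomial_graph (F : MvPolynomial (Fin 2) ℤ) {p b x₀ y₀ : ℤ}
    (hb : p ∣ 1 - b * eval ![x₀, y₀] (pderiv 1 F)) (n : ℕ) :
    ∃ g : Polynomial ℤ, ∀ x y : ℤ, p ∣ x - x₀ → p ∣ y - y₀ → eval ![x, y] F = 0 →
      p ^ (n + 1) ∣ y - g.eval x := by
  induction n with
  | zero => exact ⟨Polynomial.C y₀, fun x y _ hy _ => by simpa using hy⟩
  | succ n ih =>
    obtain ⟨g, hg⟩ := ih
    refine ⟨g - Polynomial.C b * aeval ![Polynomial.X, g] F, fun x y hx hy hF => ?_⟩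
    have h := hg x y hx hy hF
    rw [Polynomial.eval_sub, Polynomial.eval_mul, Polynomial.eval_C, eval_aeval_X]
    set z := g.eval x
    obtain ⟨k, hk⟩ := Polynomial.binomExpansion
      (aeval ![Polynomial.C x, Polynomial.X] F) z (y - z)
    rw [derivative_aeval_C_X, eval_aeval_C_X, eval_aeval_C_X, eval_aeval_C_X, add_sub_cancel,
      hF] at hk
    have hpz : p ∣ y - z := (dvd_pow_self p n.succ_ne_zero).trans h
    have hz : p ∣ z - y₀ := by
      have := dvd_sub hy hpz
      rwa [sub_sub_sub_cancel_left] at this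
    have hd : p ∣ 1 - b * eval ![x, z] (pderiv 1 F) := by
      have := dvd_sub hb ((dvd_eval_sub_eval hx hz (pderiv 1 F)).mul_left b)
      rwa [mul_sub, sub_sub, add_sub_cancel] at this
    have hyz : y - (z - b * eval ![x, z] F) =
        (y - z) * ((1 - b * eval ![x, z] (pderiv 1 F)) - b * k * (y - z)) := by
      linear_combination -b * hk
    rw [hyz, pow_succ]
    exact mul_dvd_mul h (dvd_sub hd (hpz.mul_left _))

lemma card_mul_card_sub_one_le_sum (S : Finset ℕ) :
    S.card * (S.card - 1) / 2 ≤ ∑ k ∈ S, k := by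
  rw [← Finset.sum_range_id]
  induction S using Finset.induction_on_max with
  | empty => simp
  | insert a S hS ih =>
    have ha : a ∉ S := fun h => lt_irrefl a (hS a h)
    rw [Finset.card_insert_of_notMem ha, Finset.sum_range_succ, Finset.sum_insert ha, add_comm]
    refine Nat.add_le_add ?_ ih
    have := Finset.card_le_card (fun k hk => Finset.mem_range.2 (hS k hk) : S ⊆ Finset.range a)
    rwa [Finset.card_range] at this

lemma dvd_det_sub_det {ι : Type*} [Fintype ι] [DecidableEq ι] {q : ℤ} {A B : Matrix ι ι ℤ}
    (h : ∀ i j, q ∣ A i j - B i j) : q ∣ A.det - B.det := by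
  rw [← Ideal.mem_span_singleton, ← Ideal.Quotient.eq, RingHom.map_det, RingHom.map_det]
  congr 1
  ext i j
  exact Ideal.Quotient.eq.2 (Ideal.mem_span_singleton.2 (h i j))

/-- The determinant of the values of polynomials at points which are congruent modulo `p` is
divisible by a large power of `p`. -/
lemma pow_dvd_det_eval {ι : Type*} [Fintype ι] [DecidableEq ι] {p x₀ : ℤ} {x : ι → ℤ}
    (hx : ∀ i, p ∣ x i - x₀) (Q : ι → Polynomial ℤ) :
    p ^ (Fintype.card ι * (Fintype.card ι - 1) / 2) ∣
      (Matrix.of fun j i => (Q j).eval (x i)).det := by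
  choose u hu using hx
  set K := (Finset.univ.sup fun j => (Polynomial.taylor x₀ (Q j)).natDegree) + 1
  have hQ : (Matrix.of fun j i => (Q j).eval (x i)) = fun j =>
      ∑ k : Fin K, ((Polynomial.taylor x₀ (Q j)).coeff k * p ^ (k : ℕ)) •
        (fun i => u i ^ (k : ℕ)) := by
    ext j i
    rw [Finset.sum_apply, Matrix.of_apply]
    have h1 : (Q j).eval (x i) = (Polynomial.taylor x₀ (Q j)).eval (x i - x₀) := by
      rw [Polynomial.taylor_eval, sub_add_cancel]
    rw [h1, Polynomial.eval_eq_sum_range' (n := K) (Nat.lt_succ_of_le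
        (Finset.le_sup (f := fun j => (Polynomial.taylor x₀ (Q j)).natDegree)
          (Finset.mem_univ j))),
      hu, Finset.sum_range]
    refine Finset.sum_congr rfl fun k _ => ?_
    rw [Pi.smul_apply, smul_eq_mul, mul_pow, mul_assoc]
  rw [hQ]
  change _ ∣ (Matrix.detRowAlternating : (ι → ℤ) [⋀^ι]→ₗ[ℤ] ℤ).toMultilinearMap _
  rw [MultilinearMap.map_sum]
  refine Finset.dvd_sum fun r _ => ?_
  rw [MultilinearMap.map_smul_univ, smul_eq_mul]
  by_cases hr : Function.Injective r
  · refine Dvd.dvd.mul_right ?_ _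
    rw [Finset.prod_mul_distrib, Finset.prod_pow_eq_pow_sum]
    refine Dvd.dvd.mul_left (pow_dvd_pow _ ?_) _
    have h := card_mul_card_sub_one_le_sum (Finset.univ.image fun i => (r i : ℕ))
    have hr' : Function.Injective fun i => (r i : ℕ) := Fin.val_injective.comp hr
    rwa [Finset.card_image_of_injective _ hr', Finset.sum_image hr'.injOn] at h
  · obtain ⟨i, j, hij, hne⟩ := Function.not_injective_iff.1 hr
    refine Dvd.dvd.mul_left ?_ _
    rw [AlternatingMap.coe_multilinearMap,
      AlternatingMap.map_eq_zero_of_eq _ _ (by simp only [hij]) hne]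
    exact dvd_zero _

/-- The matrix of the values of the monomials with exponents in `S` at given points. -/
noncomputable def monomialMatrix {ι : Type*} (S : Finset (Fin 2 →₀ ℕ)) (P : ι → ℤ × ℤ) :
    Matrix ι S ℤ :=
  Matrix.of fun i e => eval ![(P i).1, (P i).2] (monomial (e : Fin 2 →₀ ℕ) 1)

lemma pow_dvd_det_monomialMatrix {F : MvPolynomial (Fin 2) ℤ} {p : ℕ} (hp : p.Prime) {x₀ y₀ : ℤ}
    (hF : ¬ (p : ℤ) ∣ eval ![x₀, y₀] (pderiv 1 F)) {S : Finset (Fin 2 →₀ ℕ)} (P : S → ℤ × ℤ)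
    (hP : ∀ i, eval ![(P i).1, (P i).2] F = 0) (hx : ∀ i, (p : ℤ) ∣ (P i).1 - x₀)
    (hy : ∀ i, (p : ℤ) ∣ (P i).2 - y₀) :
    (p : ℤ) ^ (S.card * (S.card - 1) / 2) ∣ (monomialMatrix S P).det := by
  obtain ⟨b, hb⟩ : ∃ b, (p : ℤ) ∣ 1 - b * eval ![x₀, y₀] (pderiv 1 F) := by
    obtain ⟨u, v, huv⟩ := (Nat.prime_iff_prime_int.1 hp).irreducible.coprime_iff_not_dvd.2 hF
    exact ⟨v, u, by linear_combination -huv⟩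
  obtain ⟨g, hg⟩ := exists_polynomial_graph F hb (S.card * (S.card - 1) / 2)
  have h := pow_dvd_det_eval hx fun e : S =>
    aeval ![Polynomial.X, g] (monomial (e : Fin 2 →₀ ℕ) (1 : ℤ))
  rw [Fintype.card_coe] at h
  rw [← Matrix.det_transpose]
  refine (dvd_iff_dvd_of_dvd_sub (dvd_det_sub_det fun e i => ?_)).2 h
  rw [Matrix.of_apply, eval_aeval_X, Matrix.transpose_apply, monomialMatrix, Matrix.of_apply]
  exact dvd_eval_sub_eval (by simp)
    ((pow_dvd_pow _ (Nat.le_succ _)).trans (hg _ _ (hx i) (hy i) (hP i))) _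

lemma abs_monomialMatrix_le {ι : Type*} {S : Finset (Fin 2 →₀ ℕ)} {P : ι → ℤ × ℤ} {H : ℝ} {i : ι}
    (hx : |((P i).1 : ℝ)| ≤ H) (hy : |((P i).2 : ℝ)| ≤ H) (e : S) :
    |(monomialMatrix S P i e : ℝ)| ≤ H ^ e.1.degree := by
  have hH : 0 ≤ H := (abs_nonneg _).trans hx
  rw [Finsupp.degree_eq_sum, monomialMatrix, Matrix.of_apply, eval_monomial,
    Finsupp.prod_fintype _ _ (by simp)]
  simp only [Fin.prod_univ_two, Fin.sum_univ_two, Matrix.cons_val_zero, Matrix.cons_val_one,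
    one_mul, Int.cast_mul, Int.cast_pow, abs_mul, abs_pow, pow_add]
  gcongr

lemma abs_det_monomialMatrix_le {S : Finset (Fin 2 →₀ ℕ)} {P : S → ℤ × ℤ} {H : ℝ}
    (hx : ∀ i, |((P i).1 : ℝ)| ≤ H) (hy : ∀ i, |((P i).2 : ℝ)| ≤ H) :
    |((monomialMatrix S P).det : ℝ)| ≤ S.card.factorial * H ^ (∑ e ∈ S, e.degree) := by
  rw [Matrix.det_apply, Int.cast_sum]
  refine (Finset.abs_sum_le_sum_abs _ _).trans ?_
  have h : ∀ σ : Equiv.Perm S, |((Equiv.Perm.sign σ • ∏ i, monomialMatrix S P (σ i) i : ℤ) : ℝ)| ≤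
      H ^ (∑ e ∈ S, e.degree) := by
    intro σ
    have h1 : |((Equiv.Perm.sign σ • ∏ i, monomialMatrix S P (σ i) i : ℤ) : ℝ)| =
        ∏ i, |(monomialMatrix S P (σ i) i : ℝ)| := by
      rw [← Finset.abs_prod]
      rcases Int.units_eq_one_or (Equiv.Perm.sign σ) with h | h <;> simp [h]
    rw [h1, ← Finset.prod_pow_eq_pow_sum, ← Finset.prod_coe_sort S fun e => H ^ e.degree]
    exact Finset.prod_le_prod (fun _ _ => abs_nonneg _) fun i _ =>
      abs_monomialMatrix_le (hx _) (hy _) i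
  refine (Finset.sum_le_card_nsmul _ _ _ fun σ _ => h σ).trans (le_of_eq ?_)
  rw [Finset.card_univ, Fintype.card_perm, Fintype.card_coe, nsmul_eq_mul]

lemma eval_map_intCast (F : MvPolynomial (Fin 2) ℤ) (x y : ℤ) :
    eval ![(x : ℂ), (y : ℂ)] (map (Int.castRingHom ℂ) F) = ((eval ![x, y] F : ℤ) : ℂ) := by
  have h : ![(x : ℂ), (y : ℂ)] = Int.castRingHom ℂ ∘ ![x, y] := by
    ext i
    fin_cases i <;> simp
  rw [h, eval_map]
  exact (eval₂_comp (Int.castRingHom ℂ) ![x, y] F).symm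

lemma eval_ofCoeffs_eq_sum_monomialMatrix {ι : Type*} {S : Finset (Fin 2 →₀ ℕ)} (P : ι → ℤ × ℤ)
    (i : ι) (c : S → ℂ) :
    eval ![((P i).1 : ℂ), ((P i).2 : ℂ)] (ofCoeffs S c) =
      ∑ e, c e * (monomialMatrix S P i e : ℂ) := by
  rw [eval_ofCoeffs]
  refine Finset.sum_congr rfl fun e _ => ?_
  rw [monomialMatrix, Matrix.of_apply, ← eval_map_intCast, map_monomial, RingHom.map_one]

lemma exists_vector_of_span_ne_top {ι κ : Type*} [Fintype κ] [DecidableEq κ] {v : ι → κ → ℂ}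
    (h : Submodule.span ℂ (Set.range v) ≠ ⊤) :
    ∃ c : κ → ℂ, c ≠ 0 ∧ ∀ i, ∑ e, c e * v i e = 0 := by
  obtain ⟨f, hf, hle⟩ := Submodule.exists_le_ker_of_lt_top _ h.lt_top
  have hfx : ∀ x, f x = ∑ e, f (Pi.single e 1) * x e := by
    intro x
    rw [LinearMap.pi_apply_eq_sum_univ f x]
    refine Finset.sum_congr rfl fun e _ => ?_
    rw [smul_eq_mul, mul_comm]
    congr 2
    ext j
    rw [Pi.single_apply]
    exact if_congr eq_comm rfl rfl
  refine ⟨fun e => f (Pi.single e 1), fun hc => hf ?_, fun i => ?_⟩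
  · refine LinearMap.ext fun x => ?_
    rw [hfx, LinearMap.zero_apply]
    exact Finset.sum_eq_zero fun e _ => by rw [congrFun hc e, Pi.zero_apply, zero_mul]
  · rw [← hfx]
    exact hle (Submodule.subset_span ⟨i, rfl⟩)

lemma exists_det_ne_zero_of_span_eq_top {ι κ : Type*} [Fintype κ] [DecidableEq κ] {v : ι → κ → ℂ}
    (h : Submodule.span ℂ (Set.range v) = ⊤) :
    ∃ P : κ → ι, (Matrix.of fun i e => v (P i) e).det ≠ 0 := by
  obtain ⟨μ, a, -, hsp, hli⟩ := exists_linearIndependent' ℂ v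
  rw [h] at hsp
  let b := Module.Basis.mk hli hsp.ge
  let e := (Pi.basisFun ℂ κ).indexEquiv b
  refine ⟨a ∘ e, ?_⟩
  rw [← isUnit_iff_ne_zero, ← Matrix.isUnit_iff_isUnit_det,
    ← Matrix.linearIndependent_rows_iff_isUnit]
  exact hli.comp e e.injective

lemma totalDegree_map_intCast (F : MvPolynomial (Fin 2) ℤ) :
    (map (Int.castRingHom ℂ) F).totalDegree = F.totalDegree := by
  rw [totalDegree, totalDegree, support_map_of_injective _ (RingHom.injective_int _)]

/-- The key step of the determinant method: the integral zeros of `F` in a box which lie in a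
residue class modulo `p` that is smooth on `F = 0` are contained in a second curve. -/
lemma card_residue_class_le {F : MvPolynomial (Fin 2) ℤ}
    (hF : Irreducible (map (Int.castRingHom ℂ) F)) {p : ℕ} (hp : p.Prime) {x₀ y₀ : ℤ}
    (hFy : ¬ (p : ℤ) ∣ eval ![x₀, y₀] (pderiv 1 F)) {H : ℝ} {T : Finset (ℤ × ℤ)}
    (hT : ∀ P ∈ T, eval ![P.1, P.2] F = 0) (hTx : ∀ P ∈ T, |(P.1 : ℝ)| ≤ H)
    (hTy : ∀ P ∈ T, |(P.2 : ℝ)| ≤ H) (hx : ∀ P ∈ T, (p : ℤ) ∣ P.1 - x₀)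
    (hy : ∀ P ∈ T, (p : ℤ) ∣ P.2 - y₀) {n : ℕ} {S : Finset (Fin 2 →₀ ℕ)}
    (hS : S = standardMonomials n (MonomialOrder.degLex.degree (map (Int.castRingHom ℂ) F)))
    (hlt : S.card.factorial * H ^ (∑ e ∈ S, e.degree) <
      (p : ℝ) ^ (S.card * (S.card - 1) / 2)) :
    T.card ≤ (F.totalDegree * n) ^ 2 := by
  classical
  let v : T → S → ℂ := fun P e => (monomialMatrix S (fun P : T => (P : ℤ × ℤ)) P e : ℂ)
  have hspan : Submodule.span ℂ (Set.range v) ≠ ⊤ := by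
    intro htop
    obtain ⟨P, hP⟩ := exists_det_ne_zero_of_span_eq_top htop
    have hdet : (monomialMatrix S fun i => (P i : ℤ × ℤ)).det ≠ 0 := by
      intro h0
      apply hP
      have := congrArg (Int.castRingHom ℂ) h0
      rw [RingHom.map_det, map_zero] at this
      exact this
    have hdvd := pow_dvd_det_monomialMatrix hp hFy (fun i => (P i : ℤ × ℤ))
      (fun i => hT _ (P i).2) (fun i => hx _ (P i).2) (fun i => hy _ (P i).2)
    have hle := Int.le_of_dvd (abs_pos.2 hdet) ((dvd_abs _ _).2 hdvd)
    have hle' : (p : ℝ) ^ (S.card * (S.card - 1) / 2) ≤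
        |((monomialMatrix S fun i => (P i : ℤ × ℤ)).det : ℝ)| := by
      exact_mod_cast hle
    exact absurd (hle'.trans (abs_det_monomialMatrix_le (fun i => hTx _ (P i).2)
      fun i => hTy _ (P i).2)) hlt.not_ge
  obtain ⟨c, hc, hcv⟩ := exists_vector_of_span_ne_top hspan
  rw [← totalDegree_map_intCast]
  refine card_common_zeros_le hF (A := ofCoeffs S c) ?_ ?_ T ?_ ?_
  · refine not_dvd_of_support_subset_standardMonomials (n := n) (ofCoeffs_ne_zero hc) ?_
    rw [← hS]
    exact support_ofCoeffs_subset c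
  · exact totalDegree_ofCoeffs_le (fun e he => (mem_standardMonomials.1 (hS ▸ he)).1) c
  · intro P hP
    rw [eval_map_intCast, hT P hP, Int.cast_zero]
  · intro P hP
    rw [← hcv ⟨P, hP⟩]
    exact eval_ofCoeffs_eq_sum_monomialMatrix (fun P : T => (P : ℤ × ℤ)) ⟨P, hP⟩ c

attribute [local instance] Matrix.seminormedAddCommGroup in
/-- Siegel's lemma with a simple bound. -/
lemma exists_small_int_vec {α β : Type*} [Fintype α] [Fintype β] (A : Matrix α β ℤ)
    (h : Fintype.card α < Fintype.card β) {B : ℝ} (hB : 1 ≤ B) (hA : ∀ i j, |(A i j : ℝ)| ≤ B) :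
    ∃ t : β → ℤ, t ≠ 0 ∧ A.mulVec t = 0 ∧
      ∀ j, |(t j : ℝ)| ≤ (Fintype.card β * B) ^ Fintype.card β := by
  have hβ : 1 ≤ Fintype.card β := by omega
  have hβ' : (1 : ℝ) ≤ Fintype.card β := by exact_mod_cast hβ
  have h1 : 1 ≤ Fintype.card β * B := one_le_mul_of_one_le_of_one_le hβ' hB
  rcases Nat.eq_zero_or_pos (Fintype.card α) with h0 | h0
  · have := Fintype.card_eq_zero_iff.1 h0
    have : Nonempty β := Fintype.card_pos_iff.1 hβ
    refine ⟨1, one_ne_zero, Subsingleton.elim _ _, fun j => ?_⟩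
    simpa using one_le_pow₀ h1
  · obtain ⟨t, ht, hAt, hn⟩ := Int.Matrix.exists_ne_zero_int_vec_norm_le A h h0
    refine ⟨t, ht, hAt, fun j => ?_⟩
    have hAB : max 1 ‖A‖ ≤ B := by
      refine max_le hB ((Matrix.norm_le_iff (zero_le_one.trans hB)).2 fun i j => ?_)
      rw [Int.norm_eq_abs]
      exact hA i j
    rw [← Int.norm_eq_abs]
    refine (norm_le_pi_norm t j).trans (hn.trans ?_)
    have hαβ : (1 : ℝ) ≤ Fintype.card β - Fintype.card α := by
      have : (Fintype.card α : ℝ) + 1 ≤ Fintype.card β := by exact_mod_cast h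
      linarith
    calc (Fintype.card β * max 1 ‖A‖) ^
          ((Fintype.card α : ℝ) / (Fintype.card β - Fintype.card α))
        ≤ (Fintype.card β * B) ^ ((Fintype.card α : ℝ) / (Fintype.card β - Fintype.card α)) := by
          gcongr
      _ ≤ (Fintype.card β * B) ^ (Fintype.card β : ℝ) := by
          refine Real.rpow_le_rpow_of_exponent_le h1 ?_
          refine (div_le_self (Nat.cast_nonneg _) hαβ).trans ?_
          exact_mod_cast h.le
      _ = _ := Real.rpow_natCast _ _

/-- Either there are few integral zeros of `F` in the box, or `F` can be replaced with a polynomial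
having small coefficients. -/
lemma card_le_or_exists_small_coeff {F : MvPolynomial (Fin 2) ℤ}
    (hF : Irreducible (map (Int.castRingHom ℂ) F)) {H : ℝ} (hH : 1 ≤ H) {T : Finset (ℤ × ℤ)}
    (hT : ∀ P ∈ T, eval ![P.1, P.2] F = 0) (hTx : ∀ P ∈ T, |(P.1 : ℝ)| ≤ H)
    (hTy : ∀ P ∈ T, |(P.2 : ℝ)| ≤ H) :
    T.card ≤ (F.totalDegree * F.totalDegree) ^ 2 ∨
      ∃ F' : MvPolynomial (Fin 2) ℤ, Irreducible (map (Int.castRingHom ℂ) F') ∧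
        F'.totalDegree = F.totalDegree ∧ (∀ P ∈ T, eval ![P.1, P.2] F' = 0) ∧
        ∀ e, |((F'.coeff e : ℤ) : ℝ)| ≤ ((lowDegree F.totalDegree).card * H ^ F.totalDegree) ^
          (lowDegree F.totalDegree).card := by
  classical
  set d := F.totalDegree with hd
  set S := lowDegree d with hS
  let M := monomialMatrix S (fun P : T => (P : ℤ × ℤ))
  let v : T → S → ℂ := fun P e => (M P e : ℂ)
  let φ (c : S → ℂ) : (S → ℂ) →ₗ[ℂ] ℂ := ∑ e, c e • LinearMap.proj e
  have hφ : ∀ c x, φ c x = ∑ e, c e * x e := by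
    intro c x
    simp [φ]
  have hF0 : F ≠ 0 := by
    rintro rfl
    exact hF.ne_zero (map_zero _)
  have hFS : F = ofCoeffs S fun e => F.coeff e.1 := by
    ext e
    by_cases he : e ∈ S
    · exact (coeff_ofCoeffs (fun e : S => F.coeff e.1) ⟨e, he⟩).symm
    · rw [notMem_support_iff.1 fun h => he (support_ofCoeffs_subset _ h)]
      by_contra h
      apply he
      rw [hS, mem_lowDegree, Finsupp.degree_eq_sum,
        ← Finsupp.sum_fintype _ (fun _ k => k) (by simp)]
      exact le_totalDegree (mem_support_iff.2 h)
  have hmap : ∀ c : S → ℤ, map (Int.castRingHom ℂ) (ofCoeffs S c) =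
      ofCoeffs S fun e => (c e : ℂ) := by
    intro c
    simp [ofCoeffs, map_monomial]
  have hzero : ∀ c : S → ℤ, ∀ P : T, φ (fun e => (c e : ℂ)) (v P) =
      ((eval ![P.1.1, P.1.2] (ofCoeffs S c) : ℤ) : ℂ) := by
    intro c P
    rw [hφ, ← eval_map_intCast, hmap]
    exact (eval_ofCoeffs_eq_sum_monomialMatrix (fun P : T => (P : ℤ × ℤ)) P _).symm
  have hspan : Submodule.span ℂ (Set.range v) ≠ ⊤ := by
    intro htop
    have hle : Submodule.span ℂ (Set.range v) ≤
        LinearMap.ker (φ fun e => ((F.coeff e.1 : ℤ) : ℂ)) := by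
      refine Submodule.span_le.2 ?_
      rintro _ ⟨P, rfl⟩
      rw [SetLike.mem_coe, LinearMap.mem_ker, hzero, ← hFS, hT _ P.2, Int.cast_zero]
    rw [htop] at hle
    apply hF0
    rw [hFS]
    have h0 : (fun e : S => F.coeff e.1) = 0 := by
      ext e
      have := LinearMap.mem_ker.1 (hle (Submodule.mem_top (x := Pi.single e (1 : ℂ))))
      rw [hφ, Finset.sum_eq_single e (fun b _ hb => by simp [hb]) (by simp)] at this
      simpa using this
    rw [h0]
    simp [ofCoeffs]
  obtain ⟨κ, a, ha, hsp, hli⟩ := exists_linearIndependent' ℂ v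
  have : Finite κ := Finite.of_injective a ha
  have := Fintype.ofFinite κ
  have hκ : Fintype.card κ < Fintype.card S := by
    rw [← finrank_span_eq_card hli, hsp, ← Module.finrank_fintype_fun_eq_card ℂ]
    exact Submodule.finrank_lt hspan
  obtain ⟨t, ht, hMt, htb⟩ := exists_small_int_vec (M.submatrix a id) hκ (B := H ^ d)
    (one_le_pow₀ hH) (fun i e => (abs_monomialMatrix_le (hTx _ (a i).2) (hTy _ (a i).2) e).trans
      (pow_le_pow_right₀ hH (mem_lowDegree.1 e.2)))
  rw [Fintype.card_coe] at htb
  have htT : ∀ P ∈ T, eval ![P.1, P.2] (ofCoeffs S t) = 0 := by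
    have hle : Submodule.span ℂ (Set.range v) ≤ LinearMap.ker (φ fun e => (t e : ℂ)) := by
      rw [← hsp, Submodule.span_le]
      rintro _ ⟨k, rfl⟩
      have := congrFun hMt k
      rw [SetLike.mem_coe, LinearMap.mem_ker, hφ]
      simp only [Matrix.mulVec, dotProduct, Matrix.submatrix_apply, id, Pi.zero_apply] at this
      have := congrArg (Int.cast : ℤ → ℂ) this
      rw [Int.cast_sum, Int.cast_zero] at this
      rw [← this]
      refine Finset.sum_congr rfl fun e _ => ?_
      rw [Int.cast_mul, mul_comm]
      rfl
    intro P hP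
    have := hle (Submodule.subset_span ⟨⟨P, hP⟩, rfl⟩)
    rw [LinearMap.mem_ker, hzero] at this
    exact_mod_cast this
  have hdeg : (map (Int.castRingHom ℂ) (ofCoeffs S t)).totalDegree ≤ d := by
    rw [totalDegree_map_intCast]
    exact totalDegree_ofCoeffs_le (fun e he => mem_lowDegree.1 he) t
  by_cases hdvd : map (Int.castRingHom ℂ) F ∣ map (Int.castRingHom ℂ) (ofCoeffs S t)
  · right
    have h0 : map (Int.castRingHom ℂ) (ofCoeffs S t) ≠ 0 := by
      rw [Ne, map_eq_zero_iff _ (map_injective _ (RingHom.injective_int _))]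
      exact ofCoeffs_ne_zero ht
    obtain ⟨G, hG⟩ := hdvd
    have hG0 : G ≠ 0 := by
      rintro rfl
      exact h0 (by rw [hG, mul_zero])
    have hdegG := hdeg
    rw [hG, totalDegree_mul_of_isDomain hF.ne_zero hG0, totalDegree_map_intCast] at hdegG
    have hGd : G.totalDegree = 0 := by omega
    have hGu : IsUnit G := by
      rw [totalDegree_eq_zero_iff_eq_C.1 hGd] at hG0 ⊢
      exact (isUnit_iff_ne_zero.2 fun h => hG0 (by rw [h, map_zero])).map C
    refine ⟨ofCoeffs S t, ?_, ?_, htT, fun e => ?_⟩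
    · rw [hG]
      exact (irreducible_mul_isUnit hGu).2 hF
    · rw [← totalDegree_map_intCast, hG, totalDegree_mul_of_isDomain hF.ne_zero hG0, hGd,
        totalDegree_map_intCast, add_zero]
    · by_cases he : e ∈ S
      · rw [coeff_ofCoeffs t ⟨e, he⟩]
        exact htb _
      · rw [notMem_support_iff.1 fun h => he (support_ofCoeffs_subset _ h), Int.cast_zero, abs_zero]
        exact pow_nonneg (mul_nonneg (Nat.cast_nonneg _) (pow_nonneg (zero_le_one.trans hH) _)) _
  · left
    have := card_common_zeros_le hF hdvd hdeg T
      (fun P hP => by rw [eval_map_intCast, hT P hP, Int.cast_zero])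
      (fun P hP => by rw [eval_map_intCast, htT P hP, Int.cast_zero])
    rwa [totalDegree_map_intCast] at this

lemma degree_le_totalDegree {F : MvPolynomial (Fin 2) ℤ} {e : Fin 2 →₀ ℕ} (he : F.coeff e ≠ 0) :
    e.degree ≤ F.totalDegree := by
  rw [Finsupp.degree_eq_sum, ← Finsupp.sum_fintype _ (fun _ k => k) (by simp)]
  exact le_totalDegree (mem_support_iff.2 he)

lemma degree_lt_of_coeff_pderiv_ne_zero {F : MvPolynomial (Fin 2) ℤ} {e : Fin 2 →₀ ℕ}
    (he : (pderiv 1 F).coeff e ≠ 0) : e.degree < F.totalDegree := by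
  rw [coeff_pderiv] at he
  have := degree_le_totalDegree (left_ne_zero_of_mul he)
  rwa [map_add, Finsupp.degree_single] at this

lemma totalDegree_pderiv_lt {F : MvPolynomial (Fin 2) ℤ} (hF : pderiv 1 F ≠ 0) :
    (pderiv 1 F).totalDegree < F.totalDegree := by
  obtain ⟨e, he⟩ := ne_zero_iff.1 hF
  have h := degree_lt_of_coeff_pderiv_ne_zero he
  refine (Finset.sup_lt_iff (bot_lt_of_lt h)).2 fun e he => ?_
  have := degree_lt_of_coeff_pderiv_ne_zero (mem_support_iff.1 he)
  rwa [Finsupp.degree_eq_sum, ← Finsupp.sum_fintype _ (fun _ k => k) (by simp)] at this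

lemma not_dvd_of_totalDegree_lt {F A : MvPolynomial (Fin 2) ℂ} (hA : A ≠ 0)
    (h : A.totalDegree < F.totalDegree) : ¬ F ∣ A := by
  rintro ⟨G, rfl⟩
  rw [totalDegree_mul_of_isDomain (left_ne_zero_of_mul hA) (right_ne_zero_of_mul hA)] at h
  omega

lemma natDegree_aeval_C_X_le (F : MvPolynomial (Fin 2) ℤ) (x : ℤ) :
    (aeval ![Polynomial.C x, Polynomial.X] F : Polynomial ℤ).natDegree ≤ F.totalDegree := by
  rw [aeval_def, eval₂_eq']
  refine Polynomial.natDegree_sum_le_of_forall_le _ _ fun e he => ?_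
  refine le_trans ?_ (degree_le_totalDegree (mem_support_iff.1 he))
  rw [Finsupp.degree_eq_sum, Fin.prod_univ_two, Fin.sum_univ_two]
  simp only [Matrix.cons_val_zero, Matrix.cons_val_one]
  rw [← Polynomial.C_pow, ← mul_assoc]
  refine (Polynomial.natDegree_mul_le_of_le (m := 0) ?_ (Polynomial.natDegree_X_pow_le _)).trans
    (by omega)
  rw [Polynomial.algebraMap_apply, ← Polynomial.C_mul, Polynomial.natDegree_C]

lemma pderiv_ne_zero_of_eval_eq_zero {F : MvPolynomial (Fin 2) ℤ}
    (hF : Irreducible (map (Int.castRingHom ℂ) F)) (hd : 2 ≤ F.totalDegree) {a b : ℤ}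
    (hab : eval ![a, b] F = 0) : pderiv 1 F ≠ 0 := by
  intro h0
  have hder := derivative_aeval_C_X F a
  rw [h0, map_zero] at hder
  have hC := Polynomial.eq_C_of_derivative_eq_zero hder
  have hval : ∀ y : ℤ, eval ![a, y] F = 0 := by
    intro y
    rw [← hab, ← eval_aeval_C_X, ← eval_aeval_C_X, hC, Polynomial.eval_C, Polynomial.eval_C]
  have hA : (X 0 - C (a : ℂ) : MvPolynomial (Fin 2) ℂ).totalDegree ≤ 1 :=
    (totalDegree_sub_C_le _ _).trans (totalDegree_X _).le
  have hA0 : (X 0 - C (a : ℂ) : MvPolynomial (Fin 2) ℂ) ≠ 0 := by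
    intro h
    have := congrArg (eval ![(a : ℂ) + 1, 0]) h
    simp at this
  have hdvd : ¬ map (Int.castRingHom ℂ) F ∣ X 0 - C (a : ℂ) := by
    refine not_dvd_of_totalDegree_lt hA0 ?_
    rw [totalDegree_map_intCast]
    omega
  have hinj : Function.Injective fun k : ℕ => (a, (k : ℤ)) := fun k l hkl => by
    simpa using hkl
  have := card_common_zeros_le hF hdvd hA
    ((Finset.range ((F.totalDegree * 1) ^ 2 + 1)).image fun k : ℕ => (a, (k : ℤ)))
    (fun P hP => by
      obtain ⟨k, -, rfl⟩ := Finset.mem_image.1 hP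
      rw [eval_map_intCast, hval, Int.cast_zero])
    (fun P hP => by
      obtain ⟨k, -, rfl⟩ := Finset.mem_image.1 hP
      simp)
  rw [Finset.card_image_of_injective _ hinj, Finset.card_range, totalDegree_map_intCast] at this
  omega

lemma card_singular_le {F : MvPolynomial (Fin 2) ℤ}
    (hF : Irreducible (map (Int.castRingHom ℂ) F)) (hd : 2 ≤ F.totalDegree) {T : Finset (ℤ × ℤ)}
    (hT : ∀ P ∈ T, eval ![P.1, P.2] F = 0) (hT' : ∀ P ∈ T, eval ![P.1, P.2] (pderiv 1 F) = 0) :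
    T.card ≤ (F.totalDegree * F.totalDegree) ^ 2 := by
  rcases T.eq_empty_or_nonempty with rfl | ⟨P, hP⟩
  · simp
  have h0 := pderiv_ne_zero_of_eval_eq_zero hF hd (hT P hP)
  have hlt := totalDegree_pderiv_lt h0
  have hdvd : ¬ map (Int.castRingHom ℂ) F ∣ map (Int.castRingHom ℂ) (pderiv 1 F) := by
    refine not_dvd_of_totalDegree_lt ?_ (by rwa [totalDegree_map_intCast, totalDegree_map_intCast])
    rwa [Ne, map_eq_zero_iff _ (map_injective _ (RingHom.injective_int _))]
  have := card_common_zeros_le hF hdvd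
    ((totalDegree_map_intCast (pderiv 1 F)).le.trans hlt.le) T
    (fun P hP => by rw [eval_map_intCast, hT P hP, Int.cast_zero])
    (fun P hP => by rw [eval_map_intCast, hT' P hP, Int.cast_zero])
  rwa [totalDegree_map_intCast] at this

/-- The number of residue classes modulo `p` of zeros of `F` with `∂F/∂y ≠ 0` is at most
`deg F * p`. -/
lemma card_le_of_card_residue_class_le {F : MvPolynomial (Fin 2) ℤ} {p : ℕ} (hp : p.Prime)
    {T : Finset (ℤ × ℤ)} (hT : ∀ P ∈ T, eval ![P.1, P.2] F = 0)
    (hT' : ∀ P ∈ T, ¬ (p : ℤ) ∣ eval ![P.1, P.2] (pderiv 1 F)) {N : ℕ}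
    (hN : ∀ P ∈ T, ∀ U ⊆ T, (∀ Q ∈ U, (p : ℤ) ∣ Q.1 - P.1) → (∀ Q ∈ U, (p : ℤ) ∣ Q.2 - P.2) →
      U.card ≤ N) :
    T.card ≤ N * (F.totalDegree * p) := by
  classical
  have : Fact p.Prime := ⟨hp⟩
  let r : ℤ × ℤ → ZMod p × ZMod p := fun P => (P.1, P.2)
  refine (Finset.card_le_mul_card_image (f := r) T N fun b hb => ?_).trans
    (Nat.mul_le_mul_left _ ?_)
  · obtain ⟨P, hP, rfl⟩ := Finset.mem_image.1 hb
    refine hN P hP _ (Finset.filter_subset _ _) (fun Q hQ => ?_) fun Q hQ => ?_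
    · rw [← (ZMod.intCast_eq_intCast_iff_dvd_sub _ _ _)]
      exact (Prod.ext_iff.1 (Finset.mem_filter.1 hQ).2).1.symm
    · rw [← (ZMod.intCast_eq_intCast_iff_dvd_sub _ _ _)]
      exact (Prod.ext_iff.1 (Finset.mem_filter.1 hQ).2).2.symm
  · refine (Finset.card_le_mul_card_image_of_maps_to (f := Prod.fst) (t := Finset.univ)
      (fun _ _ => Finset.mem_univ _) F.totalDegree fun a _ => ?_).trans_eq
        (by rw [Finset.card_univ, ZMod.card])
    set V := (T.image r).filter fun b => b.1 = a
    rcases V.eq_empty_or_nonempty with hV | ⟨b, hb⟩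
    · simp [hV]
    obtain ⟨hb, hba⟩ := Finset.mem_filter.1 hb
    obtain ⟨P, hP, rfl⟩ := Finset.mem_image.1 hb
    set g : Polynomial ℤ := aeval ![Polynomial.C P.1, Polynomial.X] F with hg
    have hg0 : g.map (Int.castRingHom (ZMod p)) ≠ 0 := by
      intro h
      apply hT' P hP
      have h1 := congrArg (fun q => (Polynomial.derivative q).eval ((P.2 : ℤ) : ZMod p)) h
      simp only [Polynomial.derivative_map, Polynomial.derivative_zero, Polynomial.eval_zero,
        Polynomial.eval_intCast_map, hg, derivative_aeval_C_X, eval_aeval_C_X] at h1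
      exact (ZMod.intCast_zmod_eq_zero_iff_dvd _ _).1 h1
    have hsub : V.image Prod.snd ⊆ (g.map (Int.castRingHom (ZMod p))).roots.toFinset := by
      intro y hy
      obtain ⟨b, hb', rfl⟩ := Finset.mem_image.1 hy
      obtain ⟨hb', hba'⟩ := Finset.mem_filter.1 hb'
      obtain ⟨Q, hQ, rfl⟩ := Finset.mem_image.1 hb'
      rw [Multiset.mem_toFinset, Polynomial.mem_roots hg0, Polynomial.IsRoot]
      change Polynomial.eval ((Q.2 : ℤ) : ZMod p) _ = 0
      rw [Polynomial.eval_intCast_map, hg, eval_aeval_C_X, eq_intCast,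
        ZMod.intCast_zmod_eq_zero_iff_dvd]
      have hd := dvd_eval_sub_eval (q := (p : ℤ)) (x := P.1) (x' := Q.1) (y := Q.2) (y' := Q.2)
        ((ZMod.intCast_eq_intCast_iff_dvd_sub _ _ _).1 (hba'.trans hba.symm)) (by simp) F
      rwa [hT Q hQ, sub_zero] at hd
    have hinj : Set.InjOn Prod.snd (V : Set (ZMod p × ZMod p)) := by
      intro b hb c hc hbc
      exact Prod.ext ((Finset.mem_filter.1 hb).2.trans (Finset.mem_filter.1 hc).2.symm) hbc
    rw [← Finset.card_image_of_injOn hinj]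
    exact (Finset.card_le_card hsub).trans ((Multiset.toFinset_card_le _).trans
      ((Polynomial.card_roots' _).trans (Polynomial.natDegree_map_le.trans
        (natDegree_aeval_C_X_le F P.1))))

lemma abs_eval_pderiv_le {F : MvPolynomial (Fin 2) ℤ} {H B : ℝ} (hH : 1 ≤ H)
    (hB : ∀ e, |((F.coeff e : ℤ) : ℝ)| ≤ B) {x y : ℤ} (hx : |(x : ℝ)| ≤ H) (hy : |(y : ℝ)| ≤ H) :
    |((eval ![x, y] (pderiv 1 F) : ℤ) : ℝ)| ≤
      (lowDegree F.totalDegree).card * (B * F.totalDegree * H ^ F.totalDegree) := by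
  have hB0 : 0 ≤ B := (abs_nonneg _).trans (hB 0)
  have hH0 : 0 ≤ H := zero_le_one.trans hH
  rw [eval_eq', Int.cast_sum]
  refine (Finset.abs_sum_le_sum_abs _ _).trans ?_
  refine (Finset.sum_le_card_nsmul _ _ (B * F.totalDegree * H ^ F.totalDegree)
    fun e he => ?_).trans ?_
  · have hlt := degree_lt_of_coeff_pderiv_ne_zero (mem_support_iff.1 he)
    have hle : (e 1 : ℝ) + 1 ≤ F.totalDegree := by
      rw [Finsupp.degree_eq_sum, Fin.sum_univ_two] at hlt
      exact_mod_cast (by omega : e 1 + 1 ≤ F.totalDegree)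
    have hmon : |(x : ℝ)| ^ e 0 * |(y : ℝ)| ^ e 1 ≤ H ^ F.totalDegree := by
      calc |(x : ℝ)| ^ e 0 * |(y : ℝ)| ^ e 1 ≤ H ^ e 0 * H ^ e 1 := by gcongr
        _ = H ^ e.degree := by rw [Finsupp.degree_eq_sum, Fin.sum_univ_two, pow_add]
        _ ≤ _ := pow_le_pow_right₀ hH hlt.le
    rw [coeff_pderiv, Fin.prod_univ_two]
    simp only [Matrix.cons_val_zero, Matrix.cons_val_one, Int.cast_mul, Int.cast_pow, abs_mul,
      abs_pow]
    have h1 : |(((e 1 : ℤ) + 1 : ℤ) : ℝ)| = e 1 + 1 := by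
      push_cast
      exact abs_of_nonneg (by positivity)
    have h2 := hB (e + Finsupp.single 1 1)
    refine mul_le_mul (mul_le_mul h2 ?_ (abs_nonneg _) hB0) hmon (by positivity) (by positivity)
    push_cast at h1 ⊢
    rw [h1]
    exact hle
  · rw [nsmul_eq_mul]
    refine mul_le_mul_of_nonneg_right ?_ (by positivity)
    refine Nat.cast_le.2 (Finset.card_le_card fun e he => mem_lowDegree.2 ?_)
    exact (degree_lt_of_coeff_pderiv_ne_zero (mem_support_iff.1 he)).le

lemma exists_primes {N : ℕ} (hN : N ≠ 0) :
    ∃ q : ℕ → ℕ, Function.Injective q ∧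
      ∀ i, (q i).Prime ∧ N < q i ∧ q i ≤ 2 ^ (i + 1) * N := by
  have h : ∀ i, 2 ^ i * N ≠ 0 := fun i => by positivity
  choose q hq hlt hle using fun i => Nat.exists_prime_lt_and_le_two_mul (2 ^ i * N) (h i)
  have hle' : ∀ i, q i ≤ 2 ^ (i + 1) * N := fun i => (hle i).trans_eq (by ring)
  refine ⟨q, (strictMono_nat_of_lt_succ fun i => (hle' i).trans_lt (hlt _)).injective,
    fun i => ⟨hq i, ?_, hle' i⟩⟩
  exact (Nat.le_mul_of_pos_left N (by positivity)).trans_lt (hlt i)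

lemma exists_not_dvd_of_abs_lt {N : ℕ} {q : ℕ → ℕ} (hq : Function.Injective q)
    (hqp : ∀ i, (q i).Prime ∧ N < q i) {K : ℕ} {z : ℤ} (hz : z ≠ 0)
    (hzN : |(z : ℝ)| < (N : ℝ) ^ K) : ∃ i ∈ Finset.range K, ¬ (q i : ℤ) ∣ z := by
  by_contra! h
  have hdvd : ∏ p ∈ (Finset.range K).image q, p ∣ z.natAbs := by
    refine Finset.prod_primes_dvd _ (fun p hp => ?_) fun p hp => ?_
    · obtain ⟨i, -, rfl⟩ := Finset.mem_image.1 hp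
      exact (hqp i).1.prime
    · obtain ⟨i, hi, rfl⟩ := Finset.mem_image.1 hp
      exact Int.natCast_dvd.1 (h i hi)
  rw [Finset.prod_image hq.injOn] at hdvd
  have h1 := Nat.le_of_dvd (Int.natAbs_pos.2 hz) hdvd
  have h2 : N ^ K ≤ ∏ i ∈ Finset.range K, q i := by
    simpa using Finset.prod_le_prod' (f := fun _ => N) fun i (_ : i ∈ Finset.range K) =>
      (hqp i).2.le
  have h3 : ((N ^ K : ℕ) : ℝ) ≤ (z.natAbs : ℝ) := by exact_mod_cast h2.trans h1
  rw [Nat.cast_natAbs, Int.cast_abs, Nat.cast_pow] at h3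
  exact absurd h3 hzN.not_ge

/-- The numerical input of the determinant method. -/
lemma exists_degree_factorial_mul_pow_lt {d : ℕ} (hd : 1 ≤ d) {ε : ℝ} (hε : 0 < ε) :
    ∃ n : ℕ, ∃ H₁ : ℝ, ∀ H : ℝ, 1 ≤ H → H₁ ≤ H → ∀ l : Fin 2 →₀ ℕ, l.degree = d →
      ∀ p : ℝ, H ^ (1 / (d : ℝ) + ε) ≤ p →
        (standardMonomials n l).card.factorial * H ^ (∑ e ∈ standardMonomials n l, e.degree) <
          p ^ ((standardMonomials n l).card * ((standardMonomials n l).card - 1) / 2) := by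
  have hd0 : (0 : ℝ) < d := by exact_mod_cast hd
  obtain ⟨m, hm⟩ := exists_nat_ge
    (max 1 (((2 * d + 1) + d * (d + 1) + 2) / (ε * d) : ℝ))
  have hm1 : (1 : ℝ) ≤ m := (le_max_left _ _).trans hm
  have hm2 := (le_max_right _ _).trans hm
  rw [div_le_iff₀ (by positivity)] at hm2
  refine ⟨m + d, ((d * m + d * (d + 3)).factorial : ℝ) + 1, fun H hH hH₁ l hl p hp => ?_⟩
  have hcard := card_standardMonomials m l
  have hsum := sum_degree_standardMonomials m l
  rw [hl] at hcard hsum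
  set s := (standardMonomials (m + d) l).card
  set E := ∑ e ∈ standardMonomials (m + d) l, e.degree
  have hs1 : s ≤ d * m + d * (d + 3) := by nlinarith
  have hs2 : d * m + 1 ≤ s := by nlinarith
  set W := s * (s - 1) / 2
  have hW : (d * m) * (d * m) ≤ 2 * W := by
    have h2 : 2 * W = s * (s - 1) := Nat.mul_div_cancel' (Nat.even_mul_pred_self s).two_dvd
    rw [h2]
    exact Nat.mul_le_mul (by omega) (by omega)
  have hW' : ((d : ℝ) * m) * (d * m) ≤ 2 * W := by exact_mod_cast hW
  have hE' : (2 : ℝ) * E ≤ d * (m + d) * (m + d + 1) := by exact_mod_cast hsum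
  have hα : 0 < 1 / (d : ℝ) + ε := by positivity
  have hexp : (E : ℝ) + 1 ≤ (1 / (d : ℝ) + ε) * W := by
    have h1 : (1 / (d : ℝ) + ε) * ((d * m) * (d * m)) = d * m * m + ε * d * m * (d * m) := by
      field_simp
    have h2 : (1 / (d : ℝ) + ε) * ((d * m) * (d * m)) ≤ (1 / (d : ℝ) + ε) * (2 * W) := by gcongr
    have h3 : ((2 * d + 1) + d * (d + 1) + 2 : ℝ) * (d * m) ≤ m * (ε * d) * (d * m) := by gcongr
    have hd1 : (1 : ℝ) ≤ d := by exact_mod_cast hd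
    have hdm : (1 : ℝ) ≤ d * m := one_le_mul_of_one_le_of_one_le hd1 hm1
    have h4 : (d : ℝ) * d * (d + 1) ≤ d * (d + 1) * (d * m) := by
      have : (0 : ℝ) ≤ d * d * (d + 1) * (m - 1) :=
        mul_nonneg (by positivity) (by linarith)
      linarith
    linarith
  calc (s.factorial : ℝ) * H ^ E < H * H ^ E := by
        have : (s.factorial : ℝ) ≤ (d * m + d * (d + 3)).factorial := by
          exact_mod_cast Nat.factorial_le hs1
        gcongr
        linarith
    _ = H ^ ((E : ℝ) + 1) := by
        rw [Real.rpow_add (by positivity), Real.rpow_natCast, Real.rpow_one, mul_comm]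
    _ ≤ H ^ ((1 / (d : ℝ) + ε) * W) := Real.rpow_le_rpow_of_exponent_le hH hexp
    _ = (H ^ (1 / (d : ℝ) + ε)) ^ W := Real.rpow_mul_natCast (by positivity) _ _
    _ ≤ p ^ W := by gcongr

/-- The bound for polynomials whose coefficients are polynomially bounded in `H`. -/
lemma card_le_of_coeff_le {d : ℕ} (hd : 2 ≤ d) {ε : ℝ} (hε : 0 < ε) :
    ∃ c H₀ : ℝ, 0 ≤ c ∧ ∀ F : MvPolynomial (Fin 2) ℤ, F.totalDegree = d →
      Irreducible (map (Int.castRingHom ℂ) F) → ∀ H : ℝ, 1 ≤ H → H₀ ≤ H →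
        (∀ e, |((F.coeff e : ℤ) : ℝ)| ≤
          ((lowDegree d).card * H ^ d) ^ (lowDegree d).card) → ∀ T : Finset (ℤ × ℤ),
        (∀ P ∈ T, eval ![P.1, P.2] F = 0) → (∀ P ∈ T, |(P.1 : ℝ)| ≤ H) →
        (∀ P ∈ T, |(P.2 : ℝ)| ≤ H) → (T.card : ℝ) ≤ c * H ^ (1 / (d : ℝ) + ε) := by
  classical
  obtain ⟨n, H₁, hn⟩ := exists_degree_factorial_mul_pow_lt (by omega : 1 ≤ d) hε
  set M := (lowDegree d).card
  set K := d * (d * M + d + 2)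
  refine ⟨((d * d) ^ 2 + K * ((d * n) ^ 2 * (d * (2 ^ K * 2))) : ℝ),
    max H₁ ((M : ℝ) * (M ^ M * d) + 1), by positivity,
    fun F hFd hF H hH hH₀ hcoeff T hT hTx hTy => ?_⟩
  have hd0 : (0 : ℝ) < d := by exact_mod_cast (by omega : 0 < d)
  set α := 1 / (d : ℝ) + ε with hα
  have hH0 : 0 < H := zero_lt_one.trans_le hH
  have hα0 : 0 ≤ α := by positivity
  have hHα : 1 ≤ H ^ α := Real.one_le_rpow hH hα0
  obtain ⟨N, hN⟩ : ∃ N : ℕ, N = ⌈H ^ α⌉₊ := ⟨_, rfl⟩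
  have hN1 : H ^ α ≤ N := hN ▸ Nat.le_ceil _
  have hN2 : (N : ℝ) ≤ 2 * H ^ α := by
    have := (Nat.ceil_lt_add_one (zero_le_one.trans hHα)).le
    rw [← hN] at this
    linarith
  have hN0 : N ≠ 0 := by
    rintro rfl
    rw [Nat.cast_zero] at hN1
    linarith
  obtain ⟨q, hq, hqp⟩ := exists_primes hN0
  have hder : ∀ P ∈ T, |((eval ![P.1, P.2] (pderiv 1 F) : ℤ) : ℝ)| < (N : ℝ) ^ K := by
    intro P hP
    have h := abs_eval_pderiv_le hH hcoeff (hTx P hP) (hTy P hP)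
    rw [hFd] at h
    calc _ ≤ _ := h
      _ = (M * (M ^ M * d)) * H ^ (d * M + d) := by
          rw [mul_pow, ← pow_mul, pow_add]
          ring
      _ < H * H ^ (d * M + d) := by
          gcongr
          linarith [(le_max_right _ _).trans hH₀]
      _ = H ^ (d * M + d + 1) := by ring
      _ ≤ H ^ (d * M + d + 2) := pow_le_pow_right₀ hH (by omega)
      _ = (H ^ (1 / (d : ℝ))) ^ K := by
          rw [pow_mul, ← Real.rpow_mul_natCast hH0.le, one_div, inv_mul_cancel₀ hd0.ne',
            Real.rpow_one]
      _ ≤ (N : ℝ) ^ K := by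
          gcongr
          exact (Real.rpow_le_rpow_of_exponent_le hH (by rw [hα]; linarith)).trans hN1
  set T₀ := T.filter fun P => eval ![P.1, P.2] (pderiv 1 F) = 0 with hT₀
  set U : ℕ → Finset (ℤ × ℤ) := fun i =>
    T.filter fun P => ¬ (q i : ℤ) ∣ eval ![P.1, P.2] (pderiv 1 F) with hU
  have hcover : T ⊆ T₀ ∪ (Finset.range K).biUnion U := by
    intro P hP
    by_cases h : eval ![P.1, P.2] (pderiv 1 F) = 0
    · exact Finset.mem_union_left _ (Finset.mem_filter.2 ⟨hP, h⟩)
    · obtain ⟨i, hi, hdvd⟩ := exists_not_dvd_of_abs_lt hq (fun i => ⟨(hqp i).1, (hqp i).2.1⟩) h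
        (hder P hP)
      exact Finset.mem_union_right _
        (Finset.mem_biUnion.2 ⟨i, hi, Finset.mem_filter.2 ⟨hP, hdvd⟩⟩)
  have hT₀card : T₀.card ≤ (d * d) ^ 2 := by
    have := card_singular_le hF (by omega) (T := T₀)
      (fun P hP => hT P (Finset.mem_filter.1 hP).1) fun P hP => (Finset.mem_filter.1 hP).2
    rwa [hFd] at this
  have hUcard : ∀ i ∈ Finset.range K, (U i).card ≤ (d * n) ^ 2 * (d * (2 ^ K * N)) := by
    intro i hi
    have hl : (MonomialOrder.degLex.degree (map (Int.castRingHom ℂ) F)).degree = d := by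
      rw [degree_degLexDegree, totalDegree_map_intCast, hFd]
    have hqi : H ^ α ≤ (q i : ℝ) := hN1.trans (by exact_mod_cast (hqp i).2.1.le)
    have h1 := card_le_of_card_residue_class_le (F := F) (hqp i).1 (T := U i) (N := (d * n) ^ 2)
      (fun P hP => hT P (Finset.mem_filter.1 hP).1) (fun P hP => (Finset.mem_filter.1 hP).2)
      fun P hP V hV hx hy => by
        have hVT : V ⊆ T := hV.trans (Finset.filter_subset _ _)
        have := card_residue_class_le hF (hqp i).1 (Finset.mem_filter.1 hP).2
          (fun Q hQ => hT Q (hVT hQ)) (fun Q hQ => hTx Q (hVT hQ)) (fun Q hQ => hTy Q (hVT hQ))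
          hx hy rfl (hn H hH ((le_max_left _ _).trans hH₀) _ hl _ hqi)
        rwa [hFd] at this
    rw [hFd] at h1
    refine h1.trans (Nat.mul_le_mul_left _ (Nat.mul_le_mul_left _ ((hqp i).2.2.trans ?_)))
    exact Nat.mul_le_mul_right _ (Nat.pow_le_pow_right (by norm_num) (Finset.mem_range.1 hi))
  have hTcard : T.card ≤ (d * d) ^ 2 + K * ((d * n) ^ 2 * (d * (2 ^ K * N))) := by
    refine (Finset.card_le_card hcover).trans ((Finset.card_union_le _ _).trans ?_)
    refine Nat.add_le_add hT₀card (Finset.card_biUnion_le.trans ?_)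
    refine (Finset.sum_le_card_nsmul _ _ _ hUcard).trans_eq ?_
    rw [Finset.card_range, smul_eq_mul]
  calc (T.card : ℝ) ≤ (d * d) ^ 2 + K * ((d * n) ^ 2 * (d * (2 ^ K * N))) := by
        exact_mod_cast hTcard
    _ ≤ (d * d) ^ 2 * H ^ α + K * ((d * n) ^ 2 * (d * (2 ^ K * (2 * H ^ α)))) := by
        gcongr
        exact le_mul_of_one_le_right (by positivity) hHα
    _ = _ := by ring

lemma exists_finset_zeros (F : MvPolynomial (Fin 2) ℤ) {H : ℝ} (hH : 0 ≤ H) :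
    ∃ T : Finset (ℤ × ℤ), (∀ P ∈ T, eval ![P.1, P.2] F = 0 ∧ |(P.1 : ℝ)| ≤ H ∧ |(P.2 : ℝ)| ≤ H) ∧
      (T.card : ℝ) ≤ (2 * H + 1) ^ 2 ∧
      Nat.card {P : ℤ × ℤ // eval ![P.1, P.2] F = 0 ∧ |(P.1 : ℝ)| ≤ H ∧ |(P.2 : ℝ)| ≤ H} =
        T.card := by
  classical
  set I := Finset.Icc (-⌊H⌋) ⌊H⌋
  have hI : ∀ x : ℤ, |(x : ℝ)| ≤ H ↔ x ∈ I := by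
    intro x
    rw [Finset.mem_Icc, ← abs_le, Int.le_floor, Int.cast_abs]
  refine ⟨(I ×ˢ I).filter fun P => eval ![P.1, P.2] F = 0, fun P hP => ?_, ?_, ?_⟩
  · obtain ⟨hP, h0⟩ := Finset.mem_filter.1 hP
    rw [hI, hI]
    exact ⟨h0, Finset.mem_product.1 hP⟩
  · have hcard : (I.card : ℝ) ≤ 2 * H + 1 := by
      have h1 : (I.card : ℤ) = 2 * ⌊H⌋ + 1 := by
        have := Int.floor_nonneg.2 hH
        rw [Int.card_Icc, Int.toNat_of_nonneg (by omega)]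
        ring
      have h2 : (I.card : ℝ) = 2 * ⌊H⌋ + 1 := by exact_mod_cast h1
      linarith [Int.floor_le H]
    calc _ ≤ ((I ×ˢ I).card : ℝ) := by exact_mod_cast Finset.card_filter_le _ _
      _ = (I.card : ℝ) ^ 2 := by rw [Finset.card_product, Nat.cast_mul, sq]
      _ ≤ _ := by gcongr
  · refine Nat.subtype_card _ fun P => ?_
    rw [Finset.mem_filter, Finset.mem_product, hI, hI]
    exact and_comm

end BombieriPila

/-- (Bombieri–Pila, 1989.) Let `F ∈ ℤ[x₁,x₂]` be absolutely
irreducible of total degree `d ≥ 2`. Then the number of integer points on the curve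
`F = 0` in the box `[−H,H]²` is `O_{d,ε}(H^{1/d+ε})`. -/
theorem bombieri_pila (d : ℕ) (hd : 2 ≤ d) (ε : ℝ) (hε : 0 < ε) :
    ∃ c : ℝ, 0 < c ∧
      ∀ F : MvPolynomial (Fin 2) ℤ, F.totalDegree = d →
        Irreducible (MvPolynomial.map (Int.castRingHom ℂ) F) →
        ∀ H : ℝ, 2 ≤ H →
          (Nat.card {p : ℤ × ℤ //
              MvPolynomial.eval ![p.1, p.2] F = 0 ∧ |(p.1 : ℝ)| ≤ H ∧ |(p.2 : ℝ)| ≤ H} : ℝ)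
            ≤ c * H ^ (1 / (d : ℝ) + ε) := by
  obtain ⟨c, H₀, hc, h⟩ := BombieriPila.card_le_of_coeff_le hd hε
  refine ⟨c + ((d * d) ^ 2 + (2 * |H₀| + 1) ^ 2), by positivity, fun F hFd hF H hH => ?_⟩
  obtain ⟨T, hT, hTH, hcard⟩ := BombieriPila.exists_finset_zeros F (zero_le_two.trans hH)
  rw [hcard]
  have hH1 : 1 ≤ H := one_le_two.trans hH
  have hHα : 1 ≤ H ^ (1 / (d : ℝ) + ε) := Real.one_le_rpow hH1 (by positivity)
  have hconst : ∀ b : ℝ, 0 ≤ b → b ≤ b * H ^ (1 / (d : ℝ) + ε) := fun b hb =>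
    le_mul_of_one_le_right hb hHα
  have h1 := hconst ((d * d) ^ 2) (by positivity)
  have h2 := hconst ((2 * |H₀| + 1) ^ 2) (by positivity)
  have h3 : 0 ≤ c * H ^ (1 / (d : ℝ) + ε) := mul_nonneg hc (zero_le_one.trans hHα)
  rw [add_mul, add_mul]
  rcases le_total H₀ H with hH₀ | hH₀
  · rcases BombieriPila.card_le_or_exists_small_coeff hF hH1 (fun P hP => (hT P hP).1)
      (fun P hP => (hT P hP).2.1) (fun P hP => (hT P hP).2.2) with hle | ⟨G, hG, hGd, hGT, hGc⟩
    · rw [hFd] at hle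
      have hle' : (T.card : ℝ) ≤ (d * d) ^ 2 := by exact_mod_cast hle
      nlinarith
    · rw [hFd] at hGd hGc
      have := h G hGd hG H hH1 hH₀ hGc T hGT (fun P hP => (hT P hP).2.1)
        fun P hP => (hT P hP).2.2
      nlinarith
  · have : (2 * H + 1) ^ 2 ≤ (2 * |H₀| + 1) ^ 2 := by
      have := hH₀.trans (le_abs_self H₀)
      gcongr
    nlinarith
end
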